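/- arXiv:1312.1330 — 3 statements merged into one kernel-verified Lean document; each statement's English description precedes it below -/
import Mathlib

section
/- Let R be Noetherian, 𝔞 an ideal, M a nonzero finitely generated R-module with c = cd(𝔞, M) finite, and {M_i} the cohomological dimension filtration. Then for 1 ≤ i ≤ c, Ass_R(M_i/M_{i−1}) = {𝔭 ∈ Ass_R(M) : cd(𝔞, R/𝔭) = i}. -/
open CategoryTheory

universe u

/-- `H^i_I(M) ≠ 0`: the `i`-th local cohomology of `M` with respect to `I` is nonzero. -/
abbrev LCNonzero {R : Type u} [CommRing R] (I : Ideal R) (i : ℕ)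
    (M : Type u) [AddCommGroup M] [Module R M] : Prop :=
  Nontrivial ((localCohomology I i).obj (ModuleCat.of R M))

/-- Cohomological dimension `cd(I, M) = sup {i : H^i_I(M) ≠ 0}`, as an element of
`WithBot ℕ∞` (it is `⊥` if all local cohomology of `M` vanishes). -/
noncomputable def cohDim {R : Type u} [CommRing R] (I : Ideal R)
    (M : Type u) [AddCommGroup M] [Module R M] : WithBot ℕ∞ :=
  sSup {n : WithBot ℕ∞ | ∃ i : ℕ, n = (i : ℕ∞) ∧ LCNonzero I i M}

/-- Krull dimension of a module, i.e. the Krull dimension of `R ⧸ Ann_R M`. -/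
noncomputable def modDim (R : Type u) [CommRing R]
    (M : Type u) [AddCommGroup M] [Module R M] : WithBot ℕ∞ :=
  ringKrullDim (R ⧸ Module.annihilator R M)


namespace StmtFive
open Limits Opposite

section bridge
variable {R : Type u} [CommRing R]

section abs
variable (K K' : ChainComplex (ModuleCat.{u} R)ᵒᵖ ℕ) (n : ℕ) {H H' : (ModuleCat.{u} R)ᵒᵖ}
  (e : H ≅ K.homology n) (e' : H' ≅ K'.homology n)

/-- The cochain `f` represents the class `ξ`. -/
def ARel (f : (K.X n).unop) (ξ : H.unop) : Prop :=
  ∃ z : (K.opcycles n).unop, (K.pOpcycles n).unop.hom z = f ∧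
    (e.hom ≫ K.homologyι n).unop.hom z = ξ

lemma arel_exists (ξ : H.unop) : ∃ f, ARel K n e f ξ := by
  have : Epi (e.hom ≫ K.homologyι n).unop := by
    have : Mono (e.hom ≫ K.homologyι n) := mono_comp _ _
    infer_instance
  obtain ⟨z, hz⟩ := (ModuleCat.epi_iff_surjective _).1 this ξ
  exact ⟨_, z, rfl, hz⟩

lemma arel_cocycle (f : (K.X n).unop) (ξ : H.unop) (h : ARel K n e f ξ) (m : ℕ) :
    (K.d m n).unop.hom f = 0 := by
  obtain ⟨z, rfl, -⟩ := h
  have h1 : (K.pOpcycles n).unop ≫ (K.d m n).unop = 0 := by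
    rw [← unop_comp, HomologicalComplex.d_pOpcycles]; rfl
  exact congrArg (fun k => k.hom z) h1

lemma cocycle_arel (f : (K.X n).unop) (hf : (K.d (n+1) n).unop.hom f = 0) :
    ∃ ξ, ARel K n e f ξ := by
  let S := ShortComplex.mk (K.d (n+1) n) (K.pOpcycles n) (by simp)
  have hS : S.Exact := ShortComplex.exact_of_g_is_cokernel _
    (K.opcyclesIsCokernel (n+1) n (by simp))
  have h2 := (ShortComplex.moduleCat_exact_iff _).1 hS.unop
  obtain ⟨z, hz⟩ := h2 f hf
  exact ⟨_, z, hz, rfl⟩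

lemma arel_zero (p : ℕ) (hp : p + 1 = n) (f : (K.X n).unop) (ξ : H.unop) (h : ARel K n e f ξ) :
    ξ = 0 ↔ ∃ g, (K.d n p).unop.hom g = f := by
  subst hp
  obtain ⟨z, rfl, rfl⟩ := h
  let S := ShortComplex.mk (e.hom ≫ K.homologyι (p+1)) (K.fromOpcycles (p+1) p) (by simp)
  have hS : S.Exact := by
    let S' := ShortComplex.mk (K.homologyι (p+1)) (K.fromOpcycles (p+1) p) (by simp)
    have hS' : S'.Exact := ShortComplex.exact_of_f_is_kernel _
      (K.homologyIsKernel (p+1) p (by simp))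
    let i : S ≅ S' := ShortComplex.isoMk e (Iso.refl _) (Iso.refl _)
      (by simp [S, S']) (by simp [S, S'])
    exact (ShortComplex.exact_iff_of_iso i).2 hS'
  have h2 := (ShortComplex.moduleCat_exact_iff _).1 hS.unop
  have hd : (K.fromOpcycles (p+1) p).unop ≫ (K.pOpcycles (p+1)).unop = (K.d (p+1) p).unop := by
    rw [← unop_comp, HomologicalComplex.p_fromOpcycles]
  have hinj : Function.Injective (K.pOpcycles (p+1)).unop.hom :=
    (ModuleCat.mono_iff_injective _).1 (inferInstance : Mono (K.pOpcycles (p+1)).unop)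
  constructor
  · intro h0
    obtain ⟨g, hg⟩ := h2 z h0
    refine ⟨g, ?_⟩
    have := congrArg (fun k => k.hom g) hd
    rw [← hg]
    exact this.symm
  · rintro ⟨g, hg⟩
    have h3 := congrArg (fun k => k.hom g) hd
    have h4 : (K.fromOpcycles (p+1) p).unop.hom g = z := hinj (h3.trans hg)
    have h5 : (K.fromOpcycles (p+1) p).unop ≫ (e.hom ≫ K.homologyι (p+1)).unop = 0 := by
      rw [← unop_comp, Category.assoc, HomologicalComplex.homologyι_comp_fromOpcycles, comp_zero]
      rfl
    rw [← h4]
    exact congrArg (fun k => k.hom g) h5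

lemma arel_map (ψ : K' ⟶ K) (g : H' ⟶ H)
    (hg : g ≫ e.hom = e'.hom ≫ HomologicalComplex.homologyMap ψ n)
    (f : (K.X n).unop) (ξ : H.unop) (h : ARel K n e f ξ) :
    ARel K' n e' ((ψ.f n).unop.hom f) (g.unop.hom ξ) := by
  obtain ⟨z, rfl, rfl⟩ := h
  refine ⟨(HomologicalComplex.opcyclesMap ψ n).unop.hom z, ?_, ?_⟩
  · have h1 : (HomologicalComplex.opcyclesMap ψ n).unop ≫ (K'.pOpcycles n).unop =
        (K.pOpcycles n).unop ≫ (ψ.f n).unop := by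
      rw [← unop_comp, ← unop_comp, HomologicalComplex.p_opcyclesMap]
    exact congrArg (fun k => k.hom z) h1
  · have h1 : (HomologicalComplex.opcyclesMap ψ n).unop ≫ (e'.hom ≫ K'.homologyι n).unop =
        (e.hom ≫ K.homologyι n).unop ≫ g.unop := by
      rw [← unop_comp, ← unop_comp, Category.assoc, ← HomologicalComplex.homologyι_naturality,
        ← Category.assoc, ← Category.assoc, hg]
    exact congrArg (fun k => k.hom z) h1
end abs

abbrev oldF (Y : ModuleCat.{u} R) : ModuleCat.{u} R ⥤ (ModuleCat.{u} R)ᵒᵖ :=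
  ((linearYoneda R (ModuleCat.{u} R)).obj Y).rightOp

abbrev oldK {X : ModuleCat.{u} R} (P : ProjectiveResolution X) (Y : ModuleCat.{u} R) :
    ChainComplex (ModuleCat.{u} R)ᵒᵖ ℕ :=
  ((oldF Y).mapHomologicalComplex _).obj P.complex

noncomputable abbrev OldE (n : ℕ) (X Y : ModuleCat.{u} R) : ModuleCat.{u} R :=
  (((oldF Y).leftDerived n).obj X).unop

def Rel {X : ModuleCat.{u} R} (P : ProjectiveResolution X) (Y : ModuleCat.{u} R) (n : ℕ)
    (f : P.complex.X n ⟶ Y) (ξ : OldE n X Y) : Prop :=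
  ARel (oldK P Y) n (P.isoLeftDerivedObj (oldF Y) n) f ξ

lemma rel_exists {X : ModuleCat.{u} R} (P : ProjectiveResolution X) (Y : ModuleCat.{u} R) (n : ℕ)
    (ξ : OldE n X Y) : ∃ f, Rel P Y n f ξ :=
  arel_exists (oldK P Y) n (P.isoLeftDerivedObj (oldF Y) n) ξ

lemma rel_cocycle {X : ModuleCat.{u} R} (P : ProjectiveResolution X) (Y : ModuleCat.{u} R) (n : ℕ)
    (f : P.complex.X n ⟶ Y) (ξ : OldE n X Y) (h : Rel P Y n f ξ) (m : ℕ) : P.complex.d m n ≫ f = 0 :=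
  arel_cocycle (oldK P Y) n (P.isoLeftDerivedObj (oldF Y) n) f ξ h m

lemma cocycle_rel {X : ModuleCat.{u} R} (P : ProjectiveResolution X) (Y : ModuleCat.{u} R) (n : ℕ)
    (f : P.complex.X n ⟶ Y) (hf : P.complex.d (n+1) n ≫ f = 0) : ∃ ξ, Rel P Y n f ξ :=
  cocycle_arel (oldK P Y) n (P.isoLeftDerivedObj (oldF Y) n) f hf

lemma rel_zero {X : ModuleCat.{u} R} (P : ProjectiveResolution X) (Y : ModuleCat.{u} R) (p n : ℕ)
    (hp : p + 1 = n)
    (f : P.complex.X n ⟶ Y) (ξ : OldE n X Y) (h : Rel P Y n f ξ) :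
    ξ = 0 ↔ ∃ g : P.complex.X p ⟶ Y, P.complex.d n p ≫ g = f :=
  arel_zero (oldK P Y) n (P.isoLeftDerivedObj (oldF Y) n) p hp f ξ h

lemma rel_map {X X' : ModuleCat.{u} R} (P : ProjectiveResolution X) (P' : ProjectiveResolution X')
    (Y : ModuleCat.{u} R) (n : ℕ) (g : X' ⟶ X) (φ : ProjectiveResolution.Hom P' P g)
    (f : P.complex.X n ⟶ Y) (ξ : OldE n X Y) (h : Rel P Y n f ξ) :
    Rel P' Y n (φ.hom.f n ≫ f) ((((oldF Y).leftDerived n).map g).unop.hom ξ) :=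
  arel_map (oldK P Y) (oldK P' Y) n _ _
    (((oldF Y).mapHomologicalComplex _).map φ.hom) _
    (P'.isoLeftDerivedObj_hom_naturality g P φ.hom
        (by simpa using! φ.hom_f_zero_comp_π_f_zero) (oldF Y) n) f ξ h

/-- Elementwise vanishing of local cohomology, in terms of `Abelian.Ext`. -/
def qmap {J J' : Ideal R} (h : J' ≤ J) : ModuleCat.of R (R ⧸ J') ⟶ ModuleCat.of R (R ⧸ J) :=
  ModuleCat.ofHom (Submodule.mapQ J' J LinearMap.id h)

def Van (I : Ideal R) (j : ℕ) (L : ModuleCat.{u} R) : Prop :=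
  ∀ (t : ℕ) (ξ : Abelian.Ext (ModuleCat.of R (R ⧸ I ^ t)) L j), ∃ (s : ℕ) (h : t ≤ s),
    (Abelian.Ext.mk₀ (qmap (Ideal.pow_le_pow_right (I := I) h))).comp ξ (zero_add j) = 0

def VanOld (I : Ideal R) (j : ℕ) (L : ModuleCat.{u} R) : Prop :=
  ∀ (t : ℕ) (ξ : OldE j (ModuleCat.of R (R ⧸ I ^ t)) L), ∃ (s : ℕ) (h : t ≤ s),
    (((oldF L).leftDerived j).map (qmap (Ideal.pow_le_pow_right (I := I) h))).unop.hom ξ = 0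

lemma exists_hom {X X' : ModuleCat.{u} R} (P : ProjectiveResolution X)
    (P' : ProjectiveResolution X') (g : X' ⟶ X) : Nonempty (ProjectiveResolution.Hom P' P g) :=
  ⟨⟨ProjectiveResolution.lift g P' P, by
    have := ProjectiveResolution.lift_commutes_zero g P' P
    simpa using! this⟩⟩

lemma van_iff_old (I : Ideal R) (p : ℕ) (L : ModuleCat.{u} R) :
    Van I (p+1) L ↔ VanOld I (p+1) L := by
  let P : ∀ X : ModuleCat.{u} R, ProjectiveResolution X := fun X => ProjectiveResolution.of X
  constructor
  · intro H t ξ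
    obtain ⟨f, hf⟩ := rel_exists (P _) L (p+1) ξ
    have hc := rel_cocycle _ _ _ _ _ hf (p+2)
    obtain ⟨s, h, hs⟩ := H t ((P _).extMk f (p+2) rfl hc)
    refine ⟨s, h, ?_⟩
    obtain ⟨φ⟩ := exists_hom (P _) (P _) (qmap (Ideal.pow_le_pow_right (I := I) h))
    rw [ProjectiveResolution.mk₀_comp_extMk _ _ _ _ φ,
      ProjectiveResolution.extMk_eq_zero_iff _ _ _ _ _ p rfl] at hs
    exact (rel_zero _ _ p _ rfl _ _ (rel_map _ (P _) _ _ _ φ _ _ hf)).2 hs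
  · intro H t ξ
    obtain ⟨f, hc, rfl⟩ := (P _).extMk_surjective ξ (p+2) rfl
    obtain ⟨ξ, hf⟩ := cocycle_rel (P _) L (p+1) f hc
    obtain ⟨s, h, hs⟩ := H t ξ
    refine ⟨s, h, ?_⟩
    obtain ⟨φ⟩ := exists_hom (P _) (P _) (qmap (Ideal.pow_le_pow_right (I := I) h))
    rw [ProjectiveResolution.mk₀_comp_extMk _ _ _ _ φ,
      ProjectiveResolution.extMk_eq_zero_iff _ _ _ _ _ p rfl]
    exact (rel_zero _ _ p _ rfl _ _ (rel_map _ (P _) _ _ _ φ _ _ hf)).1 hs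

lemma old_iff (I : Ideal R) (j : ℕ) (L : ModuleCat.{u} R) :
    VanOld I j L ↔ Subsingleton ((localCohomology I j).obj L) := by
  let D := localCohomology.diagram (localCohomology.idealPowersDiagram I) j
  let c : Cocone (D ⋙ (evaluation _ _).obj L) := ((evaluation _ _).obj L).mapCocone (colimit.cocone D)
  have hc : IsColimit c := isColimitOfPreserves ((evaluation _ _).obj L) (colimit.isColimit D)
  change _ ↔ Subsingleton c.pt
  have : IsFiltered ℕᵒᵖᵒᵖ := inferInstance
  have : PreservesFilteredColimitsOfSize.{0, 0} (forget (ModuleCat.{u} R)) :=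
    preservesFilteredColimitsOfSize_shrink.{0, u, 0, u} _
  constructor
  · intro H
    refine subsingleton_of_forall_eq 0 fun x => ?_
    obtain ⟨t, y, rfl⟩ := Concrete.isColimit_exists_rep _ hc x
    obtain ⟨s, h, hs⟩ := H t.unop.unop y
    have := c.w ((homOfLE h).op.op : t ⟶ op (op s))
    rw [← this]
    refine Eq.trans ?_ (map_zero (c.ι.app (op (op s))).hom)
    exact congrArg (c.ι.app (op (op s))).hom hs
  · intro H t ξ
    have : c.ι.app (op (op t)) ξ = c.ι.app (op (op t)) 0 := H.elim _ _
    obtain ⟨k, f, g, h⟩ := (Concrete.isColimit_rep_eq_iff_exists _ hc _ _).1 this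
    have hk : t ≤ k.unop.unop := leOfHom f.unop.unop
    refine ⟨k.unop.unop, hk, ?_⟩
    rw [map_zero] at h
    exact h

end bridge
end StmtFive

namespace StmtFive
open Limits Opposite

section extnat
variable {C : Type*} [Category* C] [Abelian C] [HasExt C]
open Abelian DerivedCategory

lemma extClass_nat {S₁ S₂ : ShortComplex C} (h₁ : S₁.ShortExact) (h₂ : S₂.ShortExact) (f : S₁ ⟶ S₂) :
    (Ext.mk₀ f.τ₃).comp h₂.extClass (zero_add 1) = h₁.extClass.comp (Ext.mk₀ f.τ₁) (add_zero 1) := by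
  have := HasDerivedCategory.standard C
  apply Ext.homEquiv.injective
  change Ext.hom _ = Ext.hom _
  rw [Ext.comp_hom, Ext.comp_hom, Ext.mk₀_hom, Ext.mk₀_hom, ShortComplex.ShortExact.extClass_hom,
    ShortComplex.ShortExact.extClass_hom, ShiftedHom.mk₀_comp, ShiftedHom.comp_mk₀]
  exact (ShortComplex.ShortExact.singleTriangle.map h₁ h₂ f).comm₃.symm
end extnat

variable {R : Type u} [CommRing R]
open Abelian

lemma qmap_comp {J J' J'' : Ideal R} (h : J' ≤ J) (h' : J'' ≤ J') :
    qmap h' ≫ qmap h = qmap (h'.trans h) := by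
  ext x
  rfl

lemma van_mid (I : Ideal R) (j : ℕ) {S : ShortComplex (ModuleCat.{u} R)} (hS : S.ShortExact)
    (h1 : Van I j S.X₁) (h3 : Van I j S.X₃) : Van I j S.X₂ := by
  intro t ξ
  obtain ⟨s, h, hs⟩ := h3 t (ξ.comp (Ext.mk₀ S.g) (add_zero j))
  rw [← Ext.comp_assoc_of_third_deg_zero] at hs
  obtain ⟨η, hη⟩ := Ext.covariant_sequence_exact₂ _ hS _ hs
  obtain ⟨s', h', hs'⟩ := h1 s η
  refine ⟨s', h.trans h', ?_⟩
  rw [← qmap_comp (Ideal.pow_le_pow_right h) (Ideal.pow_le_pow_right h'),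
    ← Ext.mk₀_comp_mk₀_assoc, ← hη, ← Ext.comp_assoc_of_third_deg_zero, hs', Ext.zero_comp]

lemma van_right (I : Ideal R) (j : ℕ) {S : ShortComplex (ModuleCat.{u} R)} (hS : S.ShortExact)
    (h2 : Van I j S.X₂) (h1 : Van I (j+1) S.X₁) : Van I j S.X₃ := by
  intro t ξ
  obtain ⟨s, h, hs⟩ := h1 t (ξ.comp hS.extClass rfl)
  rw [← Ext.comp_assoc _ _ _ (zero_add j) rfl (by omega)] at hs
  obtain ⟨η, hη⟩ := Ext.covariant_sequence_exact₃ _ hS _ _ hs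
  obtain ⟨s', h', hs'⟩ := h2 s η
  refine ⟨s', h.trans h', ?_⟩
  rw [← qmap_comp (Ideal.pow_le_pow_right h) (Ideal.pow_le_pow_right h'),
    ← Ext.mk₀_comp_mk₀_assoc, ← hη, ← Ext.comp_assoc_of_third_deg_zero, hs', Ext.zero_comp]

lemma van_iso (I : Ideal R) (j : ℕ) {A B : ModuleCat.{u} R} (e : A ≅ B) (h : Van I j A) : Van I j B := by
  intro t ξ
  obtain ⟨s, hts, hs⟩ := h t (ξ.comp (Ext.mk₀ e.inv) (add_zero j))
  refine ⟨s, hts, ?_⟩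
  have := congrArg (fun k => k.comp (Ext.mk₀ e.hom) (add_zero j)) hs
  simpa using this

/-- `f` kills `Ext^j` for `j > d`. -/
def Null (d : ℕ) {A B : ModuleCat.{u} R} (f : A ⟶ B) : Prop :=
  ∀ (L : ModuleCat.{u} R) (j : ℕ) (_ : d < j) (ξ : Ext B L j), (Ext.mk₀ f).comp ξ (zero_add j) = 0

lemma Null.pre {d : ℕ} {A B C : ModuleCat.{u} R} {f : A ⟶ B} (hf : Null d f) (g : C ⟶ A) :
    Null d (g ≫ f) := by
  intro L j hj ξ
  rw [← Ext.mk₀_comp_mk₀_assoc, hf L j hj, Ext.comp_zero]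

lemma Null.post {d : ℕ} {A B C : ModuleCat.{u} R} {f : A ⟶ B} (hf : Null d f) (g : B ⟶ C) :
    Null d (f ≫ g) := by
  intro L j hj ξ
  rw [← Ext.mk₀_comp_mk₀_assoc, hf L j hj]

lemma null_step (d : ℕ) {S₁ S₂ : ShortComplex (ModuleCat.{u} R)} (h₁ : S₁.ShortExact)
    (h₂ : S₂.ShortExact) (f : S₁ ⟶ S₂) (hf : Null d f.τ₁) {C : ModuleCat.{u} R} (g : S₂.X₃ ⟶ C)
    (hg : Null d (S₂.g ≫ g)) : Null (d+1) (f.τ₃ ≫ g) := by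
  intro L j hj ξ
  obtain ⟨k, rfl⟩ : ∃ k, j = 1 + k := ⟨j - 1, by omega⟩
  obtain ⟨η, hη⟩ := Ext.contravariant_sequence_exact₃ h₂ L ((Ext.mk₀ g).comp ξ (zero_add _))
    (by rw [Ext.mk₀_comp_mk₀_assoc]; exact hg _ _ (by omega) _) rfl
  rw [← Ext.mk₀_comp_mk₀_assoc, ← hη, ← Ext.comp_assoc _ _ _ (zero_add 1) rfl (by omega), extClass_nat h₁ h₂ f,
    Ext.comp_assoc_of_second_deg_zero, hf _ _ (by omega), Ext.comp_zero]

def ProNull (I : Ideal R) (d : ℕ) : Prop :=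
  ∀ J : Ideal R, (∃ t, I ^ t ≤ J) → ∃ (J' : Ideal R) (h : J' ≤ J), (∃ s, I ^ s ≤ J') ∧ Null d (qmap h)

lemma proNull_bot : ProNull (⊥ : Ideal R) 0 := by
  intro J _
  refine ⟨⊥, bot_le, ⟨1, by simp⟩, ?_⟩
  intro L j hj ξ
  have : Module.Projective R (R ⧸ (⊥ : Ideal R)) :=
    Module.Projective.of_equiv (Submodule.quotEquivOfEqBot (⊥ : Ideal R) rfl).symm
  have : Projective (ModuleCat.of R (R ⧸ (⊥ : Ideal R))) :=
    (IsProjective.iff_projective _).1 this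
  obtain ⟨k, rfl⟩ : ∃ k, j = k + 1 := ⟨j - 1, by omega⟩
  exact Ext.eq_zero_of_projective _

lemma colon_stab [IsNoetherianRing R] (B : Ideal R) (x : R) :
    ∃ m : ℕ, ∀ (t : ℕ) (r : R), x ^ (m + t) * r ∈ B → x ^ m * r ∈ B := by
  let f : ℕ →o Ideal R := ⟨fun n => Submodule.comap (LinearMap.mulLeft R (x ^ n)) B, by
    refine monotone_nat_of_le_succ fun n r hr => ?_
    simp only [Submodule.mem_comap, LinearMap.mulLeft_apply] at hr ⊢
    rw [pow_succ', mul_assoc]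
    exact B.mul_mem_left _ hr⟩
  obtain ⟨m, hm⟩ := (monotone_stabilizes_iff_noetherian (R := R) (M := R)).2 inferInstance f
  refine ⟨m, fun t r hr => ?_⟩
  have : r ∈ f (m + t) := hr
  rw [← hm (m + t) (by omega)] at this
  exact this

lemma qmap_surj {J J' : Ideal R} (h : J' ≤ J) : Function.Surjective (Submodule.mapQ J' J LinearMap.id h) := by
  intro y
  obtain ⟨r, rfl⟩ := Submodule.Quotient.mk_surjective _ y
  exact ⟨Submodule.Quotient.mk r, rfl⟩

lemma proNull_step [IsNoetherianRing R] (b : Ideal R) (x : R) (d : ℕ) (hb : ProNull b d) :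
    ProNull (b ⊔ Ideal.span {x}) (d+1) := by
  rintro J ⟨t, ht⟩
  have hbt : b ^ t ≤ J := (Ideal.pow_right_mono le_sup_left t).trans ht
  have hxt : x ^ t ∈ J := ht (Ideal.pow_mem_pow (Ideal.mem_sup_right (Ideal.mem_span_singleton_self x)) t)
  obtain ⟨B2, h2, ⟨s2, hs2⟩, n2⟩ := hb (b ^ t) ⟨t, le_rfl⟩
  obtain ⟨B1, h1, ⟨s1, hs1⟩, n1⟩ := hb B2 ⟨s2, hs2⟩
  obtain ⟨m, hm⟩ := colon_stab B1 x
  let J1 := B1 ⊔ Ideal.span {x ^ (m + t)}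
  let J2 := B2 ⊔ Ideal.span {x ^ t}
  have hJ12 : J1 ≤ J2 := by
    refine sup_le (h1.trans le_sup_left) ?_
    rw [Ideal.span_singleton_le_iff_mem, pow_add]
    exact Ideal.mul_mem_left _ _ (Ideal.mem_sup_right (Ideal.mem_span_singleton_self _))
  have hJ2 : J2 ≤ J := sup_le (h2.trans hbt) (by rwa [Ideal.span_singleton_le_iff_mem])
  refine ⟨J1, hJ12.trans hJ2, ⟨s1 + (m + t), ?_⟩, ?_⟩
  · refine (Ideal.sup_pow_add_le_pow_sup_pow).trans (sup_le_sup hs1 ?_)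
    rw [Ideal.span_singleton_pow]
  · rw [← qmap_comp hJ2 hJ12]
    let q1 := Submodule.mapQ B1 J1 LinearMap.id le_sup_left
    let q2 := Submodule.mapQ B2 J2 LinearMap.id le_sup_left
    have e1 := LinearMap.shortExact_shortComplexKer (qmap_surj (J := J1) (J' := B1) le_sup_left)
    have e2 := LinearMap.shortExact_shortComplexKer (qmap_surj (J := J2) (J' := B2) le_sup_left)
    have hq2 : ∀ z, q2 (x ^ t • z) = 0 := by
      intro z
      obtain ⟨r, rfl⟩ := Submodule.Quotient.mk_surjective _ z
      change Submodule.Quotient.mk (x ^ t • r) = _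
      rw [Submodule.Quotient.mk_eq_zero]
      exact Ideal.mem_sup_right (Ideal.mul_mem_right _ _ (Ideal.mem_span_singleton_self _))
    -- the multiplication map onto the kernel
    let mu2 : (R ⧸ B2) →ₗ[R] LinearMap.ker q2 :=
      LinearMap.codRestrict _ (LinearMap.lsmul R (R ⧸ B2) (x ^ t)) (fun z => hq2 z)
    -- lift of the kernel to `R ⧸ B1`
    have hlift : ∃ l : LinearMap.ker q1 →ₗ[R] (R ⧸ B1), ∀ z, x ^ t • l z = (z : R ⧸ B1) := by
      have key : ∀ z : LinearMap.ker q1, ∃ r : R, (z : R ⧸ B1) = Submodule.Quotient.mk (x ^ (m + t) * r) := by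
        rintro ⟨z, hz⟩
        obtain ⟨r, rfl⟩ := Submodule.Quotient.mk_surjective _ z
        have hr : r ∈ J1 := (Submodule.Quotient.mk_eq_zero _).1 hz
        obtain ⟨y, hy, w, hw, rfl⟩ := Submodule.mem_sup.1 hr
        obtain ⟨a, rfl⟩ := Ideal.mem_span_singleton'.1 hw
        refine ⟨a, ?_⟩
        rw [Submodule.Quotient.eq]
        convert hy using 1; ring
      choose r hr using key
      have hwd : ∀ (z : LinearMap.ker q1) (r' : R), (z : R ⧸ B1) = Submodule.Quotient.mk (x ^ (m + t) * r') →
          (Submodule.Quotient.mk (x ^ m * r z) : R ⧸ B1) = Submodule.Quotient.mk (x ^ m * r') := by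
        intro z r' h
        rw [hr z, Submodule.Quotient.eq, ← mul_sub] at h
        rw [Submodule.Quotient.eq, ← mul_sub]
        exact hm _ _ h
      refine ⟨{ toFun := fun z => Submodule.Quotient.mk (x ^ m * r z), map_add' := ?_, map_smul' := ?_ }, ?_⟩
      · intro y z
        rw [hwd (y + z) (r y + r z), mul_add]
        · rfl
        · rw [mul_add, Submodule.coe_add, hr y, hr z]; rfl
      · intro a z
        rw [hwd (a • z) (a * r z)]
        · change _ = Submodule.Quotient.mk (a * (x ^ m * r z))
          congr 1; ring
        · rw [Submodule.coe_smul, hr z]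
          change Submodule.Quotient.mk (a * _) = _
          congr 1; ring
      · intro z
        rw [hr z]
        change Submodule.Quotient.mk (x ^ t * (x ^ m * r z)) = _
        congr 1; ring
    obtain ⟨l, hl⟩ := hlift
    let f : (LinearMap.shortComplexKer q1) ⟶ (LinearMap.shortComplexKer q2) :=
      { τ₁ := ModuleCat.ofHom l ≫ qmap h1 ≫ ModuleCat.ofHom mu2
        τ₂ := qmap h1
        τ₃ := qmap hJ12
        comm₁₂ := by
          ext z
          change x ^ t • (qmap h1).hom (l z) = (qmap h1).hom z
          rw [← map_smul, hl]
        comm₂₃ := by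
          change qmap h1 ≫ qmap le_sup_left = qmap le_sup_left ≫ qmap hJ12
          rw [qmap_comp, qmap_comp] }
    refine null_step d e1 e2 f ((n1.post _).pre _) (qmap hJ2) ?_
    change Null d (qmap (le_sup_left) ≫ qmap hJ2)
    rw [qmap_comp, ← qmap_comp hbt h2]
    exact n2.post _

lemma proNull_exists [IsNoetherianRing R] (I : Ideal R) : ∃ d, ProNull I d := by
  classical
  obtain ⟨S, rfl⟩ := IsNoetherian.noetherian I
  induction S using Finset.induction_on with
  | empty =>
    refine ⟨0, ?_⟩
    simpa using proNull_bot (R := R)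
  | insert x s _ ih =>
    obtain ⟨d, hd⟩ := ih
    refine ⟨d + 1, ?_⟩
    have := proNull_step _ x d hd
    rw [Finset.coe_insert, Submodule.span_insert, sup_comm]
    exact this

lemma van_large [IsNoetherianRing R] (I : Ideal R) : ∃ d, ∀ j, d < j → ∀ L : ModuleCat.{u} R, Van I j L := by
  obtain ⟨d, hd⟩ := proNull_exists I
  refine ⟨d, fun j hj L t ξ => ?_⟩
  obtain ⟨J', h, ⟨s, hs⟩, hn⟩ := hd (I ^ t) ⟨t, le_rfl⟩
  refine ⟨max s t, le_max_right _ _, ?_⟩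
  have h' : I ^ (max s t) ≤ J' := (Ideal.pow_le_pow_right (le_max_left _ _)).trans hs
  rw [← qmap_comp h h']
  exact hn.pre _ _ _ hj _

end StmtFive

namespace StmtFive
open Abelian
section final
variable {R : Type u} [CommRing R]

/-- `V I j N`: vanishing of the `j`-th local cohomology. -/
def V (I : Ideal R) (j : ℕ) (N : Type u) [AddCommGroup N] [Module R N] : Prop :=
  Van I j (ModuleCat.of R N)

section seq
variable {N₁ N₂ N₃ : Type u} [AddCommGroup N₁] [Module R N₁] [AddCommGroup N₂] [Module R N₂]
  [AddCommGroup N₃] [Module R N₃]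

lemma shortExact_of (f : N₁ →ₗ[R] N₂) (g : N₂ →ₗ[R] N₃) (hf : Function.Injective f)
    (hg : Function.Surjective g) (h : Function.Exact f g) :
    (ShortComplex.mk (ModuleCat.ofHom f) (ModuleCat.ofHom g)
      (by ext x; exact h.apply_apply_eq_zero x)).ShortExact where
  exact := (ShortComplex.ShortExact.moduleCat_exact_iff_function_exact _).2 h
  mono_f := (ModuleCat.mono_iff_injective _).2 hf
  epi_g := (ModuleCat.epi_iff_surjective _).2 hg

lemma V_mid (I : Ideal R) (j : ℕ) (f : N₁ →ₗ[R] N₂) (g : N₂ →ₗ[R] N₃) (hf : Function.Injective f)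
    (hg : Function.Surjective g) (h : Function.Exact f g) (h1 : V I j N₁) (h3 : V I j N₃) :
    V I j N₂ :=
  van_mid I j (shortExact_of f g hf hg h) h1 h3

lemma V_right (I : Ideal R) (j : ℕ) (f : N₁ →ₗ[R] N₂) (g : N₂ →ₗ[R] N₃) (hf : Function.Injective f)
    (hg : Function.Surjective g) (h : Function.Exact f g) (h2 : V I j N₂) (h1 : V I (j+1) N₁) :
    V I j N₃ :=
  van_right I j (shortExact_of f g hf hg h) h2 h1

lemma V_equiv (I : Ideal R) (j : ℕ) (e : N₁ ≃ₗ[R] N₂) (h : V I j N₁) : V I j N₂ :=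
  van_iso I j e.toModuleIso h
end seq

lemma V_zero (I : Ideal R) (j : ℕ) (N : Type u) [AddCommGroup N] [Module R N] [Subsingleton N] :
    V I j N := by
  intro t ξ
  refine ⟨t, le_rfl, ?_⟩
  have h : ξ = 0 := by
    rw [← Ext.comp_mk₀_id ξ]
    have : 𝟙 (ModuleCat.of R N) = 0 := by
      ext x
      exact Subsingleton.elim (α := N) _ _
    rw [this, Ext.mk₀_zero, Ext.comp_zero]
  rw [h, Ext.comp_zero]

variable [IsNoetherianRing R]

lemma V_fg (I : Ideal R) (j : ℕ) (A : Ideal R)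
    (H : ∀ p : Ideal R, p.IsPrime → A ≤ p → V I j (R ⧸ p))
    (L : Type u) [AddCommGroup L] [Module R L] (hL : Module.Finite R L)
    (hA : A ≤ Module.annihilator R L) : V I j L := by
  revert hA
  induction hL using IsNoetherianRing.induction_on_isQuotientEquivQuotientPrime R with
  | subsingleton N => exact fun _ => V_zero I j N
  | quotient N p f =>
    intro hA
    refine V_equiv I j f.symm (H _ p.2 ?_)
    rw [f.annihilator_eq, Ideal.annihilator_quotient] at hA
    exact hA
  | exact N₁ N₂ N₃ f g hf hg h h1 h3 =>
    intro hA
    exact V_mid I j f g hf hg h (h1 (hA.trans (f.annihilator_le_of_injective hf)))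
      (h3 (hA.trans (g.annihilator_le_of_surjective hg)))

lemma V_supp (I : Ideal R) (k : ℕ) (N : Type u) [AddCommGroup N] [Module R N] [Module.Finite R N]
    (hN : ∀ j, k < j → V I j N) (p : Ideal R) (hp : p.IsPrime)
    (hNp : Module.annihilator R N ≤ p) (j : ℕ) (hj : k < j) : V I j (R ⧸ p) := by
  obtain ⟨d, hd⟩ := van_large I
  suffices H : ∀ n j, k < j → d < j + n → ∀ p : Ideal R, p.IsPrime →
      Module.annihilator R N ≤ p → V I j (R ⧸ p) from H (d + 1) j hj (by omega) p hp hNp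
  clear hj hNp hp p j
  intro n
  induction n with
  | zero => exact fun j _ hj p _ _ => hd j hj _
  | succ n ih =>
    intro j hj hn p
    have ih' := ih (j + 1) (by omega) (by omega)
    induction p using WellFoundedGT.induction with
    | _ p ihp =>
    intro hp hNp
    have hne : ∃ f : N →ₗ[R] R ⧸ p, f ≠ 0 := by
      by_contra! hall
      have : Subsingleton (N →ₗ[R] R ⧸ p) := ⟨fun a b => (hall a).trans (hall b).symm⟩
      obtain ⟨r, hr, hreg⟩ := IsSMulRegular.subsingleton_linearMap_iff.1 this
      have h1 : (Ideal.Quotient.mk p r) = 0 := Ideal.Quotient.eq_zero_iff_mem.2 (hNp hr)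
      have h2 : r • (1 : R ⧸ p) = r • 0 := by
        rw [smul_zero, Algebra.smul_def, mul_one]
        exact h1
      exact one_ne_zero (hreg h2)
    obtain ⟨f, hf⟩ := hne
    have hker : V I (j+1) (LinearMap.ker f) :=
      V_fg I (j+1) _ ih' _ inferInstance
        (LinearMap.annihilator_le_of_injective _ (LinearMap.ker f).injective_subtype)
    have hrange : V I j (LinearMap.range f) :=
      V_right I j (LinearMap.ker f).subtype f.rangeRestrict (LinearMap.ker f).injective_subtype
        f.surjective_rangeRestrict (by
          rw [LinearMap.exact_iff, LinearMap.ker_rangeRestrict, Submodule.range_subtype])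
        (hN j hj) hker
    obtain ⟨x, hx⟩ : ∃ x, f x ≠ 0 := by
      by_contra! h
      exact hf (LinearMap.ext h)
    obtain ⟨r, hr⟩ := Ideal.Quotient.mk_surjective (f x)
    have hrp : r ∉ p := fun h => hx (by rw [← hr, Ideal.Quotient.eq_zero_iff_mem.2 h])
    have hquot : V I j ((R ⧸ p) ⧸ LinearMap.range f) := by
      refine V_fg I j _ (fun q hq hle => ?_) _ inferInstance le_rfl
      have hpq : p ≤ q := by
        refine le_trans ?_ ((LinearMap.annihilator_le_of_surjective (LinearMap.range f).mkQ
          (LinearMap.range f).mkQ_surjective).trans hle)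
        rw [Ideal.annihilator_quotient]
      have hrq : r ∈ q := by
        refine hle (Module.mem_annihilator.2 fun z => ?_)
        obtain ⟨z, rfl⟩ := (LinearMap.range f).mkQ_surjective z
        obtain ⟨a, rfl⟩ := Ideal.Quotient.mk_surjective z
        rw [← map_smul, Submodule.mkQ_apply, Submodule.Quotient.mk_eq_zero]
        refine ⟨a • x, ?_⟩
        rw [map_smul, ← hr, Algebra.smul_def, Algebra.smul_def]
        exact mul_comm _ _
      exact ihp q (lt_of_le_of_ne hpq (fun h => hrp (h ▸ hrq))) hq (hNp.trans hpq)
    exact V_mid I j (LinearMap.range f).subtype (LinearMap.range f).mkQ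
      (LinearMap.range f).injective_subtype (LinearMap.range f).mkQ_surjective
      (LinearMap.exact_subtype_mkQ _) hrange hquot

lemma cohDim_le_iff (I : Ideal R) (N : Type u) [AddCommGroup N] [Module R N] (k : ℕ) :
    cohDim I N ≤ ((k : ℕ∞) : WithBot ℕ∞) ↔ ∀ j, k < j → V I j N := by
  have hV : ∀ j, k < j → (V I j N ↔ ¬ LCNonzero I j N) := by
    intro j hj
    obtain ⟨p, rfl⟩ : ∃ p, j = p + 1 := ⟨j - 1, by omega⟩
    unfold V LCNonzero
    rw [van_iff_old, old_iff, not_nontrivial_iff_subsingleton]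
  unfold cohDim
  rw [sSup_le_iff]
  constructor
  · intro h j hj
    rw [hV j hj]
    intro hn
    have := h _ ⟨j, rfl, hn⟩
    have : j ≤ k := by exact_mod_cast this
    omega
  · rintro h _ ⟨j, rfl, hn⟩
    by_contra hlt
    have : k < j := by
      by_contra h'
      exact hlt (by exact_mod_cast not_lt.1 h')
    exact (hV j this).1 (h j this) hn

lemma cohDim_supp (I : Ideal R) (k : ℕ) (N : Type u) [AddCommGroup N] [Module R N]
    [Module.Finite R N] (hN : cohDim I N ≤ ((k : ℕ∞) : WithBot ℕ∞)) (p : Ideal R) (hp : p.IsPrime)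
    (hNp : Module.annihilator R N ≤ p) : cohDim I (R ⧸ p) ≤ ((k : ℕ∞) : WithBot ℕ∞) := by
  rw [cohDim_le_iff] at hN ⊢
  exact V_supp I k N hN p hp hNp

lemma cohDim_eq_iff (I : Ideal R) (N : Type u) [AddCommGroup N] [Module R N] (i : ℕ) (hi : 1 ≤ i) :
    cohDim I N = ((i : ℕ∞) : WithBot ℕ∞) ↔ cohDim I N ≤ ((i : ℕ∞) : WithBot ℕ∞) ∧
      ¬ cohDim I N ≤ (((i - 1 : ℕ) : ℕ∞) : WithBot ℕ∞) := by
  constructor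
  · intro h
    rw [h]
    refine ⟨le_rfl, fun h' => ?_⟩
    have : i ≤ i - 1 := by exact_mod_cast h'
    omega
  · rintro ⟨h1, h2⟩
    refine le_antisymm h1 ?_
    rw [not_le] at h2
    generalize cohDim I N = a at *
    induction a using WithBot.recBotCoe with
    | bot => simp at h2
    | coe a =>
      have h1 : a ≤ (i : ℕ∞) := by exact_mod_cast h1
      obtain ⟨m, rfl⟩ := ENat.ne_top_iff_exists.1 (ne_top_of_le_ne_top (ENat.natCast_ne_top i) h1)
      have : i - 1 < m := by exact_mod_cast h2
      have : i ≤ m := by omega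
      exact_mod_cast this

/-- Cyclic submodule extension. -/
lemma cohDim_ext (I : Ideal R) (k : ℕ) {M : Type u} [AddCommGroup M] [Module R M]
    (N : Submodule R M) (hN : cohDim I N ≤ ((k : ℕ∞) : WithBot ℕ∞)) (x : M) (p : Ideal R)
    (hx : ∀ r : R, r ∈ p ↔ r • x ∈ N)
    (hp : cohDim I (R ⧸ p) ≤ ((k : ℕ∞) : WithBot ℕ∞)) :
    cohDim I (N ⊔ Submodule.span R {x} : Submodule R M) ≤ ((k : ℕ∞) : WithBot ℕ∞) := by
  rw [cohDim_le_iff] at hN hp ⊢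
  intro j hj
  set T := N ⊔ Submodule.span R {x} with hT
  have hNT : N ≤ T := le_sup_left
  have hxT : x ∈ T := Submodule.mem_sup_right (Submodule.mem_span_singleton_self x)
  let N' : Submodule R T := N.comap T.subtype
  let φ : R →ₗ[R] T ⧸ N' := N'.mkQ ∘ₗ LinearMap.toSpanSingleton R T ⟨x, hxT⟩
  have hφ : Function.Surjective φ := by
    intro z
    obtain ⟨⟨z, hz⟩, rfl⟩ := N'.mkQ_surjective z
    obtain ⟨y, hy, w, hw, rfl⟩ := Submodule.mem_sup.1 hz
    obtain ⟨r, rfl⟩ := Submodule.mem_span_singleton.1 hw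
    refine ⟨r, ?_⟩
    refine (Submodule.Quotient.eq _).2 ?_
    change r • x - (y + r • x) ∈ N
    simpa using hy
  have hker : LinearMap.ker φ = p := by
    ext r
    rw [LinearMap.mem_ker, hx]
    exact Submodule.Quotient.mk_eq_zero N'
  have e : (R ⧸ p) ≃ₗ[R] (T ⧸ N') :=
    (Submodule.quotEquivOfEq _ _ hker.symm).trans (φ.quotKerEquivOfSurjective hφ)
  refine V_mid I j (Submodule.inclusion hNT) N'.mkQ (Submodule.inclusion_injective hNT)
    N'.mkQ_surjective ?_ (hN j hj) (V_equiv I j e (hp j hj))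
  rw [LinearMap.exact_iff, Submodule.ker_mkQ, Submodule.range_inclusion]

end final
end StmtFive

/-- `Ass_R (M_i / M_{i-1}) = {p ∈ Ass_R M : cd(𝔞, R/p) = i}`, where `M_i` (resp. `M_{i-1}`)
is the largest submodule of `M` of cohomological dimension at most `i` (resp. `i - 1`). -/
theorem stmt_5 {R : Type u} [CommRing R] [IsNoetherianRing R] (𝔞 : Ideal R)
    (M : Type u) [AddCommGroup M] [Module R M] [Module.Finite R M] [Nontrivial M]
    (c : ℕ) (hc : cohDim 𝔞 M = (c : ℕ∞)) (i : ℕ) (hi1 : 1 ≤ i) (hic : i ≤ c)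
    (Mi : Submodule R M) (hMi : cohDim 𝔞 ↥Mi ≤ (i : ℕ∞))
    (hMimax : ∀ L : Submodule R M, cohDim 𝔞 ↥L ≤ (i : ℕ∞) → L ≤ Mi)
    (Mim : Submodule R M) (hMim : cohDim 𝔞 ↥Mim ≤ ((i - 1 : ℕ) : ℕ∞))
    (hMimmax : ∀ L : Submodule R M, cohDim 𝔞 ↥L ≤ ((i - 1 : ℕ) : ℕ∞) → L ≤ Mim) :
    associatedPrimes R (↥Mi ⧸ Mim.comap Mi.subtype) =
      {p ∈ associatedPrimes R M | cohDim 𝔞 (R ⧸ p) = ((i : ℕ∞) : WithBot ℕ∞)} := by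
  have hmk : ∀ (x : M) (hx : x ∈ Mi) (r : R),
      r • ((Mim.comap Mi.subtype).mkQ ⟨x, hx⟩) = 0 ↔ r • x ∈ Mim := by
    intro x hx r
    rw [← map_smul]
    exact Submodule.Quotient.mk_eq_zero _
  ext p
  rw [Set.mem_ofPred_eq, AssociatedPrimes.mem_iff, AssociatedPrimes.mem_iff, isAssociatedPrime_iff,
    isAssociatedPrime_iff, StmtFive.cohDim_eq_iff _ _ _ hi1]
  constructor
  · rintro ⟨hp, xb, hxb⟩
    obtain ⟨⟨x, hx⟩, rfl⟩ := (Mim.comap Mi.subtype).mkQ_surjective xb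
    have hx' : ∀ r : R, r ∈ p ↔ r • x ∈ Mim := by
      intro r
      rw [← hmk x hx r, hxb, Submodule.mem_colon_singleton, Submodule.mem_bot]
    have hnot : ¬ cohDim 𝔞 (R ⧸ p) ≤ (((i - 1 : ℕ) : ℕ∞) : WithBot ℕ∞) := by
      intro h
      have h1 := hMimmax _ (StmtFive.cohDim_ext 𝔞 (i-1) Mim hMim x p hx' h)
      have h2 : x ∈ Mim := h1 (Submodule.mem_sup_right (Submodule.mem_span_singleton_self x))
      exact hp.ne_top ((Ideal.eq_top_iff_one p).2 ((hx' 1).2 (by simpa using h2)))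
    have hle : cohDim 𝔞 (R ⧸ p) ≤ ((i : ℕ∞) : WithBot ℕ∞) := by
      refine StmtFive.cohDim_supp 𝔞 i Mi hMi p hp fun r hr => ?_
      rw [hx']
      have := Module.mem_annihilator.1 hr ⟨x, hx⟩
      have h0 : r • x = 0 := congrArg Subtype.val this
      rw [h0]
      exact zero_mem _
    refine ⟨⟨hp, ?_⟩, hle, hnot⟩
    have hs : ¬ Module.annihilator R Mim ≤ p := fun h =>
      hnot (StmtFive.cohDim_supp 𝔞 (i-1) Mim hMim p hp h)
    obtain ⟨s, hs, hsp⟩ := SetLike.not_le_iff_exists.1 hs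
    refine ⟨s • x, ?_⟩
    ext r
    rw [Submodule.mem_colon_singleton, Submodule.mem_bot]
    constructor
    · intro hr
      have := Module.mem_annihilator.1 hs ⟨r • x, (hx' r).1 hr⟩
      have h0 : s • (r • x) = 0 := congrArg Subtype.val this
      rwa [smul_comm] at h0
    · intro h0
      have : r * s ∈ p := by
        rw [hx', mul_smul, h0]
        exact zero_mem _
      exact (hp.mem_or_mem this).resolve_right hsp
  · rintro ⟨⟨hp, x, hx⟩, hle, hnot⟩
    have hx0 : ∀ r : R, r ∈ p ↔ r • x = 0 := by
      intro r
      rw [hx, Submodule.mem_colon_singleton, Submodule.mem_bot]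
    have hbot : cohDim 𝔞 (⊥ : Submodule R M) ≤ ((i : ℕ∞) : WithBot ℕ∞) := by
      rw [StmtFive.cohDim_le_iff]
      exact fun j _ => StmtFive.V_zero 𝔞 j _
    have hxMi : x ∈ Mi := hMimax _
      (StmtFive.cohDim_ext 𝔞 i ⊥ hbot x p (by simpa using hx0) hle)
      (Submodule.mem_sup_right (Submodule.mem_span_singleton_self x))
    refine ⟨hp, (Mim.comap Mi.subtype).mkQ ⟨x, hxMi⟩, ?_⟩
    ext r
    rw [Submodule.mem_colon_singleton, Submodule.mem_bot, hmk]
    constructor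
    · intro hr
      rw [(hx0 r).1 hr]
      exact zero_mem _
    · intro hr
      by_contra hrp
      refine hnot (StmtFive.cohDim_supp 𝔞 (i-1) Mim hMim p hp fun s hs => ?_)
      have := Module.mem_annihilator.1 hs ⟨r • x, hr⟩
      have h0 : s • (r • x) = 0 := congrArg Subtype.val this
      have : s * r ∈ p := by rw [hx0, mul_smul, h0]
      exact (hp.mem_or_mem this).resolve_right hrp
end

section
/- Let R be Noetherian, 𝔞 an ideal, M a nonzero finitely generated R-module of finite dimension d with H^d_𝔞(M) ≠ 0, and G = M/T_R(𝔞, M). Then H^d_𝔞(G) ≅ H^d_𝔞(M). -/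
open CategoryTheory

universe u

open Limits in
/-- Exactness in a functor category can be checked pointwise. -/
lemma exact_of_pointwise_exact {J A : Type*} [Category* J] [Category* A] [Abelian A]
    (S : ShortComplex (J ⥤ A))
    (hS : ∀ j, (S.map ((evaluation J A).obj j)).Exact) : S.Exact := by
  simp only [ShortComplex.exact_iff_isZero_homology] at hS ⊢
  rw [IsZero.iff_id_eq_zero]
  ext j
  apply (IsZero.of_iso (hS j) (S.mapHomologyIso ((evaluation J A).obj j)).symm).eq_of_src

section LeftDerivedLES

variable {C A : Type*} [Category* C] [Abelian C] 
  [Category* A] [Abelian A] {F G H : C ⥤ A} [F.Additive] [G.Additive] [H.Additive]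
  (α : F ⟶ G) (β : G ⟶ H) (w : α ≫ β = 0)

/-- The short complex of complexes obtained by applying `F ⟶ G ⟶ H`. -/
noncomputable def lesSC (K : ChainComplex C ℕ) : ShortComplex (ChainComplex A ℕ) :=
  ShortComplex.mk ((NatTrans.mapHomologicalComplex α _).app K)
    ((NatTrans.mapHomologicalComplex β _).app K) (by
      ext i
      exact congr_app w (K.X i))

/-- Functoriality of `lesSC`. -/
noncomputable def lesSCMap {K L : ChainComplex C ℕ} (φ : K ⟶ L) :
    lesSC α β w K ⟶ lesSC α β w L where
  τ₁ := (F.mapHomologicalComplex _).map φ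
  τ₂ := (G.mapHomologicalComplex _).map φ
  τ₃ := (H.mapHomologicalComplex _).map φ
  comm₁₂ := ((NatTrans.mapHomologicalComplex α _).naturality φ)
  comm₂₃ := ((NatTrans.mapHomologicalComplex β _).naturality φ)

lemma lesSC_shortExact (hSE : ∀ P : C, Projective P →
    (ShortComplex.mk (α.app P) (β.app P) (congr_app w P)).ShortExact) {X : C} (P : ProjectiveResolution X) :
    (lesSC α β w P.complex).ShortExact :=
  HomologicalComplex.shortExact_of_degreewise_shortExact _
    (fun i => hSE (P.complex.X i) (P.projective i))

variable [HasProjectiveResolutions C]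

/-- The left derived functor of `F` as the homology of the first complex. -/
noncomputable def lesIso₁ (n : ℕ) (X : C) : (F.leftDerived n).obj X ≅
    (lesSC α β w (projectiveResolution X).complex).X₁.homology n :=
  (projectiveResolution X).isoLeftDerivedObj F n

/-- The left derived functor of `G` as the homology of the second complex. -/
noncomputable def lesIso₂ (n : ℕ) (X : C) : (G.leftDerived n).obj X ≅
    (lesSC α β w (projectiveResolution X).complex).X₂.homology n :=
  (projectiveResolution X).isoLeftDerivedObj G n

/-- The left derived functor of `H` as the homology of the third complex. -/
noncomputable def lesIso₃ (n : ℕ) (X : C) : (H.leftDerived n).obj X ≅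
    (lesSC α β w (projectiveResolution X).complex).X₃.homology n :=
  (projectiveResolution X).isoLeftDerivedObj H n

/-- The map of short complexes induced by a lift to projective resolutions. -/
noncomputable def lesLift {X Y : C} (f : X ⟶ Y) :
    lesSC α β w (projectiveResolution X).complex ⟶ lesSC α β w (projectiveResolution Y).complex :=
  lesSCMap α β w (ProjectiveResolution.lift f (projectiveResolution X) (projectiveResolution Y))

lemma lesIso₁_naturality (n : ℕ) {X Y : C} (f : X ⟶ Y) :
    (lesIso₁ α β w n X).inv ≫ (F.leftDerived n).map f =
      HomologicalComplex.homologyMap (lesLift α β w f).τ₁ n ≫ (lesIso₁ α β w n Y).inv :=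
  ProjectiveResolution.isoLeftDerivedObj_inv_naturality f _ _ _
    (ProjectiveResolution.lift_commutes_zero f (projectiveResolution X)
      (projectiveResolution Y)) F n

lemma lesIso₃_naturality (n : ℕ) {X Y : C} (f : X ⟶ Y) :
    (H.leftDerived n).map f ≫ (lesIso₃ α β w n Y).hom = (lesIso₃ α β w n X).hom ≫
      HomologicalComplex.homologyMap (lesLift α β w f).τ₃ n :=
  ProjectiveResolution.isoLeftDerivedObj_hom_naturality f _ _ _
    (ProjectiveResolution.lift_commutes_zero f (projectiveResolution X)
      (projectiveResolution Y)) H n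

/-- The connecting homomorphism of left derived functors. -/
noncomputable def lesδ (hSE : ∀ P : C, Projective P →
    (ShortComplex.mk (α.app P) (β.app P) (congr_app w P)).ShortExact)
    (n : ℕ) : H.leftDerived (n + 1) ⟶ F.leftDerived n where
  app X := (lesIso₃ α β w (n + 1) X).hom ≫
    (lesSC_shortExact α β w hSE (projectiveResolution X)).δ (n + 1) n (by simp) ≫
    (lesIso₁ α β w n X).inv
  naturality X Y f := by
    have h3 := HomologicalComplex.HomologySequence.δ_naturality (lesLift α β w f)
      (lesSC_shortExact α β w hSE (projectiveResolution X))
      (lesSC_shortExact α β w hSE (projectiveResolution Y)) (n + 1) n (by simp)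
    rw [reassoc_of% (lesIso₃_naturality α β w (n + 1) f), Category.assoc, Category.assoc,
      lesIso₁_naturality α β w n f, reassoc_of% h3]

lemma les_comm₁ (n : ℕ) (X : C) :
    (lesIso₁ α β w n X).hom ≫
        HomologicalComplex.homologyMap (lesSC α β w (projectiveResolution X).complex).f n =
      (NatTrans.leftDerived α n).app X ≫ (lesIso₂ α β w n X).hom := by
  have e1 := ProjectiveResolution.leftDerived_app_eq α (projectiveResolution X) n
  rw [← Iso.comp_inv_eq, Category.assoc]
  exact e1.symm

lemma les_comm₂ (n : ℕ) (X : C) :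
    (lesIso₂ α β w n X).hom ≫
        HomologicalComplex.homologyMap (lesSC α β w (projectiveResolution X).complex).g n =
      (NatTrans.leftDerived β n).app X ≫ (lesIso₃ α β w n X).hom := by
  have e1 := ProjectiveResolution.leftDerived_app_eq β (projectiveResolution X) n
  rw [← Iso.comp_inv_eq, Category.assoc]
  exact e1.symm

lemma les_exact₂ (hSE : ∀ P : C, Projective P →
    (ShortComplex.mk (α.app P) (β.app P) (congr_app w P)).ShortExact)
    (n : ℕ) (X : C) : ∃ w', (ShortComplex.mk ((NatTrans.leftDerived α n).app X)
    ((NatTrans.leftDerived β n).app X) w').Exact := by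
  have hs := lesSC_shortExact α β w hSE (projectiveResolution X)
  have h := hs.homology_exact₂ n
  have w' : (NatTrans.leftDerived α n).app X ≫ (NatTrans.leftDerived β n).app X = 0 := by
    rw [← cancel_mono (lesIso₃ α β w n X).hom, Category.assoc, ← les_comm₂,
      ← reassoc_of% (les_comm₁ α β w), ← HomologicalComplex.homologyMap_comp,
      (lesSC α β w _).zero,
      HomologicalComplex.homologyMap_zero, Limits.zero_comp, Limits.comp_zero]
  exact ⟨w', (ShortComplex.exact_iff_of_iso (ShortComplex.isoMk
    (lesIso₁ α β w n X) (lesIso₂ α β w n X) (lesIso₃ α β w n X)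
    (les_comm₁ α β w n X) (les_comm₂ α β w n X))).2 h⟩

lemma les_exact₁ (hSE : ∀ P : C, Projective P →
    (ShortComplex.mk (α.app P) (β.app P) (congr_app w P)).ShortExact)
    (n : ℕ) (X : C) : ∃ w', (ShortComplex.mk ((lesδ α β w hSE n).app X)
    ((NatTrans.leftDerived α n).app X) w').Exact := by
  have hs := lesSC_shortExact α β w hSE (projectiveResolution X)
  have h := hs.homology_exact₁ (n + 1) n (by simp)
  have c0 : (lesIso₃ α β w (n + 1) X).hom ≫ hs.δ (n + 1) n (by simp) =
      (lesδ α β w hSE n).app X ≫ (lesIso₁ α β w n X).hom := by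
    simp [lesδ]
  have w' : (lesδ α β w hSE n).app X ≫ (NatTrans.leftDerived α n).app X = 0 := by
    rw [← cancel_mono (lesIso₂ α β w n X).hom, Category.assoc, ← les_comm₁,
      ← reassoc_of% c0, hs.δ_comp, Limits.zero_comp, Limits.comp_zero]
  exact ⟨w', (ShortComplex.exact_iff_of_iso (ShortComplex.isoMk
    (lesIso₃ α β w (n + 1) X) (lesIso₁ α β w n X) (lesIso₂ α β w n X)
    c0 (les_comm₁ α β w n X))).2 h⟩

end LeftDerivedLES

section ExtLES

open Limits localCohomology

variable {R : Type u} [CommRing R] (S : ShortComplex (ModuleCat.{u} R))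

/-- The functor `Hom(-, Y)` with values in the opposite category. -/
noncomputable abbrev homOp (Y : ModuleCat.{u} R) : ModuleCat.{u} R ⥤ (ModuleCat.{u} R)ᵒᵖ :=
  ((linearYoneda R (ModuleCat.{u} R)).obj Y).rightOp

/-- Functoriality of `homOp`. -/
noncomputable abbrev homOpMap {Y Z : ModuleCat.{u} R} (f : Y ⟶ Z) : homOp Z ⟶ homOp Y :=
  NatTrans.rightOp ((linearYoneda R (ModuleCat.{u} R)).map f)

lemma hom_comp_zero {X : ModuleCat.{u} R} (x : X ⟶ S.X₁) : (x ≫ S.f) ≫ S.g = 0 := by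
  rw [Category.assoc, S.zero, comp_zero]

lemma homOpMap_zero : homOpMap S.g ≫ homOpMap S.f = 0 := by
  ext X : 2
  apply Quiver.Hom.unop_inj
  ext x
  exact hom_comp_zero S x

lemma homOp_shortExact (hS : S.ShortExact) (P : ModuleCat.{u} R) (hP : Projective P) :
    (ShortComplex.mk ((homOpMap S.g).app P) ((homOpMap S.f).app P)
      (congr_app (homOpMap_zero S) P)).ShortExact := by
  have := hS.mono_f
  have := hS.epi_g
  let S' : ShortComplex (ModuleCat.{u} R) :=
    ShortComplex.mk (((linearYoneda R (ModuleCat.{u} R)).map S.f).app (Opposite.op P))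
      (((linearYoneda R (ModuleCat.{u} R)).map S.g).app (Opposite.op P)) (by
        ext x
        exact hom_comp_zero S x)
  have hS' : S'.ShortExact :=
    { exact := by
        rw [ShortComplex.moduleCat_exact_iff]
        intro x hx
        exact ⟨hS.exact.lift (x : P ⟶ S.X₂) hx, hS.exact.lift_f (x : P ⟶ S.X₂) hx⟩
      mono_f := by
        rw [ModuleCat.mono_iff_injective]
        intro x y hxy
        exact (cancel_mono S.f).1 (show (x : P ⟶ S.X₁) ≫ S.f = (y : P ⟶ S.X₁) ≫ S.f from hxy)
      epi_g := by
        rw [ModuleCat.epi_iff_surjective]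
        intro x
        exact ⟨Projective.factorThru (x : P ⟶ S.X₃) S.g,
          Projective.factorThru_comp (x : P ⟶ S.X₃) S.g⟩ }
  exact hS'.op

variable {D : Type} [SmallCategory D] (I : D ⥤ Ideal R)

/-- The connecting morphism for the diagrams of `Ext` groups. -/
noncomputable def diagδ (hS : S.ShortExact) (n : ℕ) :
    (diagram I n).flip.obj S.X₃ ⟶ (diagram I (n + 1)).flip.obj S.X₁ :=
  Functor.whiskerLeft (ringModIdeals I).op
    (NatTrans.leftOp (lesδ (homOpMap S.g) (homOpMap S.f) (homOpMap_zero S)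
      (homOp_shortExact S hS) n))

lemma diag_exact₂ (hS : S.ShortExact) (n : ℕ) : ∃ w', (ShortComplex.mk ((diagram I n).flip.map S.f)
    ((diagram I n).flip.map S.g) w').Exact := by
  have key := fun t : Dᵒᵖ => les_exact₂ (homOpMap S.g) (homOpMap S.f) (homOpMap_zero S)
      (homOp_shortExact S hS) n ((ringModIdeals I).obj t.unop)
  refine ⟨?_, exact_of_pointwise_exact _ ?_⟩
  · ext t : 2
    exact congrArg Quiver.Hom.unop (key t).1
  · intro t
    exact (key t).2.unop

lemma diag_exact₃ (hS : S.ShortExact) (n : ℕ) : ∃ w', (ShortComplex.mk ((diagram I n).flip.map S.g)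
    (diagδ S I hS n) w').Exact := by
  have key := fun t : Dᵒᵖ => les_exact₁ (homOpMap S.g) (homOpMap S.f) (homOpMap_zero S)
      (homOp_shortExact S hS) n ((ringModIdeals I).obj t.unop)
  refine ⟨?_, exact_of_pointwise_exact _ ?_⟩
  · ext t : 2
    exact congrArg Quiver.Hom.unop (key t).1
  · intro t
    exact (key t).2.unop

end ExtLES

section Main

open Limits localCohomology

/-- Local cohomology as a colimit of diagrams of `Ext` groups. -/
noncomputable def localCohomologyIsoColim {R : Type u} [CommRing R] (𝔞 : Ideal R) (n : ℕ) :
    localCohomology 𝔞 n ≅ (diagram (idealPowersDiagram 𝔞) n).flip ⋙ colim :=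
  colimitIsoFlipCompColim (diagram (idealPowersDiagram 𝔞) n)

lemma localCohomology_iso_of_subsingleton {R : Type u} [CommRing R] (𝔞 : Ideal R)
    (S : ShortComplex (ModuleCat.{u} R)) (hS : S.ShortExact) (n : ℕ)
    (h₁ : Subsingleton ((localCohomology 𝔞 n).obj S.X₁))
    (h₂ : Subsingleton ((localCohomology 𝔞 (n + 1)).obj S.X₁)) :
    Nonempty ((localCohomology 𝔞 n).obj S.X₃ ≅ (localCohomology 𝔞 n).obj S.X₂) := by
  have z₁ : IsZero (colim.obj ((diagram (idealPowersDiagram 𝔞) n).flip.obj S.X₁)) :=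
    (ModuleCat.isZero_of_subsingleton _).of_iso ((localCohomologyIsoColim 𝔞 n).app S.X₁).symm
  have z₂ : IsZero (colim.obj ((diagram (idealPowersDiagram 𝔞) (n + 1)).flip.obj S.X₁)) :=
    (ModuleCat.isZero_of_subsingleton _).of_iso
      ((localCohomologyIsoColim 𝔞 (n + 1)).app S.X₁).symm
  obtain ⟨w₂, e₂⟩ := diag_exact₂ S (idealPowersDiagram 𝔞) hS n
  obtain ⟨w₃, e₃⟩ := diag_exact₃ S (idealPowersDiagram 𝔞) hS n
  have hab : AB5OfSize.{0, 0} (ModuleCat.{u} R) := AB5OfSize_of_univLE.{0, 0, u, u} _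
  have hex : HasExactColimitsOfShape ℕᵒᵖᵒᵖ (ModuleCat.{u} R) := hab.ofShape _
  have hl : PreservesFiniteLimits (colim (J := ℕᵒᵖᵒᵖ) (C := ModuleCat.{u} R)) :=
    hex.preservesFiniteLimits
  have e₂' := e₂.map (colim (J := ℕᵒᵖᵒᵖ) (C := ModuleCat.{u} R))
  have e₃' := e₃.map (colim (J := ℕᵒᵖᵒᵖ) (C := ModuleCat.{u} R))
  have hm : Mono (colim.map ((diagram (idealPowersDiagram 𝔞) n).flip.map S.g)) :=
    e₂'.mono_g (z₁.eq_of_src _ _)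
  have he : Epi (colim.map ((diagram (idealPowersDiagram 𝔞) n).flip.map S.g)) :=
    e₃'.epi_f (z₂.eq_of_tgt _ _)
  have hi : IsIso (colim.map ((diagram (idealPowersDiagram 𝔞) n).flip.map S.g)) :=
    isIso_of_mono_of_epi _
  exact ⟨(localCohomologyIsoColim 𝔞 n).app S.X₃ ≪≫
    (asIso (colim.map ((diagram (idealPowersDiagram 𝔞) n).flip.map S.g))).symm ≪≫
    ((localCohomologyIsoColim 𝔞 n).app S.X₂).symm⟩

end Main

/-- If `dim M = d`, `H^d_𝔞(M) ≠ 0` and `T = T_R(𝔞, M)` is the largest submodule of `M` with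
`cd(𝔞, T) < d`, then `H^d_𝔞(M ⧸ T) ≅ H^d_𝔞(M)`. -/
theorem stmt_7 {R : Type u} [CommRing R] [IsNoetherianRing R] (𝔞 : Ideal R)
    (M : Type u) [AddCommGroup M] [Module R M] [Module.Finite R M] [Nontrivial M]
    (d : ℕ) (hd : modDim R M = (d : ℕ∞)) (htop : LCNonzero 𝔞 d M)
    (T : Submodule R M) (hT : cohDim 𝔞 ↥T < (d : ℕ∞))
    (hTmax : ∀ L : Submodule R M, cohDim 𝔞 ↥L < (d : ℕ∞) → L ≤ T) :
    Nonempty ((localCohomology 𝔞 d).obj (ModuleCat.of R (M ⧸ T)) ≅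
      (localCohomology 𝔞 d).obj (ModuleCat.of R M)) := by
  have h0 : ∀ i : ℕ, d ≤ i →
      Subsingleton ((localCohomology 𝔞 i).obj (ModuleCat.of R T)) := by
    intro i hi
    by_contra hne
    rw [not_subsingleton_iff_nontrivial] at hne
    have h1 : ((i : ℕ∞) : WithBot ℕ∞) ≤ cohDim 𝔞 T := le_sSup ⟨i, rfl, hne⟩
    have h2 : ((d : ℕ∞) : WithBot ℕ∞) ≤ ((i : ℕ∞) : WithBot ℕ∞) := by exact_mod_cast hi
    exact absurd hT (not_lt.2 (h2.trans h1))
  let S : ShortComplex (ModuleCat.{u} R) := ShortComplex.mk (ModuleCat.ofHom T.subtype)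
    (ModuleCat.ofHom T.mkQ) (by
      ext x
      simp)
  have hS : S.ShortExact :=
    { exact := by
        rw [ShortComplex.moduleCat_exact_iff]
        intro x hx
        exact ⟨⟨x, (Submodule.Quotient.mk_eq_zero T).1 hx⟩, rfl⟩
      mono_f := by
        rw [ModuleCat.mono_iff_injective]
        exact T.injective_subtype
      epi_g := by
        rw [ModuleCat.epi_iff_surjective]
        exact T.mkQ_surjective }
  exact localCohomology_iso_of_subsingleton 𝔞 S hS d (h0 d le_rfl) (h0 (d + 1) (by omega))
end

section
/- Let (R, 𝔪) be a complete local Noetherian ring, 𝔞 an ideal, and M a nonzero finitely generated R-module of dimension d. Then the set of attached primes of the Artinian module H^d_𝔞(M) equals {𝔭 ∈ Ass_R(M) : dim R/𝔭 = d and Rad(𝔞 + 𝔭) = 𝔪}. -/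
open CategoryTheory

universe u

/-- `p` is an attached prime of `M` if `p` is prime and is the annihilator of some
quotient of `M`. -/
def IsAttachedPrime (R : Type u) [CommRing R] (M : Type u) [AddCommGroup M] [Module R M]
    (p : Ideal R) : Prop :=
  p.IsPrime ∧ ∃ N : Submodule R M, p = Module.annihilator R (M ⧸ N)

namespace LCT
open CategoryTheory Abelian

section model
variable {R : Type u} [CommRing R]

lemma quot_hom_ext {I : Ideal R} {Y : ModuleCat.{u} R} {f g : ModuleCat.of R (R ⧸ I) ⟶ Y}
    (h : ∀ r : R, f.hom (Submodule.Quotient.mk r : R ⧸ I) =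
      g.hom (Submodule.Quotient.mk r : R ⧸ I)) : f = g := by
  apply ModuleCat.hom_ext
  apply LinearMap.ext
  intro y
  obtain ⟨y, rfl⟩ := Submodule.Quotient.mk_surjective _ y
  exact h y

/-- the projection `R/a^n → R/a^m`. -/
noncomputable def prj (a : Ideal R) {m n : ℕ} (h : m ≤ n) :
    ModuleCat.of R (R ⧸ a ^ n) ⟶ ModuleCat.of R (R ⧸ a ^ m) :=
  ModuleCat.ofHom (Submodule.mapQ (a ^ n) (a ^ m) LinearMap.id (Ideal.pow_le_pow_right h))

lemma prj_self (a : Ideal R) (n : ℕ) : prj a (le_refl n) = 𝟙 _ := by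
  refine quot_hom_ext fun x => ?_
  rfl

lemma prj_comp (a : Ideal R) {l m n : ℕ} (h : l ≤ m) (h' : m ≤ n) :
    prj a h' ≫ prj a h = prj a (h.trans h') := by
  refine quot_hom_ext fun x => ?_
  rfl

abbrev EQ (a : Ideal R) (i : ℕ) (M : Type u) [AddCommGroup M] [Module R M] (n : ℕ) : Type u :=
  Ext (ModuleCat.of R (R ⧸ a ^ n)) (ModuleCat.of R M) i

noncomputable def EQt (a : Ideal R) (i : ℕ) (M : Type u) [AddCommGroup M] [Module R M]
    (m n : ℕ) (h : m ≤ n) : EQ a i M m →ₗ[R] EQ a i M n :=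
  (Ext.mk₀ (prj a h)).precompOfLinear R _ (zero_add i)

lemma EQt_apply (a : Ideal R) (i : ℕ) (M : Type u) [AddCommGroup M] [Module R M]
    (m n : ℕ) (h : m ≤ n) (x : EQ a i M m) :
    EQt a i M m n h x = (Ext.mk₀ (prj a h)).comp x (zero_add i) := rfl

instance (a : Ideal R) (i : ℕ) (M : Type u) [AddCommGroup M] [Module R M] :
    DirectedSystem (EQ a i M) (fun m n h => EQt a i M m n h) where
  map_self n x := by
    rw [EQt_apply, prj_self, Ext.mk₀_id_comp]
  map_map l m n h h' x := by
    rw [EQt_apply, EQt_apply, EQt_apply, ← prj_comp a h h', Ext.mk₀_comp_mk₀_assoc]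

/-- Concrete local cohomology. -/
noncomputable def LC (a : Ideal R) (i : ℕ) (M : Type u) [AddCommGroup M] [Module R M] : Type u :=
  Module.DirectLimit (EQ a i M) (EQt a i M)

noncomputable instance (a : Ideal R) (i : ℕ) (M : Type u) [AddCommGroup M] [Module R M] :
    AddCommGroup (LC a i M) :=
  inferInstanceAs (AddCommGroup (Module.DirectLimit (EQ a i M) (EQt a i M)))

noncomputable instance (a : Ideal R) (i : ℕ) (M : Type u) [AddCommGroup M] [Module R M] :
    Module R (LC a i M) :=
  inferInstanceAs (Module R (Module.DirectLimit (EQ a i M) (EQt a i M)))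

variable (a : Ideal R) (i : ℕ)
variable {M : Type u} [AddCommGroup M] [Module R M]
variable {N : Type u} [AddCommGroup N] [Module R N]
variable {P : Type u} [AddCommGroup P] [Module R P]

noncomputable def LC.of (n : ℕ) : EQ a i M n →ₗ[R] LC a i M :=
  Module.DirectLimit.of R ℕ (EQ a i M) (EQt a i M) n

variable {a i}

lemma LC.of_t {m n : ℕ} (h : m ≤ n) (x : EQ a i M m) :
    LC.of a i n (EQt a i M m n h x) = LC.of a i m x :=
  Module.DirectLimit.of_f

lemma LC.exists_of (z : LC a i M) : ∃ n x, LC.of a i n x = z :=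
  Module.DirectLimit.exists_of z

lemma LC.zero_exact {n : ℕ} {x : EQ a i M n} (h : LC.of a i n x = 0) :
    ∃ m, ∃ hm : n ≤ m, EQt a i M n m hm x = 0 :=
  Module.DirectLimit.of.zero_exact h

noncomputable def LC.post {k j : ℕ} (β : Ext (ModuleCat.of R M) (ModuleCat.of R N) k)
    (h : i + k = j) : LC a i M →ₗ[R] LC a j N :=
  Module.DirectLimit.map (fun _ => β.postcompOfLinear R _ h) (by
    intro m n hmn
    ext x
    exact Ext.comp_assoc _ _ _ (zero_add i) h (by omega))

lemma LC.post_of {k j : ℕ} (β : Ext (ModuleCat.of R M) (ModuleCat.of R N) k)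
    (h : i + k = j) (n : ℕ) (x : EQ a i M n) :
    LC.post β h (LC.of a i n x) = LC.of a j n (x.comp β h) :=
  Module.DirectLimit.map_apply_of _ _ _

variable (a i)
noncomputable def LC.map (f : M →ₗ[R] N) : LC a i M →ₗ[R] LC a i N :=
  LC.post (Ext.mk₀ (ModuleCat.ofHom f)) (add_zero i)
variable {a i}

lemma LC.map_of (f : M →ₗ[R] N) (n : ℕ) (x : EQ a i M n) :
    LC.map a i f (LC.of a i n x) = LC.of a i n (x.comp (Ext.mk₀ (ModuleCat.ofHom f)) (add_zero i)) :=
  LC.post_of _ _ _ _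

lemma LC.map_id_apply (z : LC a i M) : LC.map a i (LinearMap.id : M →ₗ[R] M) z = z := by
  obtain ⟨n, x, rfl⟩ := LC.exists_of z
  rw [LC.map_of]
  congr 1
  exact Ext.comp_mk₀_id x

lemma LC.map_comp_apply (f : M →ₗ[R] N) (g : N →ₗ[R] P) (z : LC a i M) :
    LC.map a i (g ∘ₗ f) z = LC.map a i g (LC.map a i f z) := by
  obtain ⟨n, x, rfl⟩ := LC.exists_of z
  simp only [LC.map_of]
  congr 1
  rw [ModuleCat.ofHom_comp, Ext.comp_assoc_of_third_deg_zero, Ext.mk₀_comp_mk₀]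

lemma LC.map_smul_apply (r : R) (f : M →ₗ[R] N) (z : LC a i M) :
    LC.map a i (r • f) z = r • LC.map a i f z := by
  obtain ⟨n, x, rfl⟩ := LC.exists_of z
  simp only [LC.map_of]
  rw [← map_smul, ← Ext.comp_smul, ← Ext.mk₀_smul]
  rfl

lemma LC.map_add_apply (f g : M →ₗ[R] N) (z : LC a i M) :
    LC.map a i (f + g) z = LC.map a i f z + LC.map a i g z := by
  obtain ⟨n, x, rfl⟩ := LC.exists_of z
  simp only [LC.map_of]
  rw [← map_add, ← Ext.comp_add, ← Ext.mk₀_add]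
  rfl

lemma LC.map_zero_apply (z : LC a i M) :
    LC.map a i (0 : M →ₗ[R] N) z = 0 := by
  have := LC.map_smul_apply (a := a) (i := i) (0 : R) (0 : M →ₗ[R] N) z
  rwa [zero_smul, zero_smul] at this

lemma LC.map_sum_apply {ι : Type*} (s : Finset ι) (f : ι → M →ₗ[R] N) (z : LC a i M) :
    LC.map a i (∑ j ∈ s, f j) z = ∑ j ∈ s, LC.map a i (f j) z := by
  classical
  induction s using Finset.induction_on with
  | empty => simp [LC.map_zero_apply]
  | insert j s hj ih => rw [Finset.sum_insert hj, Finset.sum_insert hj, LC.map_add_apply, ih]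

lemma LC.map_lsmul_apply (r : R) (z : LC a i M) :
    LC.map a i (r • (LinearMap.id : M →ₗ[R] M)) z = r • z := by
  rw [LC.map_smul_apply, LC.map_id_apply]

noncomputable def LC.equiv (e : M ≃ₗ[R] N) : LC a i M ≃ₗ[R] LC a i N :=
  LinearEquiv.ofLinearMap (LC.map a i e.toLinearMap) (LC.map a i e.symm.toLinearMap)
    (by ext z; simp only [LinearMap.comp_apply]; rw [← LC.map_comp_apply]; simp [LC.map_id_apply])
    (by ext z; simp only [LinearMap.comp_apply]; rw [← LC.map_comp_apply]; simp [LC.map_id_apply])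

lemma LC.subsingleton_of_subsingleton [Subsingleton M] : Subsingleton (LC a i M) := by
  refine ⟨fun x y => ?_⟩
  have h : (LinearMap.id : M →ₗ[R] M) = 0 := by ext x; exact Subsingleton.elim _ _
  rw [← LC.map_id_apply x, ← LC.map_id_apply y, h, LC.map_zero_apply, LC.map_zero_apply]

lemma LC.torsion (z : LC a i M) : ∃ n : ℕ, ∀ r ∈ a ^ n, r • z = 0 := by
  obtain ⟨n, x, rfl⟩ := LC.exists_of z
  refine ⟨n, fun r hr => ?_⟩
  rw [← map_smul]
  have h1 : r • x = (Ext.mk₀ (r • 𝟙 (ModuleCat.of R (R ⧸ a ^ n)))).comp x (zero_add i) := by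
    rw [Ext.mk₀_smul, Ext.smul_comp, Ext.mk₀_id_comp]
  have h2 : r • 𝟙 (ModuleCat.of R (R ⧸ a ^ n)) = 0 := by
    refine quot_hom_ext fun y => ?_
    change r • (Submodule.Quotient.mk y : R ⧸ a ^ n) = 0
    rw [← Submodule.Quotient.mk_smul, Submodule.Quotient.mk_eq_zero, smul_eq_mul]
    exact Ideal.mul_mem_right _ _ hr
  rw [h1, h2]
  simp

lemma LC.subsingleton_of_top : Subsingleton (LC (⊤ : Ideal R) i M) := by
  refine subsingleton_of_forall_eq 0 fun z => ?_
  obtain ⟨n, hn⟩ := LC.torsion z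
  simpa using hn 1 (by rw [Ideal.top_pow]; trivial)

lemma LC.subsingleton_of_injective [Injective (ModuleCat.of R M)] :
    Subsingleton (LC a (i + 1) M) := by
  refine subsingleton_of_forall_eq 0 fun z => ?_
  obtain ⟨n, x, rfl⟩ := LC.exists_of z
  rw [x.eq_zero_of_injective, map_zero]

section les

lemma shortExact {f : M →ₗ[R] N} {g : N →ₗ[R] P} (hf : Function.Injective f)
    (hg : Function.Surjective g) (h : Function.Exact f g) :
    (ShortComplex.mk (ModuleCat.ofHom f) (ModuleCat.ofHom g)
      (by rw [← ModuleCat.ofHom_comp, h.linearMap_comp_eq_zero]; rfl)).ShortExact where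
  exact := (ShortComplex.ShortExact.moduleCat_exact_iff_function_exact _).2 h
  mono_f := (ModuleCat.mono_iff_injective _).2 hf
  epi_g := (ModuleCat.epi_iff_surjective _).2 hg

variable {f : M →ₗ[R] N} {g : N →ₗ[R] P} 

/-- exactness in the middle -/
lemma LC.exact_map (hf : Function.Injective f)
    (hg : Function.Surjective g) (h : Function.Exact f g) :
    Function.Exact (LC.map a i f) (LC.map a i g) := by
  intro z
  constructor
  · obtain ⟨n, x, rfl⟩ := LC.exists_of z
    intro hz
    rw [LC.map_of] at hz
    obtain ⟨m, hm, hx⟩ := LC.zero_exact hz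
    rw [EQt_apply, ← Ext.comp_assoc_of_third_deg_zero] at hx
    obtain ⟨y, hy⟩ := Ext.covariant_sequence_exact₂ _ (shortExact hf hg h) _ hx
    refine ⟨LC.of a i m y, ?_⟩
    rw [LC.map_of, ← LC.of_t hm x]
    exact congrArg _ hy
  · rintro ⟨y, rfl⟩
    rw [← LC.map_comp_apply, h.linearMap_comp_eq_zero, LC.map_zero_apply]

noncomputable def LC.δ (a : Ideal R) (i : ℕ) (hf : Function.Injective f)
    (hg : Function.Surjective g) (h : Function.Exact f g) : LC a i P →ₗ[R] LC a (i + 1) M :=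
  LC.post (shortExact hf hg h).extClass rfl

lemma LC.exact_map_δ (hf : Function.Injective f)
    (hg : Function.Surjective g) (h : Function.Exact f g) :
    Function.Exact (LC.map a i g) (LC.δ a i hf hg h) := by
  intro z
  constructor
  · obtain ⟨n, x, rfl⟩ := LC.exists_of z
    intro hz
    rw [LC.δ, LC.post_of] at hz
    obtain ⟨m, hm, hx⟩ := LC.zero_exact hz
    rw [EQt_apply, ← Ext.comp_assoc _ _ _ (zero_add i) rfl (by omega)] at hx
    obtain ⟨y, hy⟩ := Ext.covariant_sequence_exact₃ _ (shortExact hf hg h) _ _ hx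
    refine ⟨LC.of a i m y, ?_⟩
    rw [LC.map_of, ← LC.of_t hm x]
    exact congrArg _ hy
  · rintro ⟨y, rfl⟩
    obtain ⟨n, x, rfl⟩ := LC.exists_of y
    rw [LC.map_of, LC.δ, LC.post_of, Ext.comp_assoc _ _ _ (add_zero i) (zero_add 1) (by omega)]
    erw [(shortExact hf hg h).comp_extClass]
    simp

lemma LC.exact_δ_map (hf : Function.Injective f)
    (hg : Function.Surjective g) (h : Function.Exact f g) :
    Function.Exact (LC.δ a i hf hg h) (LC.map a (i + 1) f) := by
  intro z
  constructor
  · obtain ⟨n, x, rfl⟩ := LC.exists_of z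
    intro hz
    rw [LC.map_of] at hz
    obtain ⟨m, hm, hx⟩ := LC.zero_exact hz
    rw [EQt_apply, ← Ext.comp_assoc_of_third_deg_zero] at hx
    obtain ⟨y, hy⟩ := Ext.covariant_sequence_exact₁ _ (shortExact hf hg h) _ hx rfl
    refine ⟨LC.of a i m y, ?_⟩
    rw [LC.δ, LC.post_of, ← LC.of_t hm x]
    exact congrArg _ hy
  · rintro ⟨y, rfl⟩
    obtain ⟨n, x, rfl⟩ := LC.exists_of y
    rw [LC.δ, LC.post_of, LC.map_of, Ext.comp_assoc_of_third_deg_zero]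
    erw [(shortExact hf hg h).extClass_comp]
    simp

lemma LC.injective_map_zero (hf : Function.Injective f) : Function.Injective (LC.map a 0 f) := by
  rw [injective_iff_map_eq_zero]
  intro z hz
  obtain ⟨n, x, rfl⟩ := LC.exists_of z
  rw [LC.map_of] at hz
  obtain ⟨m, hm, hx⟩ := LC.zero_exact hz
  rw [EQt_apply, ← Ext.comp_assoc_of_third_deg_zero] at hx
  rw [← LC.of_t hm x]
  have : Mono (ModuleCat.ofHom f) := (ModuleCat.mono_iff_injective _).2 hf
  have := (injective_iff_map_eq_zero _).1
    (Ext.postcomp_mk₀_injective_of_mono (ModuleCat.of R (R ⧸ a ^ m)) (ModuleCat.ofHom f)) _ hx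
  rw [EQt_apply, this, map_zero]

end les

section H0

/-- degree zero elements as homs -/
noncomputable def EQ.hom {n : ℕ} (x : EQ a 0 M n) : (R ⧸ a ^ n) →ₗ[R] M :=
  (Ext.linearEquiv₀ (R := R) x).hom

/-- class of an element killed by `a^n`. -/
noncomputable def LC.cls (x : M) (n : ℕ) (h : ∀ r ∈ a ^ n, r • x = 0) : LC a 0 M :=
  LC.of a 0 n (Ext.mk₀ (ModuleCat.ofHom (Submodule.liftQ (a ^ n) (LinearMap.toSpanSingleton R M x)
    (by intro r hr; simpa using h r hr))))

lemma LC.map_cls (f : M →ₗ[R] N) (x : M) (n : ℕ) (h : ∀ r ∈ a ^ n, r • x = 0) :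
    LC.map a 0 f (LC.cls x n h) = LC.cls (f x) n
      (fun r hr => by rw [← map_smul, h r hr, map_zero]) := by
  rw [LC.cls, LC.map_of, Ext.mk₀_comp_mk₀, LC.cls]
  congr 2
  refine quot_hom_ext fun y => ?_
  change f (y • x) = y • f x
  simp

lemma LC.exists_cls (z : LC a 0 M) : ∃ x n h, z = LC.cls (a := a) (x : M) n h := by
  obtain ⟨n, e, rfl⟩ := LC.exists_of z
  obtain ⟨φ, rfl⟩ : ∃ φ, e = Ext.mk₀ φ := ⟨_, (Ext.mk₀_linearEquiv₀_apply (R := R) e).symm⟩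
  have key : ∀ r : R, φ.hom (Submodule.Quotient.mk r : R ⧸ a ^ n) =
      r • φ.hom (Submodule.Quotient.mk 1 : R ⧸ a ^ n) := by
    intro r
    rw [← map_smul, ← Submodule.Quotient.mk_smul, smul_eq_mul, mul_one]
  refine ⟨φ.hom (Submodule.Quotient.mk 1 : R ⧸ a ^ n), n, ?_, ?_⟩
  · intro r hr
    rw [← key, (Submodule.Quotient.mk_eq_zero _).2 hr, map_zero]
  · rw [LC.cls]
    congr 2
    refine quot_hom_ext fun y => ?_
    exact key y

lemma LC.cls_eq_zero {x : M} {n : ℕ} {h : ∀ r ∈ a ^ n, r • x = 0} :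
    LC.cls x n h = 0 ↔ x = 0 := by
  constructor
  · intro h0
    rw [LC.cls] at h0
    obtain ⟨m, hm, hx⟩ := LC.zero_exact h0
    rw [EQt_apply, Ext.mk₀_comp_mk₀, Ext.mk₀_eq_zero_iff] at hx
    have := congrArg (fun φ => φ.hom (Submodule.Quotient.mk 1 : R ⧸ a ^ m)) hx
    have h2 : (1 : R) • x = 0 := this
    simpa using h2
  · rintro rfl
    rw [LC.cls]
    rw [show (Ext.mk₀ (ModuleCat.ofHom (Submodule.liftQ (a ^ n) (LinearMap.toSpanSingleton R M 0)
      (by intro r hr; simp))) : EQ a 0 M n) = 0 from ?_, map_zero]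
    rw [Ext.mk₀_eq_zero_iff]
    refine quot_hom_ext fun y => ?_
    change y • (0 : M) = 0
    simp

/-- `LC 0` of a surjection out of... onto: if the source is torsion. -/
lemma LC.surjective_map_zero {f : M →ₗ[R] N} (hf : Function.Surjective f)
    (ht : ∀ x : M, ∃ n : ℕ, ∀ r ∈ a ^ n, r • x = 0) : Function.Surjective (LC.map a 0 f) := by
  intro z
  obtain ⟨x, n, h, rfl⟩ := LC.exists_cls z
  obtain ⟨y, rfl⟩ := hf x
  obtain ⟨m, hm⟩ := ht y
  have hk : ∀ (k l : ℕ) (hk : k ≤ l) (w : N) (h1 : ∀ r ∈ a ^ k, r • w = 0)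
      (h2 : ∀ r ∈ a ^ l, r • w = 0), LC.cls w k h1 = LC.cls w l h2 := by
    intro k l hkl w h1 h2
    rw [LC.cls, ← LC.of_t hkl, LC.cls, EQt_apply, Ext.mk₀_comp_mk₀]
    congr 2
    refine quot_hom_ext fun y => ?_
    rfl
  refine ⟨LC.cls y m hm, ?_⟩
  rw [LC.map_cls]
  rcases le_total n m with h' | h'
  · exact (hk _ _ h' _ _ _).symm
  · exact hk _ _ h' _ _ _

end H0
end model
end LCT

namespace LCT
open CategoryTheory Abelian Opposite Limits

section bridge
variable {R : Type u} [CommRing R]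

section opc
variable (L : ChainComplex (ModuleCat.{u} R)ᵒᵖ ℕ) (i : ℕ)

noncomputable def opJ : (L.opcycles i).unop ⟶ (L.X i).unop := (L.pOpcycles i).unop
noncomputable def opQ : (L.opcycles i).unop ⟶ (L.homology i).unop := (L.homologyι i).unop

lemma opJ_inj : Function.Injective (opJ L i).hom := by
  rw [← ModuleCat.mono_iff_injective]
  unfold opJ; infer_instance

lemma opQ_surj : Function.Surjective (opQ L i).hom := by
  rw [← ModuleCat.epi_iff_surjective]
  unfold opQ; infer_instance

lemma opJ_exact : Function.Exact (opJ L i).hom (L.d (i + 1) i).unop.hom := by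
  have h := (ShortComplex.exact_of_g_is_cokernel
    (ShortComplex.mk (L.d (i+1) i) (L.pOpcycles i) (by simp))
    (L.opcyclesIsCokernel (i+1) i (by simp))).unop
  exact (ShortComplex.ShortExact.moduleCat_exact_iff_function_exact _).1 h

lemma opQ_exact (j : ℕ) (hj : (ComplexShape.down ℕ).next i = j) :
    Function.Exact (L.fromOpcycles i j).unop.hom (opQ L i).hom := by
  have h := (ShortComplex.exact_of_f_is_kernel
    (ShortComplex.mk (L.homologyι i) (L.fromOpcycles i j) (by simp))
    (L.homologyIsKernel i j hj)).unop
  exact (ShortComplex.ShortExact.moduleCat_exact_iff_function_exact _).1 h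

lemma opQ_eq_zero_succ (p : ℕ) (c : (L.opcycles (p+1)).unop) :
    (opQ L (p+1)).hom c = 0 ↔ ∃ g : (L.X p).unop, (L.d (p+1) p).unop.hom g = (opJ L (p+1)).hom c := by
  have key : ∀ g, (opJ L (p+1)).hom ((L.fromOpcycles (p+1) p).unop.hom g) =
      (L.d (p+1) p).unop.hom g := by
    intro g
    rw [← L.p_fromOpcycles (p+1) p, unop_comp]
    rfl
  rw [opQ_exact L (p+1) p (by simp) c]
  constructor
  · rintro ⟨g, rfl⟩
    exact ⟨g, (key g).symm⟩
  · rintro ⟨g, hg⟩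
    exact ⟨g, opJ_inj L _ (by rw [key, hg])⟩

lemma opQ_eq_zero_zero (c : (L.opcycles 0).unop) :
    (opQ L 0).hom c = 0 ↔ c = 0 := by
  have key : ∀ g, (opJ L 0).hom ((L.fromOpcycles 0 0).unop.hom g) = 0 := by
    intro g
    have : (L.fromOpcycles 0 0) = 0 := by
      rw [← cancel_epi (L.pOpcycles 0), L.p_fromOpcycles 0 0, L.shape _ _ (by simp), comp_zero]
    rw [this]
    simp
  rw [opQ_exact L 0 0 (by simp) c]
  constructor
  · rintro ⟨g, rfl⟩
    exact opJ_inj L _ (by rw [key, map_zero])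
  · rintro rfl
    exact ⟨0, map_zero _⟩

variable {L i}
variable {L' : ChainComplex (ModuleCat.{u} R)ᵒᵖ ℕ} (φ : L' ⟶ L)

lemma opJ_nat (c) : (opJ L' i).hom ((HomologicalComplex.opcyclesMap φ i).unop.hom c) =
    (φ.f i).unop.hom ((opJ L i).hom c) := by
  have := congrArg (fun f => f.unop.hom c) (HomologicalComplex.p_opcyclesMap φ i)
  exact this

lemma opQ_nat (c) : (opQ L' i).hom ((HomologicalComplex.opcyclesMap φ i).unop.hom c) =
    (HomologicalComplex.homologyMap φ i).unop.hom ((opQ L i).hom c) := by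
  have := congrArg (fun f => f.unop.hom c) (HomologicalComplex.homologyι_naturality φ i)
  exact this.symm

end opc

section main
variable {X : ModuleCat.{u} R} (P : ProjectiveResolution X) (M : ModuleCat.{u} R) (i : ℕ)

noncomputable abbrev LX : ChainComplex (ModuleCat.{u} R)ᵒᵖ ℕ :=
  (((linearYoneda R (ModuleCat.{u} R)).obj M).rightOp.mapHomologicalComplex _).obj P.complex

/-- The cocycle as a morphism. -/
noncomputable def cocy (c : ((LX P M).opcycles i).unop) : P.complex.X i ⟶ M := (opJ (LX P M) i).hom c

lemma d_cocy (c : ((LX P M).opcycles i).unop) : P.complex.d (i+1) i ≫ cocy P M i c = 0 :=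
  (opJ_exact (LX P M) i).apply_apply_eq_zero c

lemma extMk_smul (r : R) (f : P.complex.X i ⟶ M) (hf : P.complex.d (i+1) i ≫ f = 0) :
    P.extMk (r • f) (i+1) rfl (by rw [Linear.comp_smul, hf, smul_zero]) = r • P.extMk f (i+1) rfl hf := by
  rw [Ext.smul_eq_comp_mk₀, ProjectiveResolution.extMk_comp_mk₀]
  congr 1

noncomputable def wmap : ((LX P M).opcycles i).unop →ₗ[R] Abelian.Ext X M i where
  toFun c := P.extMk (cocy P M i c) (i+1) rfl (d_cocy P M i c)
  map_add' c c' := by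
    rw [ProjectiveResolution.add_extMk]
    congr 1
    exact map_add (opJ (LX P M) i).hom c c'
  map_smul' r c := by
    rw [RingHom.id_apply, ← extMk_smul]
    congr 1
    exact map_smul (opJ (LX P M) i).hom r c

lemma wmap_apply (c) : wmap P M i c =
    P.extMk (cocy P M i c) (i+1) rfl (d_cocy P M i c) := rfl

lemma wmap_surj : Function.Surjective (wmap P M i) := by
  intro α
  obtain ⟨f, hf, rfl⟩ := P.extMk_surjective α (i+1) rfl
  obtain ⟨c, hc⟩ := (opJ_exact (LX P M) i f).1 hf
  refine ⟨c, ?_⟩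
  rw [wmap_apply]
  congr 1

lemma extMk_zero_iff (f : P.complex.X 0 ⟶ M) (hf : P.complex.d 1 0 ≫ f = 0) :
    P.extMk f 1 rfl hf = 0 ↔ f = 0 := by
  constructor
  · intro h
    rw [← P.extEquivCohomologyClass.apply_eq_iff_eq,
      ProjectiveResolution.extEquivCohomologyClass_extMk,
      ProjectiveResolution.extEquivCohomologyClass_zero,
      CochainComplex.HomComplex.CohomologyClass.mk_eq_zero_iff] at h
    rw [CochainComplex.HomComplex.Cocycle.toSingleMk_mem_coboundaries_iff _ _ _ _ _ 1 (by lia)] at h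
    obtain ⟨g, hg⟩ := h
    have : IsZero (P.cochainComplex.X 1) := P.cochainComplex.isZero_of_isStrictlyLE 0 1 (by lia)
    have hg0 : g = 0 := this.eq_of_src _ _
    rw [hg0, comp_zero] at hg
    have := (cancel_epi (P.cochainComplexXIso (-(0:ℕ)) 0 rfl).hom).1 (hg.symm.trans comp_zero.symm)
    exact this
  · rintro rfl
    simp

lemma ker_wmap : LinearMap.ker (wmap P M i) = LinearMap.ker (opQ (LX P M) i).hom := by
  ext c
  rw [LinearMap.mem_ker, LinearMap.mem_ker]
  rw [wmap_apply]
  cases i with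
  | zero =>
    rw [extMk_zero_iff, opQ_eq_zero_zero]
    exact map_eq_zero_iff (opJ (LX P M) 0).hom (opJ_inj (LX P M) 0)
  | succ p =>
    rw [P.extMk_eq_zero_iff _ _ _ _ p rfl, opQ_eq_zero_succ]
    rfl

noncomputable abbrev DExt (X M : ModuleCat.{u} R) (i : ℕ) : ModuleCat.{u} R :=
  ((_root_.Ext R (ModuleCat.{u} R) i).obj (op X)).obj M

noncomputable def dIso : ((LX P M).homology i).unop ≅ DExt X M i :=
  (P.isoLeftDerivedObj ((linearYoneda R (ModuleCat.{u} R)).obj M).rightOp i).unop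

noncomputable def vmap : ((LX P M).opcycles i).unop →ₗ[R] DExt X M i :=
  (dIso P M i).hom.hom ∘ₗ (opQ (LX P M) i).hom

lemma vmap_surj : Function.Surjective (vmap P M i) := by
  refine Function.Surjective.comp (g := (dIso P M i).hom.hom) ?_ (opQ_surj _ _)
  exact (ModuleCat.epi_iff_surjective _).1 inferInstance

lemma ker_vmap : LinearMap.ker (vmap P M i) = LinearMap.ker (opQ (LX P M) i).hom := by
  rw [vmap, LinearMap.ker_comp_of_ker_eq_bot]
  rw [LinearMap.ker_eq_bot]
  exact (ModuleCat.mono_iff_injective _).1 inferInstance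

noncomputable def bExt : Abelian.Ext X M i ≃ₗ[R] DExt X M i :=
  ((wmap P M i).quotKerEquivOfSurjective (wmap_surj P M i)).symm ≪≫ₗ
    (Submodule.quotEquivOfEq _ _ ((ker_wmap P M i).trans (ker_vmap P M i).symm)) ≪≫ₗ
    ((vmap P M i).quotKerEquivOfSurjective (vmap_surj P M i))

lemma bExt_wmap (c) : bExt P M i (wmap P M i c) = vmap P M i c := by
  have : ((wmap P M i).quotKerEquivOfSurjective (wmap_surj P M i)).symm (wmap P M i c) =
    Submodule.Quotient.mk c := by
    rw [LinearEquiv.symm_apply_eq]; rfl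
  simp only [bExt, LinearEquiv.trans_apply, this]
  rfl

variable {P M i}
lemma bExt_nat {X' : ModuleCat.{u} R} {P' : ProjectiveResolution X'} {g : X' ⟶ X}
    (φ : ProjectiveResolution.Hom P' P g) (x : Abelian.Ext X M i) :
    bExt P' M i ((Ext.mk₀ g).comp x (zero_add i)) =
      (((_root_.Ext R (ModuleCat.{u} R) i).map g.op).app M).hom (bExt P M i x) := by
  obtain ⟨c, rfl⟩ := wmap_surj P M i x
  let ψ : LX P' M ⟶ LX P M := 
    (((linearYoneda R (ModuleCat.{u} R)).obj M).rightOp.mapHomologicalComplex _).map φ.hom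
  have h1 : (Ext.mk₀ g).comp (wmap P M i c) (zero_add i) =
      wmap P' M i ((HomologicalComplex.opcyclesMap ψ i).unop.hom c) := by
    rw [wmap_apply, wmap_apply]
    rw [ProjectiveResolution.mk₀_comp_extMk _ _ _ _ φ]
    congr 1
    exact (opJ_nat ψ c).symm
  rw [h1, bExt_wmap, bExt_wmap]
  have h2 := P'.isoLeftDerivedObj_hom_naturality g P φ.hom φ.hom_f_zero_comp_π_f_zero ((linearYoneda R (ModuleCat.{u} R)).obj M).rightOp i
  have h3 := congrArg (fun f => f.unop.hom ((opQ (LX P M) i).hom c)) h2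
  refine Eq.trans ?_ h3.symm
  change (dIso P' M i).hom.hom _ = (dIso P' M i).hom.hom _
  congr 1
  exact opQ_nat ψ c

end main

section final
variable (a : Ideal R) (i : ℕ) (M : Type u) [AddCommGroup M] [Module R M]

noncomputable abbrev bE (X : ModuleCat.{u} R) :
    Abelian.Ext X (ModuleCat.of R M) i ≃ₗ[R] DExt X (ModuleCat.of R M) i :=
  bExt (projectiveResolution X) (ModuleCat.of R M) i

lemma bE_nat {X' X : ModuleCat.{u} R} (g : X' ⟶ X) (x : Abelian.Ext X (ModuleCat.of R M) i) :
    bE i M X' ((Ext.mk₀ g).comp x (zero_add i)) =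
      (((_root_.Ext R (ModuleCat.{u} R) i).map g.op).app (ModuleCat.of R M)).hom (bE i M X x) :=
  bExt_nat ⟨ProjectiveResolution.lift g _ _,
    by rw [ProjectiveResolution.lift_commutes_zero]; rfl⟩ x

noncomputable abbrev dg : (ℕᵒᵖ)ᵒᵖ ⥤ ModuleCat.{u} R ⥤ ModuleCat.{u} R :=
  localCohomology.diagram (localCohomology.idealPowersDiagram a) i

lemma dg_map {m n : (ℕᵒᵖ)ᵒᵖ} (f : m ⟶ n) (x : EQ a i M (unop (unop m))) :
    ((((evaluation _ _).obj (ModuleCat.of R M)).mapCocone (colimit.cocone (dg a i))).pt =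
      ((localCohomology a i).obj (ModuleCat.of R M))) ∧
    (((dg a i).map f).app (ModuleCat.of R M)).hom (bE i M _ x) =
      bE i M _ (EQt a i M (unop (unop m)) (unop (unop n)) f.unop.unop.le x) := by
  refine ⟨rfl, ?_⟩
  rw [EQt_apply, bE_nat]
  rfl

/-- `bE` for the quotients `R ⧸ a ^ n`. -/
noncomputable abbrev bQ (n : ℕ) : EQ a i M n ≃ₗ[R]
    DExt (ModuleCat.of R (R ⧸ a ^ n)) (ModuleCat.of R M) i :=
  bE i M (ModuleCat.of R (R ⧸ a ^ n))

noncomputable def coc : Cocone (dg a i ⋙ (evaluation _ _).obj (ModuleCat.of R M)) where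
  pt := ModuleCat.of R (LC a i M)
  ι := 
    { app := fun n => ModuleCat.ofHom (LC.of a i (unop (unop n)) ∘ₗ (bQ a i M _).symm.toLinearMap)
      naturality := by
        intro m n f
        apply ModuleCat.hom_ext
        apply LinearMap.ext
        intro x
        obtain ⟨x, rfl⟩ : ∃ y, bQ a i M (unop (unop m)) y = x := (bQ a i M _).surjective x
        change LC.of a i _ ((bQ a i M _).symm ((((dg a i).map f).app (ModuleCat.of R M)).hom
          (bQ a i M _ x))) = LC.of a i _ ((bQ a i M _).symm (bQ a i M _ x))
        refine (congrArg (fun y => LC.of a i (unop (unop n)) ((bQ a i M _).symm y))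
          (dg_map a i M f x).2).trans ?_
        change LC.of a i (unop (unop n)) ((bQ a i M _).symm (bQ a i M _ _)) = _
        rw [LinearEquiv.symm_apply_apply, LinearEquiv.symm_apply_apply,
          LC.of_t] }

noncomputable def dsc (s : Cocone (dg a i ⋙ (evaluation _ _).obj (ModuleCat.of R M))) :
    LC a i M →ₗ[R] s.pt :=
  Module.DirectLimit.lift R ℕ (EQ a i M) (EQt a i M)
    (fun n => (s.ι.app (op (op n))).hom ∘ₗ (bQ a i M n).toLinearMap) (by
      intro m n h x
      have := s.w (show op (op m) ⟶ op (op n) from (homOfLE h).op.op)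
      have h2 := congrArg (fun f => f.hom (bQ a i M m x)) this
      refine Eq.trans ?_ h2
      change (s.ι.app (op (op n))).hom _ = (s.ι.app (op (op n))).hom _
      congr 1
      exact (dg_map a i M (homOfLE h).op.op x).2.symm)

lemma dsc_of (s) (n : ℕ) (x : EQ a i M n) :
    dsc a i M s (LC.of a i n x) = (s.ι.app (op (op n))).hom (bQ a i M n x) :=
  Module.DirectLimit.lift_of _ _ x

noncomputable def cocIsColimit : IsColimit (coc a i M) where
  desc s := ModuleCat.ofHom (dsc a i M s)
  fac s j := by
    apply ModuleCat.hom_ext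
    apply LinearMap.ext
    intro x
    obtain ⟨x, rfl⟩ : ∃ y, bQ a i M (unop (unop j)) y = x := (bQ a i M _).surjective x
    change dsc a i M s (LC.of a i (unop (unop j)) ((bQ a i M _).symm (bQ a i M _ x))) = _
    rw [LinearEquiv.symm_apply_apply, dsc_of]
  uniq s f hf := by
    apply ModuleCat.hom_ext
    apply LinearMap.ext
    intro z
    obtain ⟨n, x, rfl⟩ := LC.exists_of z
    have := congrArg (fun g => g.hom (bQ a i M n x)) (hf (op (op n)))
    have h2 : f.hom (LC.of a i n ((bQ a i M _).symm (bQ a i M n x))) = 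
      (s.ι.app (op (op n))).hom (bQ a i M n x) := this
    rw [LinearEquiv.symm_apply_apply] at h2
    rw [h2]
    exact (dsc_of a i M s n x).symm

noncomputable def bridge : LC a i M ≃ₗ[R] (localCohomology a i).obj (ModuleCat.of R M) :=
  ((cocIsColimit a i M).coconePointUniqueUpToIso
    (isColimitOfPreserves ((evaluation _ _).obj (ModuleCat.of R M))
      (colimit.isColimit (dg a i)))).toLinearEquiv

end final

end bridge
end LCT

namespace LCT
open CategoryTheory Abelian

section torsion
variable {R : Type u} [CommRing R]

def Tors (a : Ideal R) (N : Type*) [AddCommGroup N] [Module R N] : Prop :=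
  ∀ x : N, ∃ n : ℕ, ∀ r ∈ a ^ n, r • x = 0

def Gam (a : Ideal R) (N : Type*) [AddCommGroup N] [Module R N] : Submodule R N where
  carrier := {x | ∃ n : ℕ, ∀ r ∈ a ^ n, r • x = 0}
  zero_mem' := ⟨0, fun r _ => smul_zero r⟩
  add_mem' := by
    rintro x y ⟨n, hn⟩ ⟨m, hm⟩
    refine ⟨max n m, fun r hr => ?_⟩
    rw [smul_add, hn r (Ideal.pow_le_pow_right (le_max_left _ _) hr),
      hm r (Ideal.pow_le_pow_right (le_max_right _ _) hr), add_zero]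
  smul_mem' := by
    rintro c x ⟨n, hn⟩
    exact ⟨n, fun r hr => by rw [smul_comm, hn r hr, smul_zero]⟩

lemma mem_Gam {a : Ideal R} {N : Type*} [AddCommGroup N] [Module R N] {x : N} :
    x ∈ Gam a N ↔ ∃ n : ℕ, ∀ r ∈ a ^ n, r • x = 0 := Iff.rfl

lemma Tors_Gam (a : Ideal R) (N : Type*) [AddCommGroup N] [Module R N] : Tors a (Gam a N) := by
  rintro ⟨x, n, hn⟩
  exact ⟨n, fun r hr => Subtype.ext (hn r hr)⟩

lemma Tors.of_surjective {a : Ideal R} {N N' : Type*} [AddCommGroup N] [Module R N]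
    [AddCommGroup N'] [Module R N'] (h : Tors a N) (f : N →ₗ[R] N') (hf : Function.Surjective f) :
    Tors a N' := by
  intro y
  obtain ⟨x, rfl⟩ := hf y
  obtain ⟨n, hn⟩ := h x
  exact ⟨n, fun r hr => by rw [← map_smul, hn r hr, map_zero]⟩

/-- for a finitely generated submodule of a torsion module: uniform exponent -/
lemma Tors.uniform {a : Ideal R} {N N' : Type*} [AddCommGroup N] [Module R N]
    [AddCommGroup N'] [Module R N'] [Module.Finite R N] (h : Tors a N') (f : N →ₗ[R] N') :
    ∃ n : ℕ, ∀ r ∈ a ^ n, ∀ x, r • f x = 0 := by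
  obtain ⟨s, hs⟩ := Module.Finite.fg_top (R := R) (M := N)
  choose e he using h
  refine ⟨s.sup (fun x => e (f x)), fun r hr x => ?_⟩
  have hx : x ∈ Submodule.span R (s : Set N) := by rw [hs]; trivial
  induction hx using Submodule.span_induction with
  | mem x hx =>
    exact he _ r (Ideal.pow_le_pow_right (Finset.le_sup (f := fun x => e (f x)) hx) hr)
  | zero => simp
  | add x y _ _ hx hy => rw [map_add, smul_add, hx, hy, add_zero]
  | smul c x _ hx => rw [map_smul, smul_comm, hx, smul_zero]

lemma injective_Gam [IsNoetherianRing R] (a : Ideal R) (E : Type u) [AddCommGroup E] [Module R E]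
    [hE : Module.Injective R E] : Module.Injective R (Gam a E) := by
  apply Module.Baer.injective
  intro I g
  obtain ⟨k, hk⟩ := (Tors_Gam a E).uniform g
  obtain ⟨k0, hk0⟩ := Ideal.exists_pow_inf_eq_pow_smul (M := R) a I
  let f : I →ₗ[R] R ⧸ a ^ (k0 + k) := (a ^ (k0 + k)).mkQ ∘ₗ I.subtype
  have hker : LinearMap.ker f ≤ LinearMap.ker g := by
    intro y hy
    have hy1 : (y : R) ∈ a ^ (k0 + k) := by
      have : (Submodule.Quotient.mk (y : R) : R ⧸ a ^ (k0 + k)) = 0 := hy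
      rwa [Submodule.Quotient.mk_eq_zero] at this
    have hy2 : (y : R) ∈ a ^ (k0 + k) • (⊤ : Submodule R R) ⊓ I :=
      ⟨by simpa using hy1, y.2⟩
    rw [hk0 (k0 + k) (by omega), Nat.add_sub_cancel_left] at hy2
    have hy3 : (y : R) ∈ a ^ k • I := Submodule.smul_mono le_rfl inf_le_right hy2
    have : ∀ z : R, z ∈ a ^ k • I → ∃ hz : z ∈ I, g ⟨z, hz⟩ = 0 := by
      intro z hz
      induction hz using Submodule.smul_induction_on' with
      | smul r hr n hn =>
        refine ⟨I.smul_mem r hn, ?_⟩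
        have := hk r hr ⟨n, hn⟩
        rw [← map_smul] at this
        exact this
      | add x _ y _ hx hy =>
        obtain ⟨hx, hx'⟩ := hx
        obtain ⟨hy, hy'⟩ := hy
        refine ⟨I.add_mem hx hy, ?_⟩
        have := map_add g ⟨x, hx⟩ ⟨y, hy⟩
        rw [hx', hy', add_zero] at this
        exact this
    obtain ⟨_, h⟩ := this y hy3
    exact h
  obtain ⟨h, hh⟩ := hE.out ((LinearMap.ker f).liftQ f le_rfl)
    (LinearMap.ker_eq_bot.1 (Submodule.ker_liftQ_eq_bot _ _ _ le_rfl))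
    ((LinearMap.ker f).liftQ ((Gam a E).subtype ∘ₗ g)
      (hker.trans (LinearMap.ker_le_ker_comp _ _)))
  refine ⟨LinearMap.codRestrict (Gam a E) (h ∘ₗ (a ^ (k0 + k)).mkQ) ?_, ?_⟩
  · intro c
    refine ⟨k0 + k, fun r hr => ?_⟩
    rw [← map_smul, LinearMap.comp_apply, show (a ^ (k0+k)).mkQ (r • c) = 0 from
      (Submodule.Quotient.mk_eq_zero _).2 (Ideal.mul_mem_right _ _ hr), map_zero]
  · intro x hx
    have := hh (Submodule.Quotient.mk ⟨x, hx⟩)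
    exact Subtype.ext this

lemma exists_injective_embedding (N : Type u) [AddCommGroup N] [Module R N] :
    ∃ (E : Type u) (_ : AddCommGroup E) (_ : Module R E) (_ : Module.Injective R E)
      (f : N →ₗ[R] E), Function.Injective f := by
  let J : ModuleCat.{u} R := Injective.under (ModuleCat.of R N)
  refine ⟨J, inferInstance, inferInstance, ?_, (Injective.ι (ModuleCat.of R N)).hom, ?_⟩
  · have : Injective (ModuleCat.of R J) := Injective.injective_under (ModuleCat.of R N)
    exact Module.injective_module_of_injective_object R J
  · exact (ModuleCat.mono_iff_injective _).1 inferInstance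

lemma LC.subsingleton_of_tors [IsNoetherianRing R] {a : Ideal R} (i : ℕ) :
    ∀ (N : Type u) [AddCommGroup N] [Module R N] (_ : Tors a N), Subsingleton (LC a (i + 1) N) := by
  induction i with
  | zero =>
    intro N _ _ hN
    obtain ⟨E, _, _, _, f, hf⟩ := exists_injective_embedding (R := R) N
    have hinj := injective_Gam a E
    have : Injective (ModuleCat.of R (Gam a E)) := Module.injective_object_of_injective_module R _
    let f' : N →ₗ[R] Gam a E := LinearMap.codRestrict _ f (fun x => by
      obtain ⟨n, hn⟩ := hN x
      exact ⟨n, fun r hr => by rw [← map_smul, hn r hr, map_zero]⟩)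
    have hf' : Function.Injective f' := fun x y h => hf (congrArg Subtype.val h)
    have hex : Function.Exact f' (LinearMap.range f').mkQ := LinearMap.exact_map_mkQ_range f'
    have hsurj := Submodule.mkQ_surjective (LinearMap.range f')
    have h1 : Subsingleton (LC a (0+1) (Gam a E)) := LC.subsingleton_of_injective
    refine subsingleton_of_forall_eq 0 fun z => ?_
    obtain ⟨w, rfl⟩ := (LC.exact_δ_map (a := a) (i := 0) hf' hsurj hex z).1 (Subsingleton.elim _ _)
    exact (LC.exact_map_δ (a := a) (i := 0) hf' hsurj hex w).2
      (LC.surjective_map_zero hsurj (Tors_Gam a E) w)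
  | succ i ih =>
    intro N _ _ hN
    obtain ⟨E, _, _, _, f, hf⟩ := exists_injective_embedding (R := R) N
    have hinj := injective_Gam a E
    have : Injective (ModuleCat.of R (Gam a E)) := Module.injective_object_of_injective_module R _
    let f' : N →ₗ[R] Gam a E := LinearMap.codRestrict _ f (fun x => by
      obtain ⟨n, hn⟩ := hN x
      exact ⟨n, fun r hr => by rw [← map_smul, hn r hr, map_zero]⟩)
    have hf' : Function.Injective f' := fun x y h => hf (congrArg Subtype.val h)
    have hex : Function.Exact f' (LinearMap.range f').mkQ := LinearMap.exact_map_mkQ_range f'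
    have hsurj := Submodule.mkQ_surjective (LinearMap.range f')
    have h1 : Subsingleton (LC a (i+1+1) (Gam a E)) := LC.subsingleton_of_injective
    have h2 := ih (Gam a E ⧸ LinearMap.range f') ((Tors_Gam a E).of_surjective _ hsurj)
    refine subsingleton_of_forall_eq 0 fun z => ?_
    obtain ⟨w, rfl⟩ := (LC.exact_δ_map (a := a) (i := i+1) hf' hsurj hex z).1 (Subsingleton.elim _ _)
    rw [Subsingleton.elim w 0, map_zero]

end torsion
end LCT

namespace LCT
open CategoryTheory Abelian

section hull

lemma exists_max_disjoint {R : Type*} [CommRing R] {M : Type*} [AddCommGroup M] [Module R M]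
    (A K : Submodule R M) (h : Disjoint A K) :
    ∃ N : Submodule R M, A ≤ N ∧ Disjoint N K ∧ ∀ N', N ≤ N' → Disjoint N' K → N' = N := by
  obtain ⟨N, hN, hmax⟩ := zorn_le_nonempty₀ {N : Submodule R M | Disjoint N K} (by
    intro c hc hchain y hy
    refine ⟨sSup c, ?_, fun z hz => le_sSup hz⟩
    exact (DirectedOn.disjoint_sSup_left hchain.directedOn).2 fun b hb => hc hb) A h
  exact ⟨N, hN, hmax.prop, fun N' h1 h2 => le_antisymm (hmax.le_of_ge h2 h1) h1⟩

variable (R : Type u) [CommRing R] [IsNoetherianRing R] [IsLocalRing R]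

/-- The properties of the injective hull of the residue field which are used. -/
structure IsHull (E : Type u) [AddCommGroup E] [Module R E] : Prop where
  inj : Module.Injective R E
  fin : Module.Finite R ((R ⧸ IsLocalRing.maximalIdeal R) →ₗ[R] E)
  emb : ∃ f : (R ⧸ IsLocalRing.maximalIdeal R) →ₗ[R] E, Function.Injective f

theorem exists_hull : ∃ (E : Type u) (_ : AddCommGroup E) (_ : Module R E), IsHull R E := by
  obtain ⟨E0, _, _, hE0, f, hf⟩ := exists_injective_embedding (R := R)
    (R ⧸ IsLocalRing.maximalIdeal R)
  let K : Submodule R E0 := LinearMap.range f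
  obtain ⟨N, -, hNK, hN⟩ := exists_max_disjoint (⊥ : Submodule R E0) K disjoint_bot_left
  obtain ⟨E, hKE, hEN, hE⟩ := exists_max_disjoint K N hNK.symm
  have hj : Function.Injective (N.mkQ ∘ₗ E.subtype) := by
    rw [← LinearMap.ker_eq_bot, eq_bot_iff]
    intro e he
    have : (e : E0) ∈ N := (Submodule.Quotient.mk_eq_zero _).1 he
    exact Subtype.ext (Submodule.disjoint_def.1 hEN _ e.2 this)
  obtain ⟨ψ, hψ⟩ := hE0.out _ hj E.subtype
  have hψ' : ∀ e ∈ E, ψ (N.mkQ e) = e := fun e he => hψ ⟨e, he⟩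
  have key : ∀ X : Submodule R E0, N ≤ X → (∀ e ∈ E, e ∈ X → e = 0) → X = N := by
    intro X hX h
    apply hN X hX
    rw [Submodule.disjoint_def]
    exact fun x hx hk => h x (hKE hk) hx
  have hker : ∀ y, ψ (N.mkQ y) ∈ N → y ∈ N := by
    intro y hy
    have := key (N.comap (ψ ∘ₗ N.mkQ)) (fun n hn => by
      have : N.mkQ n = 0 := (Submodule.Quotient.mk_eq_zero _).2 hn
      simp [-Submodule.mkQ_apply, this]) (fun e he h => by
        have h' : ψ (N.mkQ e) ∈ N := h
        rw [hψ' e he] at h'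
        exact Submodule.disjoint_def.1 hEN _ he h')
    rw [← this]; exact hy
  have hrange : LinearMap.range ψ = E := by
    apply hE
    · intro e he; exact ⟨_, hψ' e he⟩
    · rw [Submodule.disjoint_def]
      rintro _ ⟨y, rfl⟩ h
      obtain ⟨y, rfl⟩ := N.mkQ_surjective y
      rw [show N.mkQ y = 0 from (Submodule.Quotient.mk_eq_zero _).2 (hker y h), map_zero]
  let ρ : E0 →ₗ[R] E := LinearMap.codRestrict E (ψ ∘ₗ N.mkQ) (fun y => by
    rw [← hrange]; exact ⟨_, rfl⟩)
  have hρ : ∀ e : E, ρ e = e := fun e => Subtype.ext (hψ e)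
  have hess : ∀ X : Submodule R E0, X ≤ E → Disjoint X K → X = ⊥ := by
    intro X hXE hXK
    have h1 : X ⊔ N = N := by
      apply hN _ le_sup_right
      rw [Submodule.disjoint_def]
      intro y hy hk
      obtain ⟨x, hx, n, hn, rfl⟩ := Submodule.mem_sup.1 hy
      have e1 := hψ' (x + n) (hKE hk)
      rw [map_add, show N.mkQ n = 0 from (Submodule.Quotient.mk_eq_zero _).2 hn, add_zero,
        hψ' x (hXE hx)] at e1
      rw [← e1] at hk ⊢
      exact Submodule.disjoint_def.1 hXK _ hx hk
    rw [eq_bot_iff]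
    intro x hx
    exact Submodule.disjoint_def.1 hEN _ (hXE hx) (h1 ▸ Submodule.mem_sup_left hx)
  refine ⟨E, inferInstance, inferInstance, ⟨fun X Y _ _ _ _ g hg φ => ?_⟩, ?_, ?_⟩
  · obtain ⟨h, hh⟩ := hE0.out g hg (E.subtype ∘ₗ φ)
    exact ⟨ρ ∘ₗ h, fun x => by
      rw [LinearMap.comp_apply, hh]; exact hρ _⟩
  · have h1 : ∀ φ : (R ⧸ IsLocalRing.maximalIdeal R) →ₗ[R] E, (φ 1 : E0) ∈ K := by
      intro φ
      by_contra hcon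
      have hd : Disjoint (LinearMap.range (E.subtype ∘ₗ φ)) K := by
        rw [Submodule.disjoint_def]
        rintro _ ⟨c, rfl⟩ hk
        obtain ⟨r, rfl⟩ := Submodule.mkQ_surjective _ c
        by_cases hr : r ∈ IsLocalRing.maximalIdeal R
        · rw [show Submodule.mkQ _ r = 0 from (Submodule.Quotient.mk_eq_zero _).2 hr, map_zero]
        · exfalso
          apply hcon
          have hu : IsUnit r := by simpa using hr
          have : Submodule.mkQ (IsLocalRing.maximalIdeal R) r =
            r • (1 : R ⧸ IsLocalRing.maximalIdeal R) := by
              rw [← map_one (Ideal.Quotient.mk _)]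
              change _ = Submodule.mkQ _ (r • 1)
              simp
          rw [this, map_smul] at hk
          obtain ⟨u, rfl⟩ := hu
          have := K.smul_mem (↑u⁻¹ : R) hk
          rwa [smul_smul, Units.inv_mul, one_smul] at this
      have h0 := hess _ (by rintro _ ⟨c, rfl⟩; exact (φ c).2) hd
      apply hcon
      have : (φ 1 : E0) ∈ LinearMap.range (E.subtype ∘ₗ φ) := ⟨1, rfl⟩
      rw [h0] at this
      rw [(Submodule.mem_bot R).1 this]
      exact K.zero_mem
    let ev : ((R ⧸ IsLocalRing.maximalIdeal R) →ₗ[R] E) →ₗ[R] K :=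
      LinearMap.codRestrict K (E.subtype ∘ₗ LinearMap.applyₗ 1) h1
    have hev : Function.Injective ev := by
      intro φ φ' h
      have h2 : φ 1 = φ' 1 := Subtype.ext (congrArg (fun z : K => (z : E0)) h)
      apply LinearMap.ext
      intro c
      obtain ⟨r, rfl⟩ := Submodule.mkQ_surjective _ c
      have : Submodule.mkQ (IsLocalRing.maximalIdeal R) r =
            r • (1 : R ⧸ IsLocalRing.maximalIdeal R) := by
              rw [← map_one (Ideal.Quotient.mk _)]
              change _ = Submodule.mkQ _ (r • 1)
              simp
      rw [this, map_smul, map_smul, h2]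
    exact Module.Finite.of_injective ev hev
  · exact ⟨LinearMap.codRestrict E f (fun c => hKE ⟨c, rfl⟩),
      fun x y h => hf (congrArg Subtype.val h)⟩

end hull

end LCT

namespace LCT
open CategoryTheory Abelian

section nak

lemma mem_smul_top_pi {R : Type*} [CommRing R] (I : Ideal R) (n : ℕ) (x : Fin n → R)
    (h : ∀ j, x j ∈ I) : x ∈ I • (⊤ : Submodule R (Fin n → R)) := by
  rw [pi_eq_sum_univ x]
  exact Submodule.sum_mem _ fun j _ => Submodule.smul_mem_smul (h j) trivial

lemma isPrecomplete_pi {R : Type*} [CommRing R] (I : Ideal R) [hI : IsPrecomplete I R] (n : ℕ) :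
    IsPrecomplete I (Fin n → R) := by
  refine ⟨fun f hf => ?_⟩
  have h1 : ∀ j, ∃ L : R, ∀ k, f k j ≡ L [SMOD (I ^ k • ⊤ : Submodule R R)] := by
    intro j
    apply hI.prec'
    intro m k hmk
    have := hf hmk
    rw [SModEq.sub_mem] at this ⊢
    have h2 := Submodule.mem_map_of_mem (f := (LinearMap.proj j : (Fin n → R) →ₗ[R] R)) this
    rw [Submodule.map_smul''] at h2
    exact Submodule.smul_mono le_rfl le_top h2
  choose L hL using h1
  refine ⟨L, fun k => ?_⟩
  rw [SModEq.sub_mem]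
  apply mem_smul_top_pi
  intro j
  have := hL j k
  rw [SModEq.sub_mem] at this
  simpa using this

lemma finite_of_hausdorff {R : Type*} [CommRing R] [IsNoetherianRing R] (I : Ideal R)
    [IsPrecomplete I R]
    {V W : Type*} [AddCommGroup V] [Module R V] [AddCommGroup W] [Module R W]
    [IsHausdorff I V] [Module.Finite R W] (g : V →ₗ[R] W)
    (hg : ∀ v, g v = 0 → v ∈ I • (⊤ : Submodule R V)) : Module.Finite R V := by
  obtain ⟨n, q, hq⟩ := Module.Finite.exists_fin' R (LinearMap.range g)
  obtain ⟨f, hf⟩ := Module.projective_lifting_property g.rangeRestrict q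
    g.surjective_rangeRestrict
  have := isPrecomplete_pi I n
  refine Module.Finite.of_surjective f (surjective_of_mkQ_comp_surjective (I := I) ?_)
  intro y
  obtain ⟨v, rfl⟩ := Submodule.mkQ_surjective _ y
  obtain ⟨x, hx⟩ := hq (g.rangeRestrict v)
  refine ⟨x, ?_⟩
  rw [LinearMap.comp_apply, ← sub_eq_zero, ← map_sub]
  refine (Submodule.Quotient.mk_eq_zero _).2 (hg _ ?_)
  rw [map_sub, sub_eq_zero]
  have : g.rangeRestrict (f x) = g.rangeRestrict v := by
    rw [← hx, ← hf]; rfl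
  exact congrArg Subtype.val this

end nak

section cls
set_option linter.unusedSectionVars false
variable {R : Type u} [CommRing R]

lemma dual_hausdorff (m : Ideal R) (E : Type u) [AddCommGroup E] [Module R E]
    {H : Type u} [AddCommGroup H] [Module R H] (hH : Tors m H) : IsHausdorff m (H →ₗ[R] E) := by
  refine ⟨fun φ hφ => LinearMap.ext fun x => ?_⟩
  obtain ⟨n, hn⟩ := hH x
  have h1 := hφ n
  rw [SModEq.zero] at h1
  have : ∀ ψ : H →ₗ[R] E, ψ ∈ m ^ n • (⊤ : Submodule R (H →ₗ[R] E)) → ψ x = 0 := by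
    intro ψ hψ
    induction hψ using Submodule.smul_induction_on' with
    | smul r hr ψ _ => rw [LinearMap.smul_apply, ← map_smul, hn r hr, map_zero]
    | add _ _ _ _ h1 h2 => rw [LinearMap.add_apply, h1, h2, add_zero]
  exact this φ h1

lemma Tors.of_injective {a : Ideal R} {N N' : Type*} [AddCommGroup N] [Module R N]
    [AddCommGroup N'] [Module R N'] (h : Tors a N') (f : N →ₗ[R] N') (hf : Function.Injective f) :
    Tors a N := by
  intro y
  obtain ⟨n, hn⟩ := h (f y)
  exact ⟨n, fun r hr => hf (by rw [map_smul, hn r hr, map_zero])⟩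

lemma Tors.of_exact {a : Ideal R} {A B C : Type*} [AddCommGroup A] [Module R A]
    [AddCommGroup B] [Module R B] [AddCommGroup C] [Module R C] (ha : a.FG)
    {f : A →ₗ[R] B} {g : B →ₗ[R] C} (h : Function.Exact f g) (hA : Tors a A) (hC : Tors a C) :
    Tors a B := by
  intro y
  obtain ⟨n, hn⟩ := hC (g y)
  have hfg : (a ^ n).FG := ha.pow
  have : Module.Finite R (a ^ n : Ideal R) := Module.Finite.of_fg hfg
  have hT : Tors a (LinearMap.range f) := hA.of_surjective f.rangeRestrict f.surjective_rangeRestrict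
  obtain ⟨k, hk⟩ := hT.uniform (N := (a ^ n : Ideal R))
    (LinearMap.codRestrict (LinearMap.range f) ((LinearMap.toSpanSingleton R B y) ∘ₗ
      Submodule.subtype (a ^ n)) (by
        rintro ⟨r, hr⟩
        apply (h _).1
        simp [hn r hr]))
  refine ⟨k + n, fun r hr => ?_⟩
  rw [pow_add] at hr
  induction hr using Submodule.mul_induction_on' with
  | mem_mul_mem r hr s hs =>
    have := congrArg Subtype.val (hk r hr ⟨s, hs⟩)
    simpa [mul_smul] using this
  | add _ _ _ _ h1 h2 => rw [add_smul, h1, h2, add_zero]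

variable [IsNoetherianRing R] [IsLocalRing R]

/-- modules which are torsion with finitely generated Matlis dual -/
structure InC (R : Type u) [CommRing R] [IsLocalRing R] (E : Type u) [AddCommGroup E] [Module R E] (H : Type u) [AddCommGroup H]
    [Module R H] : Prop where
  tors : Tors (IsLocalRing.maximalIdeal R) H
  fin : Module.Finite R (H →ₗ[R] E)

variable {E : Type u} [AddCommGroup E] [Module R E]
variable {A B C : Type u} [AddCommGroup A] [Module R A]
    [AddCommGroup B] [Module R B] [AddCommGroup C] [Module R C]

lemma InC.of_subsingleton [Subsingleton A] : InC R E A :=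
  ⟨fun x => ⟨0, fun r _ => by rw [Subsingleton.elim x 0, smul_zero]⟩, inferInstance⟩

lemma InC.of_surjective (h : InC R E A) (f : A →ₗ[R] B) (hf : Function.Surjective f) : InC R E B := by
  have := h.fin
  refine ⟨h.tors.of_surjective f hf, Module.Finite.of_injective (LinearMap.lcomp R E f) ?_⟩
  exact fun φ φ' h => (LinearMap.cancel_right hf).1 h

lemma InC.of_injective (hE : IsHull R E) (h : InC R E B) (f : A →ₗ[R] B)
    (hf : Function.Injective f) : InC R E A := by
  have := h.fin
  refine ⟨h.tors.of_injective f hf, Module.Finite.of_surjective (LinearMap.lcomp R E f) ?_⟩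
  intro φ
  obtain ⟨ψ, hψ⟩ := hE.inj.out f hf φ
  exact ⟨ψ, LinearMap.ext hψ⟩

lemma InC.of_exact (hE : IsHull R E) (hA : InC R E A) (hC : InC R E C)
    {f : A →ₗ[R] B} {g : B →ₗ[R] C} (h : Function.Exact f g) : InC R E B := by
  refine ⟨hA.tors.of_exact (IsNoetherian.noetherian _) h hC.tors, ?_⟩
  have := hA.fin
  have := hC.fin
  have hex : Function.Exact (LinearMap.lcomp R E g) (LinearMap.lcomp R E f) := by
    intro φ
    constructor
    · intro hφ
      have hk : LinearMap.ker g ≤ LinearMap.ker φ := by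
        intro y hy
        obtain ⟨x, rfl⟩ := (h y).1 hy
        exact LinearMap.congr_fun hφ x
      obtain ⟨ψ, hψ⟩ := hE.inj.out ((LinearMap.ker g).liftQ g le_rfl)
        (LinearMap.ker_eq_bot.1 (Submodule.ker_liftQ_eq_bot _ _ _ le_rfl))
        ((LinearMap.ker g).liftQ φ hk)
      exact ⟨ψ, LinearMap.ext fun y => hψ (Submodule.Quotient.mk y)⟩
    · rintro ⟨ψ, rfl⟩
      ext x
      change ψ (g (f x)) = 0
      rw [(h (f x)).2 ⟨x, rfl⟩, map_zero]
  have h1 : Module.Finite R (LinearMap.range (LinearMap.lcomp R E g)) := inferInstance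
  have h2 : Module.Finite R (LinearMap.ker (LinearMap.lcomp R E f)) := by
    rw [LinearMap.exact_iff.1 hex]; exact h1
  have h3 : Module.Finite R (LinearMap.range (LinearMap.lcomp R E f)) := inferInstance
  have hn : IsNoetherian R (B →ₗ[R] E) := isNoetherian_of_range_eq_ker
    (LinearMap.ker (LinearMap.lcomp R E f)).subtype (LinearMap.lcomp R E f) (by simp)
  infer_instance

/-- duals of nonzero torsion modules are nonzero -/
lemma nontrivial_dual (hE : IsHull R E) (hA : Tors (IsLocalRing.maximalIdeal R) A)
    [Nontrivial A] : Nontrivial (A →ₗ[R] E) := by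
  obtain ⟨x, hx⟩ := exists_ne (0 : A)
  have h1 : ∃ y : A, y ≠ 0 ∧ ∀ r ∈ IsLocalRing.maximalIdeal R, r • y = 0 := by
    obtain ⟨n, hn⟩ := hA x
    induction n generalizing x with
    | zero => exact absurd (by simpa using hn 1 (by simp)) hx
    | succ n ih =>
      by_cases h : ∀ r ∈ IsLocalRing.maximalIdeal R, r • x = 0
      · exact ⟨x, hx, h⟩
      · push Not at h
        obtain ⟨r, hr, hrx⟩ := h
        exact ih (r • x) hrx fun s hs => by
          rw [smul_smul]; exact hn _ (by rw [pow_succ]; exact Ideal.mul_mem_mul hs hr)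
  obtain ⟨y, hy, hm⟩ := h1
  obtain ⟨f, hf⟩ := hE.emb
  let g : (R ⧸ IsLocalRing.maximalIdeal R) →ₗ[R] A :=
    Submodule.liftQ _ (LinearMap.toSpanSingleton R A y) (fun r hr => by simp [hm r hr])
  have hg : Function.Injective g := by
    rw [← LinearMap.ker_eq_bot, eq_bot_iff]
    intro c hc
    obtain ⟨r, rfl⟩ := Submodule.mkQ_surjective _ c
    have hr : r • y = 0 := hc
    refine (Submodule.Quotient.mk_eq_zero _).2 ?_
    by_contra hcon
    have hu : IsUnit r := by simpa using hcon
    exact hy ((hu.smul_eq_zero).1 hr)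
  obtain ⟨φ, hφ⟩ := hE.inj.out g hg f
  refine nontrivial_of_ne φ 0 ?_
  rintro rfl
  have h0 : f (Submodule.Quotient.mk 1) = 0 := by rw [← hφ]; rfl
  have := hf (h0.trans (map_zero f).symm)
  rw [Submodule.Quotient.mk_eq_zero] at this
  exact (Ideal.ne_top_iff_one _).1 (Ideal.IsPrime.ne_top') this

lemma subsingleton_of_dual (hE : IsHull R E) (hA : Tors (IsLocalRing.maximalIdeal R) A)
    (h : Subsingleton (A →ₗ[R] E)) : Subsingleton A := by
  by_contra hc
  rw [not_subsingleton_iff_nontrivial] at hc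
  exact not_subsingleton_iff_nontrivial.2 (nontrivial_dual hE hA) h

/-- the main criterion -/
lemma InC.of_ker_smul [IsPrecomplete (IsLocalRing.maximalIdeal R) R] (hE : IsHull R E)
    (y : R) (hy : y ∈ IsLocalRing.maximalIdeal R) (htor : ∀ x : B, ∃ n : ℕ, y ^ n • x = 0)
    (hA : InC R E A) (f : A →ₗ[R] B) (hf : ∀ x : B, y • x = 0 → ∃ z, f z = x) : InC R E B := by
  have hK : InC R E (LinearMap.ker (LinearMap.lsmul R B y)) := by
    have h1 : InC R E (LinearMap.range f) := hA.of_surjective _ f.surjective_rangeRestrict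
    refine h1.of_injective hE (Submodule.inclusion ?_) (Submodule.inclusion_injective _)
    intro x hx
    exact hf x hx
  have hT : Tors (IsLocalRing.maximalIdeal R) B := by
    intro x
    obtain ⟨n, hn⟩ := htor x
    induction n generalizing x with
    | zero => exact ⟨0, fun r _ => by
        rw [pow_zero, one_smul] at hn; rw [hn, smul_zero]⟩
    | succ n ih =>
      obtain ⟨k, hk⟩ := ih (y • x) (by rw [smul_smul, ← pow_succ]; exact hn)
      have : Module.Finite R ((IsLocalRing.maximalIdeal R ^ k : Ideal R)) := inferInstance
      obtain ⟨l, hl⟩ := hK.tors.uniform (N := (IsLocalRing.maximalIdeal R ^ k : Ideal R))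
        (LinearMap.codRestrict _ ((LinearMap.toSpanSingleton R B x) ∘ₗ
          Submodule.subtype _) (by
            rintro ⟨r, hr⟩
            simpa using hk r hr))
      refine ⟨l + k, fun r hr => ?_⟩
      rw [pow_add] at hr
      induction hr using Submodule.mul_induction_on' with
      | mem_mul_mem r hr s hs =>
        have := congrArg Subtype.val (hl r hr ⟨s, hs⟩)
        simpa [mul_smul] using this
      | add _ _ _ _ h1 h2 => rw [add_smul, h1, h2, add_zero]
  refine ⟨hT, ?_⟩
  have := dual_hausdorff (IsLocalRing.maximalIdeal R) E hT
  have := hK.fin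
  refine finite_of_hausdorff (IsLocalRing.maximalIdeal R)
    (LinearMap.lcomp R E (LinearMap.ker (LinearMap.lsmul R B y)).subtype) ?_
  intro φ hφ
  obtain ⟨ψ, hψ⟩ := hE.inj.out ((LinearMap.ker (LinearMap.lsmul R B y)).liftQ
      (LinearMap.lsmul R B y) le_rfl)
    (LinearMap.ker_eq_bot.1 (Submodule.ker_liftQ_eq_bot _ _ _ le_rfl))
    ((LinearMap.ker (LinearMap.lsmul R B y)).liftQ φ (fun x hx => LinearMap.congr_fun hφ ⟨x, hx⟩))
  have : φ = y • ψ := by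
    ext x
    have := hψ (Submodule.Quotient.mk x)
    rw [LinearMap.smul_apply, ← map_smul]
    exact this.symm
  rw [this]
  exact Submodule.smul_mem_smul hy trivial

end cls

end LCT

namespace LCT
open CategoryTheory Abelian

section dims
variable {R : Type u} [CommRing R]

lemma dim_eq (p : Ideal R) (hp : p.IsPrime) :
    ringKrullDim (R ⧸ p) = (Order.coheight (⟨p, hp⟩ : PrimeSpectrum R) : WithBot ℕ∞) := by
  rw [ringKrullDim_quotient, Order.coheight_eq_krullDim_Ici]
  congr 1

lemma dim_mono {I J : Ideal R} (h : I ≤ J) : ringKrullDim (R ⧸ J) ≤ ringKrullDim (R ⧸ I) :=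
  ringKrullDim_le_of_surjective (Ideal.Quotient.factor h) (Ideal.Quotient.factor_surjective h)

lemma dim_lt {p q : Ideal R} (hp : p.IsPrime) (hq : q.IsPrime) (h : p < q) {i : ℕ}
    (hi : ringKrullDim (R ⧸ p) ≤ ((i + 1 : ℕ) : WithBot ℕ∞)) :
    ringKrullDim (R ⧸ q) ≤ (i : WithBot ℕ∞) := by
  rw [dim_eq p hp] at hi
  rw [dim_eq q hq]
  have h1 := Order.coheight_add_one_le (a := (⟨q, hq⟩ : PrimeSpectrum R)) (b := ⟨p, hp⟩) h
  have h2 : Order.coheight (⟨p, hp⟩ : PrimeSpectrum R) ≤ ((i + 1 : ℕ) : ℕ∞) := by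
    exact_mod_cast hi
  have h3 := h1.trans h2
  have h4 : Order.coheight (⟨q, hq⟩ : PrimeSpectrum R) ≤ (i : ℕ∞) := by
    push_cast at h3
    exact (ENat.add_le_add_iff_right (by simp)).1 h3
  exact_mod_cast h4

lemma not_dim_neg {p : Ideal R} (hp : p.IsPrime) : ¬ ringKrullDim (R ⧸ p) < 0 := by
  rw [not_lt]
  exact ringKrullDim_nonneg_of_nontrivial

variable [IsLocalRing R]

lemma eq_max_of_dim {p : Ideal R} (hp : p.IsPrime)
    (hi : ringKrullDim (R ⧸ p) ≤ 0) : p = IsLocalRing.maximalIdeal R := by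
  by_contra hne
  have hlt : p < IsLocalRing.maximalIdeal R :=
    lt_of_le_of_ne (IsLocalRing.le_maximalIdeal hp.ne_top) hne
  rw [dim_eq p hp] at hi
  have h1 := Order.coheight_add_one_le
    (a := (⟨IsLocalRing.maximalIdeal R, inferInstance⟩ : PrimeSpectrum R)) (b := ⟨p, hp⟩) hlt
  have h2 : Order.coheight (⟨p, hp⟩ : PrimeSpectrum R) ≤ 0 := by exact_mod_cast hi
  have h3 := h1.trans h2
  simp at h3

variable [IsNoetherianRing R]

lemma exists_prime_dim {p : Ideal R} (hp : p.IsPrime) {d : ℕ}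
    (hd : ringKrullDim (R ⧸ p) = ((d + 1 : ℕ) : WithBot ℕ∞)) {x : R}
    (hx : x ∈ IsLocalRing.maximalIdeal R) (hxp : x ∉ p) :
    ∃ q : Ideal R, q.IsPrime ∧ p < q ∧ x ∈ q ∧ ringKrullDim (R ⧸ q) = (d : WithBot ℕ∞) := by
  have : IsLocalRing (R ⧸ p) := IsLocalRing.of_surjective' (Ideal.Quotient.mk p)
    Ideal.Quotient.mk_surjective
  have : IsLocalHom (Ideal.Quotient.mk p) :=
    IsLocalHom.of_surjective _ Ideal.Quotient.mk_surjective
  have h1 := ringKrullDim_quotient_span_singleton_succ_eq_ringKrullDim_of_mem_nonZeroDivisors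
    (R := R ⧸ p) (x := Ideal.Quotient.mk p x)
    (mem_nonZeroDivisors_of_ne_zero (by rwa [Ne, Ideal.Quotient.eq_zero_iff_mem])) (by
      rw [IsLocalRing.mem_maximalIdeal, mem_nonunits_iff] at hx ⊢
      exact fun hu => hx (isUnit_of_map_unit _ _ hu))
  rw [hd] at h1
  have h2 : (d : WithBot ℕ∞) ≤
      ringKrullDim ((R ⧸ p) ⧸ Ideal.span {Ideal.Quotient.mk p x}) := by
    revert h1
    generalize ringKrullDim ((R ⧸ p) ⧸ Ideal.span {Ideal.Quotient.mk p x}) = X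
    intro h1
    induction X using WithBot.recBotCoe with
    | bot =>
      rw [WithBot.bot_add] at h1
      exact absurd h1 (WithBot.bot_ne_coe (a := ((d + 1 : ℕ) : ℕ∞)))
    | coe X =>
      have h3 : X + 1 = ((d + 1 : ℕ) : ℕ∞) := by exact_mod_cast h1
      push_cast at h3
      have h4 : (d : ℕ∞) ≤ X := (ENat.add_le_add_iff_right (by simp)).1 h3.ge
      exact_mod_cast h4
  rw [ringKrullDim_quotient, Order.le_krullDim_iff] at h2
  obtain ⟨l, hl⟩ := h2
  let q : PrimeSpectrum R := PrimeSpectrum.comap (Ideal.Quotient.mk p) l.head.1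
  have hpq : p ≤ q.asIdeal := fun y hy => by
    change Ideal.Quotient.mk p y ∈ l.head.1.asIdeal
    rw [Ideal.Quotient.eq_zero_iff_mem.2 hy]; exact Ideal.zero_mem _
  have hxq : x ∈ q.asIdeal := by
    change Ideal.Quotient.mk p x ∈ l.head.1.asIdeal
    have := l.head.2
    rw [PrimeSpectrum.mem_zeroLocus] at this
    exact this (Ideal.subset_span rfl)
  have hlt : p < q.asIdeal := lt_of_le_of_ne hpq (fun h => hxp (h ▸ hxq))
  refine ⟨q.asIdeal, q.2, hlt, hxq, le_antisymm (dim_lt hp q.2 hlt hd.le) ?_⟩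
  have hmono : StrictMono (fun y : PrimeSpectrum.zeroLocus (R := R ⧸ p)
      (Ideal.span {Ideal.Quotient.mk p x}) => PrimeSpectrum.comap (Ideal.Quotient.mk p) y.1) := by
    apply Monotone.strictMono_of_injective
    · intro y z h; exact Ideal.comap_mono h
    · intro y z h
      exact Subtype.ext (PrimeSpectrum.comap_injective_of_surjective _
        Ideal.Quotient.mk_surjective h)
  have := Order.length_le_coheight_head (p := l.map _ hmono)
  rw [dim_eq _ q.2]
  rw [LTSeries.map_length, hl] at this
  exact_mod_cast this

end dims

section devissage
variable {R : Type u} [CommRing R] [IsNoetherianRing R]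

theorem devissage (I : Ideal R)
    {P : (N : Type u) → [AddCommGroup N] → [Module R N] → Prop}
    (subsing : ∀ (N : Type u) [AddCommGroup N] [Module R N] [Subsingleton N], P N)
    (quot : ∀ q : Ideal R, q.IsPrime → I ≤ q → P (R ⧸ q))
    (exact : ∀ (A B C : Type u) [AddCommGroup A] [Module R A] [AddCommGroup B] [Module R B]
      [AddCommGroup C] [Module R C] (f : A →ₗ[R] B) (g : B →ₗ[R] C),
      Function.Injective f → Function.Surjective g → Function.Exact f g → P A → P C → P B)
    (M : Type u) [AddCommGroup M] [Module R M] [Module.Finite R M]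
    (hM : I ≤ Module.annihilator R M) : P M := by
  have equiv (A B : Type u) [AddCommGroup A] [Module R A] [AddCommGroup B] [Module R B]
      (f : A ≃ₗ[R] B) (h : P A) : P B :=
    exact A B PUnit.{u + 1} f 0 f.injective (Function.surjective_to_subsingleton _)
      ((f.exact_zero_iff_surjective _).2 f.surjective) h (subsing _)
  revert hM
  refine IsNoetherianRing.induction_on_isQuotientEquivQuotientPrime R (M := M) inferInstance
    (motive := fun N _ _ _ => I ≤ Module.annihilator R N → P N) ?_ ?_ ?_
  · intro N _ _ _ _ _
    exact subsing N
  · intro N _ _ _ p e h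
    refine equiv _ _ e.symm (quot p.1 p.2 ?_)
    rw [e.annihilator_eq, Ideal.annihilator_quotient] at h
    exact h
  · intro A _ _ _ B _ _ _ C _ _ _ f g hf hg hfg hA hC hB
    exact exact A B C f g hf hg hfg (hA (hB.trans (LinearMap.annihilator_le_of_injective f hf)))
      (hC (hB.trans (LinearMap.annihilator_le_of_surjective g hg)))

end devissage
end LCT

namespace LCT
open CategoryTheory Abelian

section multiplication
set_option linter.unusedSectionVars false
variable {R : Type u} [CommRing R] {a : Ideal R} {p : Ideal R}

/-- multiplication by `x` on `R ⧸ p` -/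
abbrev mx (p : Ideal R) (x : R) : (R ⧸ p) →ₗ[R] (R ⧸ p) := x • LinearMap.id

lemma mx_injective (hp : p.IsPrime) {x : R} (hx : x ∉ p) : Function.Injective (mx p x) := by
  rw [← LinearMap.ker_eq_bot, eq_bot_iff]
  intro c hc
  obtain ⟨r, rfl⟩ := Submodule.mkQ_surjective _ c
  have h : (Submodule.Quotient.mk (x • r) : R ⧸ p) = 0 := hc
  rw [Submodule.Quotient.mk_eq_zero] at h
  exact (Submodule.Quotient.mk_eq_zero _).2 ((hp.mem_or_mem h).resolve_left hx)

/-- `R ⧸ (p + x)` -/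
abbrev CQ (p : Ideal R) (x : R) : Type u := (R ⧸ p) ⧸ LinearMap.range (mx p x)

lemma CQ_exact (p : Ideal R) (x : R) :
    Function.Exact (mx p x) (LinearMap.range (mx p x)).mkQ := LinearMap.exact_map_mkQ_range _

lemma CQ_ann (p : Ideal R) (x : R) : p ⊔ Ideal.span {x} ≤ Module.annihilator R (CQ p x) := by
  have h0 : p ≤ Module.annihilator R (CQ p x) := by
    have h := LinearMap.annihilator_le_of_surjective (LinearMap.range (mx p x)).mkQ
      (Submodule.mkQ_surjective _)
    rwa [Ideal.annihilator_quotient] at h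
  refine sup_le h0 ?_
  rw [Ideal.span_le, Set.singleton_subset_iff, SetLike.mem_coe, Module.mem_annihilator]
  intro c
  obtain ⟨c, rfl⟩ := Submodule.mkQ_surjective _ c
  exact (Submodule.Quotient.mk_eq_zero _).2 ⟨c, rfl⟩

lemma lt_of_sup {x : R} (hx : x ∉ p) {q : Ideal R} (h : p ⊔ Ideal.span {x} ≤ q) : p < q :=
  lt_of_le_of_ne (le_sup_left.trans h) (fun e => hx (e ▸ h (Ideal.mem_sup_right
    (Ideal.mem_span_singleton_self x))))

lemma LC.ker_smul (hp : p.IsPrime) {x : R} (hx : x ∉ p) (i : ℕ) (z : LC a (i + 1) (R ⧸ p))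
    (hz : x • z = 0) : ∃ w : LC a i (CQ p x),
      LC.δ a i (mx_injective hp hx) (Submodule.mkQ_surjective _) (CQ_exact p x) w = z :=
  (LC.exact_δ_map (mx_injective hp hx) (Submodule.mkQ_surjective _) (CQ_exact p x) z).1
    (by rw [LC.map_lsmul_apply]; exact hz)

lemma LC.smul_surj (hp : p.IsPrime) {x : R} (hx : x ∉ p) (i : ℕ)
    [Subsingleton (LC a i (CQ p x))] (z : LC a i (R ⧸ p)) : ∃ w, x • w = z := by
  obtain ⟨w, hw⟩ := (LC.exact_map (a := a) (i := i) (mx_injective hp hx)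
    (Submodule.mkQ_surjective _) (CQ_exact p x) z).1 (Subsingleton.elim _ _)
  exact ⟨w, by rw [← hw, LC.map_lsmul_apply]⟩

/-- surjectivity on top cohomology -/
lemma LC.map_surj {i : ℕ} {A B C : Type u} [AddCommGroup A] [Module R A] [AddCommGroup B]
    [Module R B] [AddCommGroup C] [Module R C] {f : A →ₗ[R] B} {g : B →ₗ[R] C}
    (hf : Function.Injective f) (hg : Function.Surjective g) (h : Function.Exact f g)
    [Subsingleton (LC a (i + 1) A)] : Function.Surjective (LC.map a i g) := fun z =>
  (LC.exact_map_δ hf hg h z).1 (Subsingleton.elim _ _)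

variable [IsNoetherianRing R]

lemma LC.subsingleton_devissage (i : ℕ) (I : Ideal R)
    (h : ∀ q : Ideal R, q.IsPrime → I ≤ q → Subsingleton (LC a i (R ⧸ q)))
    (M : Type u) [AddCommGroup M] [Module R M] [Module.Finite R M]
    (hM : I ≤ Module.annihilator R M) : Subsingleton (LC a i M) := by
  refine devissage I (P := fun N _ _ => Subsingleton (LC a i N)) ?_ h ?_ M hM
  · intro N _ _ _; exact LC.subsingleton_of_subsingleton
  · intro A B C _ _ _ _ _ _ f g hf hg hfg hA hC
    refine subsingleton_of_forall_eq 0 fun z => ?_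
    obtain ⟨w, rfl⟩ := (LC.exact_map (a := a) (i := i) hf hg hfg z).1 (Subsingleton.elim _ _)
    rw [Subsingleton.elim w 0, map_zero]

lemma InC_devissage [IsLocalRing R] {E : Type u} [AddCommGroup E] [Module R E] (hE : IsHull R E)
    (i : ℕ) (I : Ideal R)
    (h : ∀ q : Ideal R, q.IsPrime → I ≤ q → InC R E (LC a i (R ⧸ q)))
    (M : Type u) [AddCommGroup M] [Module R M] [Module.Finite R M]
    (hM : I ≤ Module.annihilator R M) : InC R E (LC a i M) := by
  refine devissage I (P := fun N _ _ => InC R E (LC a i N)) ?_ h ?_ M hM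
  · intro N _ _ _
    have : Subsingleton (LC a i N) := LC.subsingleton_of_subsingleton
    exact InC.of_subsingleton
  · intro A B C _ _ _ _ _ _ f g hf hg hfg hA hC
    exact InC.of_exact hE hA hC (LC.exact_map (a := a) (i := i) hf hg hfg)

lemma tors_quot (h : a ≤ p) : Tors a (R ⧸ p) := by
  intro c
  refine ⟨1, fun r hr => ?_⟩
  rw [pow_one] at hr
  obtain ⟨s, rfl⟩ := Submodule.mkQ_surjective _ c
  exact (Submodule.Quotient.mk_eq_zero _).2 (p.mul_mem_right s (h hr))

lemma subsingleton_of_smul_inj {H : Type*} [AddCommGroup H] [Module R H] (x : R)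
    (h : ∀ z : H, x • z = 0 → z = 0) (ht : ∀ z : H, ∃ n : ℕ, x ^ n • z = 0) : Subsingleton H := by
  refine subsingleton_of_forall_eq 0 fun z => ?_
  obtain ⟨n, hn⟩ := ht z
  induction n with
  | zero => simpa using hn
  | succ n ih => exact ih (h _ (by rwa [smul_smul, ← pow_succ']))

lemma LC.pow_torsion {M : Type u} [AddCommGroup M] [Module R M] {i : ℕ} {x : R} (hx : x ∈ a)
    (z : LC a i M) : ∃ n : ℕ, x ^ n • z = 0 := by
  obtain ⟨n, hn⟩ := LC.torsion z
  exact ⟨n, hn _ (Ideal.pow_mem_pow hx n)⟩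

lemma LC.zero_subsingleton (hp : p.IsPrime) (h : ¬ a ≤ p) : Subsingleton (LC a 0 (R ⧸ p)) := by
  obtain ⟨x, hxa, hxp⟩ := Set.not_subset.1 h
  refine subsingleton_of_smul_inj x (fun z hz => ?_) (LC.pow_torsion hxa)
  have := LC.injective_map_zero (a := a) (mx_injective hp hxp)
  apply this
  rw [LC.map_lsmul_apply, hz, map_zero]

variable [IsLocalRing R]

theorem LC.vanish (i : ℕ) : ∀ (p : Ideal R) (_ : p.IsPrime),
    ringKrullDim (R ⧸ p) ≤ (i : WithBot ℕ∞) → Subsingleton (LC a (i + 1) (R ⧸ p)) := by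
  induction i with
  | zero =>
    intro p hp hd
    by_cases h : a ≤ p
    · exact LC.subsingleton_of_tors _ _ (tors_quot h)
    · have hpm := eq_max_of_dim hp hd
      have : a = ⊤ := by
        by_contra hne
        exact h (hpm ▸ IsLocalRing.le_maximalIdeal hne)
      rw [this]
      exact LC.subsingleton_of_top
  | succ i ih =>
    intro p hp hd
    by_cases h : a ≤ p
    · exact LC.subsingleton_of_tors _ _ (tors_quot h)
    · obtain ⟨x, hxa, hxp⟩ := Set.not_subset.1 h
      have : Subsingleton (LC a (i + 1) (CQ p x)) :=
        LC.subsingleton_devissage (i + 1) (p ⊔ Ideal.span {x})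
          (fun q hq hpq => ih q hq (dim_lt hp hq (lt_of_sup hxp hpq) hd)) _ (CQ_ann p x)
      refine subsingleton_of_smul_inj x (fun z hz => ?_) (LC.pow_torsion hxa)
      obtain ⟨w, rfl⟩ := LC.ker_smul hp hxp _ z hz
      rw [Subsingleton.elim w 0, map_zero]

/-- vanishing above the dimension -/
theorem LC.vanish_lt {i : ℕ} (hp : p.IsPrime) (h : ringKrullDim (R ⧸ p) < (i : WithBot ℕ∞)) :
    Subsingleton (LC a i (R ⧸ p)) := by
  cases i with
  | zero => exact absurd h (not_dim_neg hp)
  | succ i =>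
    apply LC.vanish i p hp
    rw [dim_eq p hp] at h ⊢
    have h1 : Order.coheight (⟨p, hp⟩ : PrimeSpectrum R) < ((i + 1 : ℕ) : ℕ∞) := by
      exact_mod_cast h
    have h2 : Order.coheight (⟨p, hp⟩ : PrimeSpectrum R) ≤ (i : ℕ∞) := by
      push_cast at h1
      exact Order.lt_add_one_iff_of_not_isMax (by simp) |>.1 h1
    exact_mod_cast h2

/-- every nonzero element of `R ⧸ p` acts surjectively on top cohomology -/
theorem LC.top_smul_surj {d : ℕ} (hp : p.IsPrime) (hd : ringKrullDim (R ⧸ p) ≤ (d : WithBot ℕ∞))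
    {x : R} (hx : x ∉ p) (z : LC a d (R ⧸ p)) : ∃ w, x • w = z := by
  have : Subsingleton (LC a d (CQ p x)) := by
    refine LC.subsingleton_devissage d (p ⊔ Ideal.span {x}) (fun q hq hpq => ?_) _ (CQ_ann p x)
    have hlt := lt_of_sup hx hpq
    cases d with
    | zero =>
      rw [eq_max_of_dim hp hd] at hlt
      exact absurd (IsLocalRing.le_maximalIdeal hq.ne_top) (not_le_of_gt hlt)
    | succ d => exact LC.vanish d q hq (dim_lt hp hq hlt hd)
  exact LC.smul_surj hp hx d z

end multiplication
end LCT

namespace LCT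
open CategoryTheory Abelian

section artinian
set_option linter.unusedSectionVars false
variable {R : Type u} [CommRing R] [IsNoetherianRing R] [IsLocalRing R]
  {a : Ideal R}

lemma inC_residue {E : Type u} [AddCommGroup E] [Module R E] (hE : IsHull R E) :
    InC R E (R ⧸ IsLocalRing.maximalIdeal R) :=
  ⟨tors_quot le_rfl, hE.fin⟩

lemma smul_cls {M : Type u} [AddCommGroup M] [Module R M] (x : M) (n : ℕ)
    (h : ∀ r ∈ a ^ n, r • x = 0) (c : R) :
    c • LC.cls x n h = LC.cls (c • x) n (fun r hr => by rw [smul_comm, h r hr, smul_zero]) := by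
  rw [← LC.map_lsmul_apply, LC.map_cls]
  rfl

lemma LC.cls_congr {M : Type u} [AddCommGroup M] [Module R M] (x y : M) (hxy : x = y) (n m : ℕ)
    (h : ∀ r ∈ a ^ n, r • x = 0) (h' : ∀ r ∈ a ^ m, r • y = 0) :
    LC.cls x n h = LC.cls y m h' := by
  subst hxy
  have hk : ∀ (k l : ℕ) (hk : k ≤ l) (w : M) (h1 : ∀ r ∈ a ^ k, r • w = 0)
      (h2 : ∀ r ∈ a ^ l, r • w = 0), LC.cls w k h1 = LC.cls w l h2 := by
    intro k l hkl w h1 h2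
    rw [LC.cls, ← LC.of_t hkl, LC.cls, EQt_apply, Ext.mk₀_comp_mk₀]
    congr 2
    refine quot_hom_ext fun y => ?_
    rfl
  rcases le_total n m with h0 | h0
  · exact hk _ _ h0 _ _ _
  · exact (hk _ _ h0 _ _ _).symm

lemma inC_zero {E : Type u} [AddCommGroup E] [Module R E] (hE : IsHull R E)
    (ha : a ≤ IsLocalRing.maximalIdeal R) :
    InC R E (LC a 0 (R ⧸ IsLocalRing.maximalIdeal R)) := by
  have h1 : ∀ r ∈ a ^ 1, r • (Submodule.Quotient.mk 1 : R ⧸ IsLocalRing.maximalIdeal R) = 0 := by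
    intro r hr
    rw [pow_one] at hr
    exact (Submodule.Quotient.mk_eq_zero _).2 (by simpa using ha hr)
  refine (inC_residue hE).of_surjective (Submodule.liftQ _
    (LinearMap.toSpanSingleton R _ (LC.cls (a := a) _ 1 h1)) ?_) ?_
  · intro r hr
    rw [LinearMap.mem_ker, LinearMap.toSpanSingleton_apply, smul_cls, LC.cls_eq_zero]
    exact (Submodule.Quotient.mk_eq_zero _).2 (by simpa using hr)
  · intro z
    obtain ⟨x, n, h, rfl⟩ := LC.exists_cls z
    obtain ⟨r, rfl⟩ := Submodule.mkQ_surjective _ x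
    refine ⟨Submodule.Quotient.mk r, ?_⟩
    change r • LC.cls (a := a) _ 1 h1 = _
    rw [smul_cls]
    apply LC.cls_congr
    change (Submodule.Quotient.mk (r • 1) : R ⧸ _) = Submodule.Quotient.mk r
    simp

lemma rad_of_le {p q : Ideal R} (hq : q.IsPrime) (hpq : p ≤ q)
    (h : (a ⊔ p).radical = IsLocalRing.maximalIdeal R) :
    (a ⊔ q).radical = IsLocalRing.maximalIdeal R := by
  apply le_antisymm
  · have h1 : a ⊔ q ≤ IsLocalRing.maximalIdeal R := by
      refine sup_le ?_ (IsLocalRing.le_maximalIdeal hq.ne_top)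
      rw [← h]
      exact le_sup_left.trans Ideal.le_radical
    exact (Ideal.IsPrime.radical_le_iff inferInstance).2 h1
  · rw [← h]
    exact Ideal.radical_mono (sup_le_sup_left hpq a)

theorem LC.inC [IsPrecomplete (IsLocalRing.maximalIdeal R) R]
    {E : Type u} [AddCommGroup E] [Module R E] (hE : IsHull R E) (i : ℕ) :
    ∀ (p : Ideal R) (_ : p.IsPrime), (ringKrullDim (R ⧸ p) ≤ (i : WithBot ℕ∞) ∨
      (a ⊔ p).radical = IsLocalRing.maximalIdeal R) → InC R E (LC a i (R ⧸ p)) := by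
  by_cases hatop : a = ⊤
  · intro p hp _
    have : Subsingleton (LC a i (R ⧸ p)) := by rw [hatop]; exact LC.subsingleton_of_top
    exact InC.of_subsingleton
  have ham := IsLocalRing.le_maximalIdeal hatop
  induction i with
  | zero =>
    intro p hp h
    by_cases hap : a ≤ p
    · have hpm : p = IsLocalRing.maximalIdeal R := by
        rcases h with h | h
        · exact eq_max_of_dim hp h
        · rw [sup_eq_right.2 hap, hp.radical] at h; exact h
      subst hpm
      exact inC_zero hE ham
    · have := LC.zero_subsingleton hp hap
      exact InC.of_subsingleton
  | succ i ih =>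
    intro p hp h
    by_cases hap : a ≤ p
    · have := LC.subsingleton_of_tors i (R ⧸ p) (tors_quot hap)
      exact InC.of_subsingleton
    · obtain ⟨y, hya, hyp⟩ := Set.not_subset.1 hap
      have h1 : InC R E (LC a i (CQ p y)) := by
        refine InC_devissage hE i (p ⊔ Ideal.span {y}) (fun q hq hpq => ih q hq ?_) _ (CQ_ann p y)
        have hlt := lt_of_sup hyp hpq
        rcases h with h | h
        · exact Or.inl (dim_lt hp hq hlt h)
        · exact Or.inr (rad_of_le hq hlt.le h)
      exact InC.of_ker_smul hE y (ham hya) (LC.pow_torsion hya) h1 _ (LC.ker_smul hp hyp i)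

end artinian
end LCT

namespace LCT
open CategoryTheory Abelian

lemma exists_mul_pow_le {R : Type*} [CommRing R] [IsNoetherianRing R] {J Q : Ideal R}
    (hQ : Q ∈ J.minimalPrimes) : ∃ s ∉ Q, ∃ n : ℕ, ∀ r ∈ Q ^ n, s * r ∈ J := by
  classical
  have key : ∃ n ≠ 0, ∃ L : Ideal R, Q ^ n * L ≤ J ∧ ¬ L ≤ Q := by
    obtain ⟨n, hn⟩ := J.exists_radical_pow_le_of_fg J.radical.fg_of_isNoetherianRing
    have hn0 : n ≠ 0 := by
      rintro rfl
      rw [pow_zero, Ideal.one_eq_top, top_le_iff] at hn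
      exact hQ.1.1.ne_top (top_le_iff.1 (hn ▸ hQ.1.2))
    have h := J.finite_minimalPrimes_of_isNoetherianRing R
    rw [← J.sInf_minimalPrimes, ← h.coe_toFinset, ← h.toFinset.inf_id_eq_sInf,
      ← Finset.insert_erase (h.mem_toFinset.mpr hQ), Finset.inf_insert, id_eq] at hn
    grw [← Ideal.mul_le_inf, mul_pow] at hn
    refine ⟨n, hn0, ((h.toFinset.erase Q).inf id) ^ n, hn, ?_⟩
    have (K : Ideal R) (hKI : K ≤ Q) (hK : K ∈ J.minimalPrimes) : K = Q :=
      le_antisymm hKI (hQ.2 hK.1 hKI)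
    rw [hQ.isPrime.pow_le_iff hn0, hQ.isPrime.inf_le']
    rintro ⟨K, hK, hKQ⟩
    rw [Finset.mem_erase, h.mem_toFinset] at hK
    exact hK.1 (this K hKQ hK.2)
  obtain ⟨n, -, L, hL, hLQ⟩ := key
  obtain ⟨s, hs, hsQ⟩ := Set.not_subset.1 hLQ
  exact ⟨s, hsQ, n, fun r hr => hL (by rw [mul_comm s r]; exact Ideal.mul_mem_mul hr hs)⟩

/-- if `s V ⊆ x V` then some element outside of `Q` kills `V` -/
lemma exists_kill {R : Type*} [CommRing R] {V : Type*} [AddCommGroup V] [Module R V]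
    [Module.Finite R V] {Q : Ideal R} (hQ : Q.IsPrime) {s x : R} (hs : s ∉ Q) (hx : x ∈ Q)
    (h : ∀ v : V, ∃ w : V, s • v = x • w) : ∃ t ∉ Q, ∀ v : V, t • v = 0 := by
  obtain ⟨q, hq, -, hc, h0⟩ :=
    LinearMap.exists_monic_and_natDegree_eq_and_coeff_mem_pow_and_aeval_eq_zero R
      (algebraMap R (Module.End R V) s) (Ideal.span {x}) (by
        rintro _ ⟨v, rfl⟩
        obtain ⟨w, hw⟩ := h v
        rw [Module.algebraMap_end_apply, hw]
        exact Submodule.smul_mem_smul (Ideal.mem_span_singleton_self x) trivial)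
  refine ⟨q.eval s, ?_, fun v => ?_⟩
  · rw [Polynomial.eval_eq_sum_range, Finset.sum_range_succ, hq.coeff_natDegree, one_mul]
    intro hmem
    have h1 : ∑ k ∈ Finset.range q.natDegree, q.coeff k * s ^ k ∈ Q := by
      refine Ideal.sum_mem _ fun k hk => Ideal.mul_mem_right _ _ ?_
      have h2 := hc k
      have h3 : q.natDegree - k ≠ 0 := by
        rw [Finset.mem_range] at hk; omega
      have h4 : Ideal.span {x} ≤ Q := by
        rw [Ideal.span_le, Set.singleton_subset_iff]; exact hx
      exact h4 (Ideal.pow_le_self h3 h2)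
    exact hs (hQ.mem_of_pow_mem _ ((Ideal.add_mem_iff_right _ h1).1 hmem))
  · rw [Polynomial.aeval_algebraMap_apply] at h0
    have := LinearMap.congr_fun h0 v
    simpa using this

section lhvt
variable {R : Type u} [CommRing R] [IsNoetherianRing R] [IsLocalRing R]
  {a : Ideal R}

theorem LC.lhvt [IsPrecomplete (IsLocalRing.maximalIdeal R) R] (d : ℕ) :
    ∀ (p : Ideal R) (_ : p.IsPrime), ringKrullDim (R ⧸ p) ≤ (d : WithBot ℕ∞) →
      ∀ (P : Ideal R) (_ : P.IsPrime), P ≠ IsLocalRing.maximalIdeal R → p ≤ P → a ≤ P →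
        Subsingleton (LC a d (R ⧸ p)) := by
  obtain ⟨E, _, _, hE⟩ := exists_hull R
  induction d with
  | zero =>
    intro p hp hd P hP hPm hpP _
    rw [eq_max_of_dim hp hd] at hpP
    exact absurd (le_antisymm (IsLocalRing.le_maximalIdeal hP.ne_top) hpP) hPm
  | succ d ih =>
    intro p hp hd P hP hPm hpP haP
    by_cases hap : a ≤ p
    · exact LC.subsingleton_of_tors _ _ (tors_quot hap)
    obtain ⟨x, hxa, hxp⟩ := Set.not_subset.1 hap
    have hJP : p ⊔ Ideal.span {x} ≤ P := sup_le hpP (by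
      rw [Ideal.span_le, Set.singleton_subset_iff]; exact haP hxa)
    obtain ⟨Q, hQmin, hQP⟩ := Ideal.exists_minimalPrimes_le hJP
    have hQ : Q.IsPrime := hQmin.1.1
    have hJQ : p ⊔ Ideal.span {x} ≤ Q := hQmin.1.2
    have hxQ : x ∈ Q := hJQ (Ideal.mem_sup_right (Ideal.mem_span_singleton_self x))
    have hpQ : p < Q := lt_of_sup hxp hJQ
    have hdQ := dim_lt hp hQ hpQ hd
    have hQm : Q ≠ IsLocalRing.maximalIdeal R := by
      rintro rfl
      exact hPm (le_antisymm (IsLocalRing.le_maximalIdeal hP.ne_top) hQP)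
    have hsub : ∀ q : Ideal R, q.IsPrime → Q ≤ q → Subsingleton (LC a d (R ⧸ q)) := by
      intro q hq hQq
      rcases eq_or_lt_of_le hQq with rfl | hlt
      · exact ih Q hQ hdQ P hP hPm hQP haP
      · cases d with
        | zero => exact absurd (eq_max_of_dim hQ hdQ) hQm
        | succ d => exact LC.vanish d q hq (dim_lt hQ hq hlt hdQ)
    have hsub' : ∀ q : Ideal R, q.IsPrime → Q ≤ q → Subsingleton (LC a (d + 1) (R ⧸ q)) :=
      fun q hq hQq => LC.vanish d q hq ((dim_mono hQq).trans hdQ)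
    obtain ⟨s, hsQ, n, hsn⟩ := exists_mul_pow_le hQmin
    let I : Submodule R (R ⧸ p) := Q ^ n • ⊤
    have hann : Q ^ n ≤ Module.annihilator R ((R ⧸ p) ⧸ I) := by
      intro r hr
      rw [Module.mem_annihilator]
      intro c
      obtain ⟨c, rfl⟩ := Submodule.mkQ_surjective _ c
      exact (Submodule.Quotient.mk_eq_zero _).2 (Submodule.smul_mem_smul hr trivial)
    have hz1 : Subsingleton (LC a d ((R ⧸ p) ⧸ I)) :=
      LC.subsingleton_devissage d (Q ^ n) (fun q hq h => hsub q hq (hq.le_of_pow_le h)) _ hann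
    have hz2 : Subsingleton (LC a (d + 1) ((R ⧸ p) ⧸ I)) :=
      LC.subsingleton_devissage (d + 1) (Q ^ n)
        (fun q hq h => hsub' q hq (hq.le_of_pow_le h)) _ hann
    have hex : Function.Exact I.subtype I.mkQ := by
      rw [LinearMap.exact_iff]; simp
    have hbij : Function.Bijective (LC.map a (d + 1) I.subtype) := by
      constructor
      · rw [injective_iff_map_eq_zero]
        intro z hz
        obtain ⟨w, rfl⟩ := (LC.exact_δ_map (a := a) (i := d) I.injective_subtype
          I.mkQ_surjective hex z).1 hz
        rw [Subsingleton.elim w 0, map_zero]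
      · intro z
        exact (LC.exact_map (a := a) (i := d + 1) I.injective_subtype
          I.mkQ_surjective hex z).1 (Subsingleton.elim _ _)
    have hrange : ∀ y : I, s • (y : R ⧸ p) ∈ LinearMap.range (mx p x) := by
      have : I ≤ (LinearMap.range (mx p x)).comap (mx p s) := by
        refine Submodule.smul_le.2 fun r hr c _ => ?_
        have h1 := hsn r hr
        obtain ⟨y, hy, z, hz, hyz⟩ := Submodule.mem_sup.1 h1
        obtain ⟨t, rfl⟩ := Ideal.mem_span_singleton'.1 hz
        refine ⟨t • c, ?_⟩
        change x • t • c = s • r • c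
        rw [smul_smul, smul_smul, ← hyz, add_smul, mul_comm x t]
        obtain ⟨c, rfl⟩ := Submodule.mkQ_surjective _ c
        rw [show y • Submodule.mkQ p c = 0 from
          (Submodule.Quotient.mk_eq_zero _).2 (p.mul_mem_right c hy), zero_add]
      exact fun y => this y.2
    let ψ : I →ₗ[R] (R ⧸ p) :=
      (LinearEquiv.ofInjective (mx p x) (mx_injective hp hxp)).symm.toLinearMap ∘ₗ
        LinearMap.codRestrict (LinearMap.range (mx p x)) (s • I.subtype) hrange
    have hψ : x • ψ = s • I.subtype := by
      ext y
      have := congrArg Subtype.val ((LinearEquiv.ofInjective (mx p x)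
        (mx_injective hp hxp)).apply_symm_apply
          (LinearMap.codRestrict (LinearMap.range (mx p x)) (s • I.subtype) hrange y))
      exact this
    let θ : LC a (d + 1) (R ⧸ p) →ₗ[R] LC a (d + 1) (R ⧸ p) :=
      LC.map a (d + 1) ψ ∘ₗ (LinearEquiv.ofBijective _ hbij).symm.toLinearMap
    have hθ : ∀ z, s • z = x • θ z := by
      intro z
      obtain ⟨w, rfl⟩ := hbij.2 z
      have h1 : θ (LC.map a (d + 1) I.subtype w) = LC.map a (d + 1) ψ w := by
        change LC.map a (d + 1) ψ ((LinearEquiv.ofBijective _ hbij).symm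
          (LinearEquiv.ofBijective _ hbij w)) = _
        rw [LinearEquiv.symm_apply_apply]
      rw [h1, ← LC.map_smul_apply, ← LC.map_smul_apply, hψ]
    have hC : InC R E (LC a (d + 1) (R ⧸ p)) := LC.inC hE (d + 1) p hp (Or.inl hd)
    have := hC.fin
    obtain ⟨t, htQ, ht⟩ := exists_kill (V := LC a (d + 1) (R ⧸ p) →ₗ[R] E) hQ hsQ hxQ
      (fun φ => ⟨φ ∘ₗ θ, by
        ext z
        rw [LinearMap.smul_apply, LinearMap.smul_apply, LinearMap.comp_apply, ← map_smul,
          ← map_smul, hθ]⟩)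
    refine subsingleton_of_dual hE hC.tors (subsingleton_of_forall_eq 0 fun φ => ?_)
    ext z
    obtain ⟨w, rfl⟩ := LC.top_smul_surj hp hd (fun h => htQ (hpQ.le h)) z
    rw [map_smul]
    exact LinearMap.congr_fun (ht φ) w

end lhvt
end LCT

namespace LCT
open CategoryTheory Abelian

section nonvanish
variable {R : Type u} [CommRing R] [IsNoetherianRing R] [IsLocalRing R]
  {a : Ideal R}

lemma LC.sub_vanish {d : ℕ} {p : Ideal R} (hp : p.IsPrime)
    (hd : ringKrullDim (R ⧸ p) ≤ ((d + 1 : ℕ) : WithBot ℕ∞))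
    (h0 : Subsingleton (LC a (d + 1) (R ⧸ p))) (K : Submodule R (R ⧸ p)) :
    Subsingleton (LC a (d + 1) K) := by
  by_cases hK : K = ⊥
  · subst hK
    exact LC.subsingleton_of_subsingleton
  obtain ⟨c, hc, hc0⟩ := Submodule.exists_mem_ne_zero_of_ne_bot hK
  obtain ⟨y, rfl⟩ := Submodule.mkQ_surjective _ c
  have hy : y ∉ p := fun h => hc0 ((Submodule.Quotient.mk_eq_zero _).2 h)
  have hmem : ∀ c : R ⧸ p, mx p y c ∈ K := by
    intro c
    obtain ⟨r, rfl⟩ := Submodule.mkQ_surjective _ c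
    have : mx p y (p.mkQ r) = r • p.mkQ y := by
      rw [← map_smul]
      change y • p.mkQ r = _
      rw [← map_smul, smul_eq_mul, smul_eq_mul, mul_comm]
    rw [this]
    exact K.smul_mem _ hc
  let g : (R ⧸ p) →ₗ[R] K := (mx p y).codRestrict K hmem
  have hg : Function.Injective g := fun u v huv => mx_injective hp hy (congrArg Subtype.val huv)
  have hann : p ⊔ Ideal.span {y} ≤ Module.annihilator R (K ⧸ LinearMap.range g) := by
    refine sup_le ?_ ?_
    · intro r hr
      rw [Module.mem_annihilator]
      intro z
      obtain ⟨k, rfl⟩ := Submodule.mkQ_surjective _ z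
      rw [← map_smul]
      have : r • k = 0 := by
        apply Subtype.ext
        obtain ⟨s, hs⟩ := Submodule.mkQ_surjective _ k.1
        change r • k.1 = 0
        rw [← hs, ← map_smul]
        exact (Submodule.Quotient.mk_eq_zero _).2 (p.mul_mem_right s hr)
      rw [this, map_zero]
    · rw [Ideal.span_le, Set.singleton_subset_iff, SetLike.mem_coe, Module.mem_annihilator]
      intro z
      obtain ⟨k, rfl⟩ := Submodule.mkQ_surjective _ z
      rw [← map_smul]
      exact (Submodule.Quotient.mk_eq_zero _).2 ⟨k.1, Subtype.ext rfl⟩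
  have hC : Subsingleton (LC a (d + 1) (K ⧸ LinearMap.range g)) := by
    refine LC.subsingleton_devissage (d + 1) _ (fun q hq hpq => ?_) _ hann
    exact LC.vanish d q hq (dim_lt hp hq (lt_of_sup hy hpq) hd)
  refine subsingleton_of_forall_eq 0 fun z => ?_
  obtain ⟨w, rfl⟩ := (LC.exact_map (a := a) (i := d + 1) hg (Submodule.mkQ_surjective _)
    (LinearMap.exact_map_mkQ_range g) z).1 (Subsingleton.elim _ _)
  rw [Subsingleton.elim w 0, map_zero]

lemma LC.p_smul {d : ℕ} {p : Ideal R} {M : Type u} [AddCommGroup M] [Module R M] {r : R}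
    (hr : ∀ x : M, r • x = 0) (z : LC a d M) : r • z = 0 := by
  rw [← LC.map_lsmul_apply]
  have : r • (LinearMap.id : M →ₗ[R] M) = 0 := by
    ext x; exact hr x
  rw [this, LC.map_zero_apply]

lemma quot_smul {p : Ideal R} {r : R} (hr : r ∈ p) (x : R ⧸ p) : r • x = 0 := by
  obtain ⟨s, rfl⟩ := Submodule.mkQ_surjective _ x
  rw [← map_smul]
  exact (Submodule.Quotient.mk_eq_zero _).2 (p.mul_mem_right s hr)

lemma LC.ann_eq {d : ℕ} {p : Ideal R} (hp : p.IsPrime)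
    (hd : ringKrullDim (R ⧸ p) ≤ (d : WithBot ℕ∞)) [Nontrivial (LC a d (R ⧸ p))] :
    Module.annihilator R (LC a d (R ⧸ p)) = p := by
  apply le_antisymm
  · intro t ht
    by_contra htp
    obtain ⟨z, hz⟩ := exists_ne (0 : LC a d (R ⧸ p))
    obtain ⟨w, rfl⟩ := LC.top_smul_surj hp hd htp z
    exact hz (Module.mem_annihilator.1 ht w)
  · intro r hr
    rw [Module.mem_annihilator]
    exact LC.p_smul (p := p) (quot_smul hr)

theorem LC.nonvanish [IsPrecomplete (IsLocalRing.maximalIdeal R) R] (d : ℕ) :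
    ∀ (p : Ideal R) (_ : p.IsPrime), ringKrullDim (R ⧸ p) = (d : WithBot ℕ∞) →
      (a ⊔ p).radical = IsLocalRing.maximalIdeal R → Nontrivial (LC a d (R ⧸ p)) := by
  obtain ⟨E, _, _, hE⟩ := exists_hull R
  induction d with
  | zero =>
    intro p hp hd hr
    have hpm := eq_max_of_dim hp hd.le
    have hap : a ≤ p := by
      rw [hpm, ← hr]
      exact le_sup_left.trans Ideal.le_radical
    have h1 : ∀ r ∈ a ^ 1, r • (Submodule.Quotient.mk 1 : R ⧸ p) = 0 := by
      intro r hr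
      rw [pow_one] at hr
      exact quot_smul (hap hr) _
    refine ⟨⟨LC.cls _ 1 h1, 0, fun h => ?_⟩⟩
    rw [LC.cls_eq_zero, Submodule.Quotient.mk_eq_zero] at h
    exact hp.ne_top ((Ideal.eq_top_iff_one _).2 h)
  | succ d ih =>
    intro p hp hd hr
    by_contra hnt
    rw [not_nontrivial_iff_subsingleton] at hnt
    have hpm : p ≠ IsLocalRing.maximalIdeal R := by
      intro h
      have h0 : ringKrullDim (R ⧸ p) = 0 := by
        subst h
        exact ringKrullDim_eq_zero_of_field (IsLocalRing.ResidueField R)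
      rw [h0] at hd
      exact absurd hd (by exact_mod_cast (Nat.succ_ne_zero d).symm)
    have hplt : p < IsLocalRing.maximalIdeal R :=
      lt_of_le_of_ne (IsLocalRing.le_maximalIdeal hp.ne_top) hpm
    have hin : InC R E (LC a d (R ⧸ p)) := LC.inC hE d p hp (Or.inr hr)
    have := hin.fin
    -- surjectivity
    have hsurj : ∀ q : Ideal R, ∀ h : p ≤ q,
        Function.Surjective (LC.map a d (Submodule.mapQ p q LinearMap.id h)) := by
      intro q h
      have hs : Function.Surjective (Submodule.mapQ p q LinearMap.id h) := by
        intro c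
        obtain ⟨r, rfl⟩ := Submodule.mkQ_surjective _ c
        exact ⟨p.mkQ r, rfl⟩
      have := LC.sub_vanish (a := a) hp hd.le hnt (LinearMap.ker (Submodule.mapQ p q LinearMap.id h))
      exact LC.map_surj (Submodule.subtype_injective _) hs (LinearMap.exact_subtype_ker_map _)
    have hass : ∀ q : Ideal R, q.IsPrime → p < q → ringKrullDim (R ⧸ q) = (d : WithBot ℕ∞) →
        q ∈ associatedPrimes R (LC a d (R ⧸ p) →ₗ[R] E) := by
      intro q hq hpq hqd
      have hrq := rad_of_le hq hpq.le hr
      have := ih q hq hqd hrq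
      have hinq : InC R E (LC a d (R ⧸ q)) := LC.inC hE d q hq (Or.inr hrq)
      have := nontrivial_dual hE hinq.tors
      obtain ⟨φ, hφ⟩ := exists_ne (0 : LC a d (R ⧸ q) →ₗ[R] E)
      let π := LC.map a d (Submodule.mapQ p q LinearMap.id hpq.le)
      rw [AssociatedPrimes.mem_iff, isAssociatedPrime_iff]
      refine ⟨hq, φ ∘ₗ π, ?_⟩
      ext t
      rw [Submodule.mem_colon_singleton, Submodule.mem_bot]
      constructor
      · intro ht
        ext z
        change t • φ (π z) = 0
        rw [← map_smul, LC.p_smul (p := q) (quot_smul ht), map_zero]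
      · intro ht
        by_contra htq
        apply hφ
        ext z
        obtain ⟨w, rfl⟩ := LC.top_smul_surj hq hqd.le htq z
        obtain ⟨v, rfl⟩ := hsurj q hpq.le w
        rw [map_smul]
        exact LinearMap.congr_fun ht v
    have hfin : {q : Ideal R | q.IsPrime ∧ p < q ∧ ringKrullDim (R ⧸ q) = (d : WithBot ℕ∞)}.Finite :=
      (associatedPrimes.finite R (LC a d (R ⧸ p) →ₗ[R] E)).subset
        fun q hq => hass q hq.1 hq.2.1 hq.2.2
    have hcov : ((IsLocalRing.maximalIdeal R : Ideal R) : Set R) ⊆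
        ⋃ q ∈ insert p {q : Ideal R | q.IsPrime ∧ p < q ∧ ringKrullDim (R ⧸ q) = (d : WithBot ℕ∞)},
          ((id q : Ideal R) : Set R) := by
      intro x hx
      rw [Set.mem_iUnion₂]
      by_cases hxp : x ∈ p
      · exact ⟨p, Set.mem_insert _ _, hxp⟩
      · obtain ⟨q, hq, hpq, hxq, hqd⟩ := exists_prime_dim hp hd hx hxp
        exact ⟨q, Set.mem_insert_of_mem _ ⟨hq, hpq, hqd⟩, hxq⟩
    obtain ⟨q, hq, hmq⟩ := (Ideal.subset_union_prime_finite (hfin.insert p) (f := id) p p (by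
      rintro i (rfl | hi) h1 h2
      · exact absurd rfl h1
      · exact hi.1)).1 hcov
    rcases hq with rfl | ⟨hq, hpq, hqd⟩
    · exact absurd hplt (not_lt_of_ge hmq)
    · have hqm : q = IsLocalRing.maximalIdeal R :=
        le_antisymm (IsLocalRing.le_maximalIdeal hq.ne_top) hmq
      have h0 : ringKrullDim (R ⧸ q) = 0 := by
        subst hqm
        exact ringKrullDim_eq_zero_of_field (IsLocalRing.ResidueField R)
      have hd0 : d = 0 := by
        rw [h0] at hqd
        exact_mod_cast hqd.symm
      subst hd0
      have hrq := rad_of_le hq hpq.le hr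
      have hn := ih q hq hqd hrq
      have hap : ¬ a ≤ p := by
        intro hap
        rw [sup_eq_right.2 hap, hp.radical] at hr
        exact hpm hr
      have hz := LC.zero_subsingleton (a := a) hp hap
      have := (hsurj q hpq.le).subsingleton
      exact not_subsingleton_iff_nontrivial.2 hn this

end nonvanish
end LCT

namespace LCT
open CategoryTheory Abelian

section final
variable {R : Type u} [CommRing R] [IsNoetherianRing R] [IsLocalRing R]
  {a : Ideal R}

lemma IsAttachedPrime.of_equiv {H H' : Type u} [AddCommGroup H] [Module R H] [AddCommGroup H']
    [Module R H'] (e : H ≃ₗ[R] H') {p : Ideal R} (h : IsAttachedPrime R H p) :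
    IsAttachedPrime R H' p := by
  obtain ⟨hp, N, hN⟩ := h
  refine ⟨hp, N.map e.toLinearMap, hN.trans ?_⟩
  exact (Submodule.Quotient.equiv N (N.map e.toLinearMap) e rfl).annihilator_eq

lemma LC.map_surj_of {d : ℕ} {I : Ideal R} (hI : ringKrullDim (R ⧸ I) ≤ (d : WithBot ℕ∞))
    {A C : Type u} [AddCommGroup A] [Module R A] [Module.Finite R A] [AddCommGroup C] [Module R C]
    (hA : I ≤ Module.annihilator R A) (f : A →ₗ[R] C)
    (hC : Subsingleton (LC a d (C ⧸ LinearMap.range f))) :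
    Function.Surjective (LC.map a d f) := by
  have hk : Subsingleton (LC a (d + 1) (LinearMap.ker f)) := by
    refine LC.subsingleton_devissage (d + 1) I
      (fun q hq hIq => LC.vanish d q hq ((dim_mono hIq).trans hI)) _ ?_
    exact hA.trans (LinearMap.annihilator_le_of_injective _ (Submodule.subtype_injective _))
  have h1 : Function.Surjective (LC.map a d f.rangeRestrict) := by
    refine LC.map_surj (Submodule.subtype_injective (LinearMap.ker f)) f.surjective_rangeRestrict ?_
    intro x
    rw [← LinearMap.mem_ker, LinearMap.ker_rangeRestrict]
    simp
  intro z
  obtain ⟨w, rfl⟩ := (LC.exact_map (a := a) (i := d) (Submodule.subtype_injective _)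
    (Submodule.mkQ_surjective _) (LinearMap.exact_subtype_mkQ (LinearMap.range f)) z).1
    (Subsingleton.elim _ _)
  obtain ⟨v, rfl⟩ := h1 w
  exact ⟨v, by rw [← LC.map_comp_apply]; rfl⟩

lemma dim_lt_of_lt {d : ℕ} {p q : Ideal R} (hp : p.IsPrime) (hq : q.IsPrime) (h : p < q)
    (hd : ringKrullDim (R ⧸ p) ≤ (d : WithBot ℕ∞)) : ringKrullDim (R ⧸ q) < (d : WithBot ℕ∞) := by
  cases d with
  | zero =>
    rw [eq_max_of_dim hp hd] at h
    exact absurd h (not_lt_of_ge (IsLocalRing.le_maximalIdeal hq.ne_top))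
  | succ d =>
    refine (dim_lt hp hq h hd).trans_lt ?_
    exact_mod_cast Nat.lt_succ_self d

lemma mem_minimal {d : ℕ} {I p : Ideal R} (hp : p.IsPrime) (hIp : I ≤ p)
    (hI : ringKrullDim (R ⧸ I) ≤ (d : WithBot ℕ∞)) (hd : ringKrullDim (R ⧸ p) = (d : WithBot ℕ∞)) :
    p ∈ I.minimalPrimes := by
  refine ⟨⟨hp, hIp⟩, fun q hq hqp => ?_⟩
  by_contra hne
  have := dim_lt_of_lt hq.1 hp (lt_of_le_not_ge hqp hne) ((dim_mono hq.2).trans hI)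
  rw [hd] at this
  exact lt_irrefl _ this

theorem attached_sub [IsPrecomplete (IsLocalRing.maximalIdeal R) R]
    (M : Type u) [AddCommGroup M] [Module R M] [Module.Finite R M] {d : ℕ}
    (hd : ringKrullDim (R ⧸ Module.annihilator R M) = (d : WithBot ℕ∞)) {p : Ideal R}
    (h : IsAttachedPrime R (LC a d M) p) :
    p ∈ associatedPrimes R M ∧ ringKrullDim (R ⧸ p) = (d : WithBot ℕ∞) ∧
      (a ⊔ p).radical = IsLocalRing.maximalIdeal R := by
  classical
  obtain ⟨hp, N, hN⟩ := h
  have hann : Module.annihilator R M ≤ p := by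
    intro r hr
    rw [hN, Module.mem_annihilator]
    intro z
    obtain ⟨z, rfl⟩ := Submodule.mkQ_surjective _ z
    rw [← map_smul, LC.p_smul (p := p) (Module.mem_annihilator.1 hr), map_zero]
  have hex : ∃ q : Ideal R, q.IsPrime ∧ p ≤ q ∧ ¬ Subsingleton (LC a d (R ⧸ q)) := by
    by_contra hcon
    push Not at hcon
    obtain ⟨s, hs⟩ := p.fg_of_isNoetherianRing
    let φ : (s → M) →ₗ[R] M := ∑ j : s, (j : R) • LinearMap.proj j
    have hquot : p ≤ Module.annihilator R (M ⧸ LinearMap.range φ) := by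
      rw [← hs]
      refine Ideal.span_le.2 fun r hr => ?_
      rw [SetLike.mem_coe, Module.mem_annihilator]
      intro z
      obtain ⟨m, rfl⟩ := Submodule.mkQ_surjective _ z
      rw [← map_smul]
      refine (Submodule.Quotient.mk_eq_zero _).2 ⟨Pi.single ⟨r, hr⟩ m, ?_⟩
      simp only [φ, LinearMap.sum_apply, LinearMap.smul_apply, LinearMap.proj_apply]
      rw [Finset.sum_eq_single ⟨r, hr⟩]
      · simp
      · intro b _ hb
        rw [Pi.single_eq_of_ne hb, smul_zero]
      · simp
    have h0 := LC.subsingleton_devissage (a := a) d p hcon _ hquot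
    have hA : Module.annihilator R M ≤ Module.annihilator R (s → M) := by
      intro r hr
      rw [Module.mem_annihilator] at hr ⊢
      intro f; ext j; exact hr _
    have hsurj := LC.map_surj_of (a := a) hd.le hA φ h0
    have hall : ∀ z : LC a d M, z ∈ N := by
      intro z
      obtain ⟨w, rfl⟩ := hsurj z
      rw [LC.map_sum_apply]
      refine N.sum_mem fun j _ => ?_
      rw [LC.map_smul_apply]
      have hj : (j : R) ∈ p := hs ▸ Ideal.subset_span j.2
      rw [hN, Module.mem_annihilator] at hj
      have := hj (N.mkQ (LC.map a d (LinearMap.proj j) w))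
      rw [← map_smul] at this
      exact (Submodule.Quotient.mk_eq_zero _).1 this
    apply hp.ne_top
    rw [Ideal.eq_top_iff_one, hN, Module.mem_annihilator]
    intro z
    obtain ⟨z, rfl⟩ := Submodule.mkQ_surjective _ z
    rw [one_smul]
    exact (Submodule.Quotient.mk_eq_zero _).2 (hall z)
  obtain ⟨q, hq, hpq, hnz⟩ := hex
  have hpd : ringKrullDim (R ⧸ p) ≤ (d : WithBot ℕ∞) := (dim_mono hann).trans hd.le
  have hqp : p = q := by
    by_contra hne
    exact hnz (LC.vanish_lt hq (dim_lt_of_lt hp hq (lt_of_le_of_ne hpq hne) hpd))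
  subst hqp
  have hpd' : ringKrullDim (R ⧸ p) = (d : WithBot ℕ∞) :=
    le_antisymm hpd (not_lt.1 fun h => hnz (LC.vanish_lt hp h))
  refine ⟨Module.associatedPrimes.minimalPrimes_annihilator_subset_associatedPrimes R M
    (mem_minimal hp hann hd.le hpd'), hpd', ?_⟩
  have ha : a ≠ ⊤ := by
    rintro rfl
    exact hnz LC.subsingleton_of_top
  have hP : ∀ P : Ideal R, P.IsPrime → a ⊔ p ≤ P → P = IsLocalRing.maximalIdeal R := by
    intro P hP hle
    by_contra hne
    exact hnz (LC.lhvt d p hp hpd P hP hne (le_sup_right.trans hle) (le_sup_left.trans hle))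
  apply le_antisymm
  · rw [← (IsLocalRing.maximalIdeal.isMaximal R).isPrime.radical]
    exact Ideal.radical_mono (sup_le (IsLocalRing.le_maximalIdeal ha)
      (IsLocalRing.le_maximalIdeal hp.ne_top))
  · rw [Ideal.radical_eq_sInf]
    refine le_sInf fun P hP1 => ?_
    rw [hP P hP1.2 hP1.1]

theorem attached_sup [IsPrecomplete (IsLocalRing.maximalIdeal R) R]
    (M : Type u) [AddCommGroup M] [Module R M] [Module.Finite R M] {d : ℕ}
    (hd : ringKrullDim (R ⧸ Module.annihilator R M) = (d : WithBot ℕ∞)) {p : Ideal R}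
    (hass : p ∈ associatedPrimes R M) (hpd : ringKrullDim (R ⧸ p) = (d : WithBot ℕ∞))
    (hr : (a ⊔ p).radical = IsLocalRing.maximalIdeal R) : IsAttachedPrime R (LC a d M) p := by
  have hp : p.IsPrime := hass.1
  have hann : Module.annihilator R M ≤ p := by
    rw [← Submodule.annihilator_top]
    exact IsAssociatedPrime.annihilator_le hass
  have hnt := LC.nonvanish (a := a) d p hp hpd hr
  obtain ⟨N, hN, hmax⟩ := set_has_maximal_iff_noetherian.2 (inferInstance : IsNoetherian R M)
    {N | ∀ t : R, (∀ m : M, t • m ∈ N) → t ∈ p}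
    ⟨⊥, fun t ht => hann (Module.mem_annihilator.2 fun m => by simpa using ht m)⟩
  have hle1 : Module.annihilator R M ≤ Module.annihilator R (M ⧸ N) :=
    LinearMap.annihilator_le_of_surjective N.mkQ (Submodule.mkQ_surjective _)
  have hle2 : Module.annihilator R (M ⧸ N) ≤ p := by
    intro t ht
    refine hN t fun m => ?_
    have := Module.mem_annihilator.1 ht (N.mkQ m)
    rw [← map_smul] at this
    exact (Submodule.Quotient.mk_eq_zero _).1 this
  have hassN := Module.associatedPrimes.minimalPrimes_annihilator_subset_associatedPrimes R (M ⧸ N)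
    (mem_minimal hp hle2 ((dim_mono hle1).trans hd.le) hpd)
  rw [AssociatedPrimes.mem_iff, isAssociatedPrime_iff] at hassN
  obtain ⟨-, x, hx⟩ := hassN
  have hx' : ∀ r : R, r ∈ p ↔ r • x = 0 := by
    intro r
    rw [hx, Submodule.mem_colon_singleton, Submodule.mem_bot]
  have hx0 : x ≠ 0 := by
    rintro rfl
    exact hp.ne_top ((Ideal.eq_top_iff_one _).2 ((hx' 1).2 (smul_zero _)))
  let L : Submodule R (M ⧸ N) := Submodule.span R {x}
  have hxL : x ∈ L := Submodule.mem_span_singleton_self x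
  have hlt : N < L.comap N.mkQ := by
    refine lt_of_le_of_ne (fun n hn => ?_) fun h => ?_
    · rw [Submodule.mem_comap, (Submodule.Quotient.mk_eq_zero N).2 hn |> (show N.mkQ n = 0 from ·)]
      exact L.zero_mem
    · obtain ⟨y, hy⟩ := Submodule.mkQ_surjective _ x
      have : y ∈ N := by
        rw [h, Submodule.mem_comap, hy]; exact hxL
      exact hx0 (hy ▸ (Submodule.Quotient.mk_eq_zero N).2 this)
  obtain ⟨t, ht, htp⟩ : ∃ t : R, (∀ m : M, t • m ∈ L.comap N.mkQ) ∧ t ∉ p := by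
    by_contra hcon
    push Not at hcon
    exact hmax _ hcon hlt
  let f : M →ₗ[R] L := (t • N.mkQ).codRestrict L (fun m => by
    have := ht m
    rwa [Submodule.mem_comap, map_smul] at this)
  have hLp : ∀ r ∈ p, ∀ z : L, r • z = 0 := by
    rintro r hrp ⟨z, hz⟩
    obtain ⟨c, rfl⟩ := Submodule.mem_span_singleton.1 hz
    apply Subtype.ext
    change r • c • x = 0
    rw [smul_comm, (hx' r).1 hrp, smul_zero]
  have hquot : p ⊔ Ideal.span {t} ≤ Module.annihilator R (L ⧸ LinearMap.range f) := by
    refine sup_le ?_ ?_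
    · intro r hrp
      rw [Module.mem_annihilator]
      intro z
      obtain ⟨z, rfl⟩ := Submodule.mkQ_surjective _ z
      rw [← map_smul, hLp r hrp, map_zero]
    · rw [Ideal.span_le, Set.singleton_subset_iff, SetLike.mem_coe, Module.mem_annihilator]
      intro z
      obtain ⟨z, rfl⟩ := Submodule.mkQ_surjective _ z
      rw [← map_smul]
      obtain ⟨m, hm⟩ := Submodule.mkQ_surjective _ z.1
      refine (Submodule.Quotient.mk_eq_zero _).2 ⟨m, Subtype.ext ?_⟩
      change t • N.mkQ m = t • z.1
      rw [hm]
  have hC : Subsingleton (LC a d (L ⧸ LinearMap.range f)) := by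
    refine LC.subsingleton_devissage d _ (fun q hq hpq => ?_) _ hquot
    exact LC.vanish_lt hq (dim_lt_of_lt hp hq (lt_of_sup htp hpq) hpd.le)
  have hsurj := LC.map_surj_of (a := a) hd.le le_rfl f hC
  have e : (R ⧸ p) ≃ₗ[R] L := by
    refine LinearEquiv.ofBijective (Submodule.liftQ p
      (LinearMap.toSpanSingleton R L ⟨x, hxL⟩) ?_) ⟨?_, ?_⟩
    · intro r hrp
      exact hLp r hrp _
    · rw [← LinearMap.ker_eq_bot, eq_bot_iff]
      intro c hc
      obtain ⟨r, rfl⟩ := Submodule.mkQ_surjective _ c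
      have h1 : r • x = 0 := congrArg Subtype.val hc
      exact (Submodule.Quotient.mk_eq_zero _).2 ((hx' r).2 h1)
    · rintro ⟨z, hz⟩
      obtain ⟨c, rfl⟩ := Submodule.mem_span_singleton.1 hz
      exact ⟨p.mkQ c, rfl⟩
  refine ⟨hp, LinearMap.ker (LC.map a d f), ?_⟩
  rw [((LC.map a d f).quotKerEquivOfSurjective hsurj).annihilator_eq,
    ← (LC.equiv (a := a) (i := d) e).annihilator_eq, LC.ann_eq hp hpd.le]

end final
end LCT

/-- Over a complete local ring `(R, 𝔪)`, the attached primes of the top local cohomology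
`H^d_𝔞(M)` (`d = dim M`) are `{p ∈ Ass_R M : dim R/p = d and Rad(𝔞 + p) = 𝔪}`. -/
theorem stmt_8 {R : Type u} [CommRing R] [IsNoetherianRing R] [IsLocalRing R]
    [IsAdicComplete (IsLocalRing.maximalIdeal R) R] (𝔞 : Ideal R)
    (M : Type u) [AddCommGroup M] [Module R M] [Module.Finite R M] [Nontrivial M]
    (d : ℕ) (hd : modDim R M = (d : ℕ∞)) :
    {p : Ideal R | IsAttachedPrime R ((localCohomology 𝔞 d).obj (ModuleCat.of R M)) p} =
      {p ∈ associatedPrimes R M | ringKrullDim (R ⧸ p) = (d : WithBot ℕ∞) ∧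
        (𝔞 + p).radical = IsLocalRing.maximalIdeal R} := by
  have hd' : ringKrullDim (R ⧸ Module.annihilator R M) = (d : WithBot ℕ∞) := hd
  ext p
  rw [Set.mem_setOf_eq, Set.mem_setOf_eq, Submodule.add_eq_sup]
  constructor
  · intro h
    exact LCT.attached_sub M hd' (LCT.IsAttachedPrime.of_equiv (LCT.bridge 𝔞 d M).symm h)
  · rintro ⟨h1, h2, h3⟩
    exact LCT.IsAttachedPrime.of_equiv (LCT.bridge 𝔞 d M) (LCT.attached_sup M hd' h1 h2 h3)
end
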